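/- Let n < p ≤ q < ∞. If E and F contain complemented subspaces isomorphic to ℓ_p and ℓ_q respectively, then the quotient P(ⁿE;F)/P_K(ⁿE;F) does not have the approximation property. -/

import Mathlib

open scoped ENNReal

noncomputable section

/-- A normed space `E` has the approximation property if for every compact set `K` and `ε > 0`
there is a finite rank bounded operator `T : E → E` with `‖T x - x‖ < ε` on `K`. -/
def HasAP (𝕜 E : Type*) [NontriviallyNormedField 𝕜] [SeminormedAddCommGroup E]
    [NormedSpace 𝕜 E] : Prop :=
  ∀ K : Set E, IsCompact K → ∀ ε : ℝ, 0 < ε →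
    ∃ T : E →L[𝕜] E, FiniteDimensional 𝕜 (LinearMap.range (T : E →ₗ[𝕜] E)) ∧
      ∀ x ∈ K, ‖T x - x‖ < ε

/-- The closed subspace of symmetric continuous `n`-linear maps, our model for the Banach space
`P(ⁿE;F)` of continuous `n`-homogeneous polynomials from `E` to `F` (a polynomial is identified
with its unique symmetric generating multilinear map). -/
def SymmCM (𝕜 : Type*) [NontriviallyNormedField 𝕜] (n : ℕ) (E F : Type*)
    [NormedAddCommGroup E] [NormedSpace 𝕜 E] [NormedAddCommGroup F] [NormedSpace 𝕜 F] :
    Submodule 𝕜 (ContinuousMultilinearMap 𝕜 (fun _ : Fin n => E) F) where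
  carrier := {A | ∀ (σ : Equiv.Perm (Fin n)) (v : Fin n → E), A (v ∘ σ) = A v}
  add_mem' := by intro a b ha hb σ v; simp [ha σ v, hb σ v]
  zero_mem' := by intro σ v; simp
  smul_mem' := by intro c a ha σ v; simp [ha σ v]

/-- The Banach space of continuous `n`-homogeneous polynomials from `E` to `F`. -/
abbrev HomPoly (𝕜 : Type*) [NontriviallyNormedField 𝕜] (n : ℕ) (E F : Type*)
    [NormedAddCommGroup E] [NormedSpace 𝕜 E] [NormedAddCommGroup F] [NormedSpace 𝕜 F] :=
  ↥(SymmCM 𝕜 n E F)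

/-- Evaluation of a homogeneous polynomial on the diagonal. -/
def HomPoly.eval {𝕜 : Type*} [NontriviallyNormedField 𝕜] {n : ℕ} {E F : Type*}
    [NormedAddCommGroup E] [NormedSpace 𝕜 E] [NormedAddCommGroup F] [NormedSpace 𝕜 F]
    (P : HomPoly 𝕜 n E F) (x : E) : F :=
  (P : ContinuousMultilinearMap 𝕜 (fun _ : Fin n => E) F) (fun _ => x)

open scoped Pointwise

/-- A homogeneous polynomial is compact if it maps bounded sets to relatively compact sets. -/
def IsCompactPoly {𝕜 : Type*} [NontriviallyNormedField 𝕜] {n : ℕ} {E F : Type*}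
    [NormedAddCommGroup E] [NormedSpace 𝕜 E] [NormedAddCommGroup F] [NormedSpace 𝕜 F]
    (P : HomPoly 𝕜 n E F) : Prop :=
  ∀ S : Set E, Bornology.IsBounded S → IsCompact (closure (P.eval '' S))

def compactPolys (𝕜 : Type*) [NontriviallyNormedField 𝕜] (n : ℕ) (E F : Type*)
    [NormedAddCommGroup E] [NormedSpace 𝕜 E] [NormedAddCommGroup F] [NormedSpace 𝕜 F] :
    Submodule 𝕜 (HomPoly 𝕜 n E F) where
  carrier := {P | IsCompactPoly P}
  add_mem' := by
    intro P Q hP hQ S hS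
    have h1 := hP S hS
    have h2 := hQ S hS
    refine (h1.add h2).of_isClosed_subset isClosed_closure
      (closure_minimal ?_ (h1.add h2).isClosed)
    rintro y ⟨x, hx, rfl⟩
    have : (P + Q).eval x = P.eval x + Q.eval x := by
      simp [HomPoly.eval]
    rw [this]
    exact Set.add_mem_add (subset_closure (Set.mem_image_of_mem _ hx))
      (subset_closure (Set.mem_image_of_mem _ hx))
  zero_mem' := by
    intro S _
    refine (isCompact_singleton (x := (0:F))).of_isClosed_subset isClosed_closure
      (closure_minimal ?_ isClosed_singleton)
    rintro y ⟨x, -, rfl⟩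
    simp [HomPoly.eval]
  smul_mem' := by
    intro c P hP S hS
    have h1 := hP S hS
    have h2 : IsCompact (c • closure (P.eval '' S)) := h1.smul c
    refine h2.of_isClosed_subset isClosed_closure (closure_minimal ?_ h2.isClosed)
    rintro y ⟨x, hx, rfl⟩
    have : (c • P).eval x = c • P.eval x := by simp [HomPoly.eval]
    rw [this]
    exact Set.smul_mem_smul_set (subset_closure (Set.mem_image_of_mem _ hx))

namespace SzP

def xx (n k : ℕ) : ℕ := Nat.pair k (n % (k + 3))

def aa (τ h n x : ℕ) : ZMod 2 :=
  if h < n ∧ (n - 1 - h) % 3 = τ ∧ x = Nat.pair (n - 1 - h) (n % (n - 1 - h + 3)) ∧ x < h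
  then 1 else 0

lemma aa_lt {τ h n x : ℕ} (H : aa τ h n x ≠ 0) : x < h ∧ h < n := by
  unfold aa at H
  split_ifs at H with h1
  · exact ⟨h1.2.2.2, h1.1⟩
  · exact absurd rfl H

lemma aa_diag {τ n k k' : ℕ} (hv : xx n k < n - 1 - k) :
    aa τ (n - 1 - k) n (xx n k') = if k % 3 = τ ∧ k = k' then 1 else 0 := by
  have e : n - 1 - (n - 1 - k) = k := by omega
  have h0 : n - 1 - k < n := by omega
  unfold aa
  rw [e]
  by_cases hk : k = k'
  · subst hk
    have : xx n k = Nat.pair k (n % (k + 3)) := rfl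
    simp only [← this, hv, h0, true_and, and_true]
  · have : ¬ (xx n k' = Nat.pair k (n % (k + 3))) := by
      unfold xx
      rw [Nat.pair_eq_pair]
      tauto
    simp [this, hk]

lemma aa_later {τ h n n' k : ℕ} (hn : n < n') (H : aa τ h n' (xx n k) ≠ 0) : n < h := by
  unfold aa at H
  split_ifs at H with h1
  · obtain ⟨h1, -, h2, -⟩ := h1
    unfold xx at h2
    rw [Nat.pair_eq_pair] at h2
    obtain ⟨h2, h3⟩ := h2
    rw [← h2] at h3
    have h4 : n ≡ n' [MOD (k + 3)] := h3
    have h5 := (Nat.modEq_iff_dvd' hn.le).1 h4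
    have h6 := Nat.le_of_dvd (by omega) h5
    omega
  · exact absurd rfl H

def RR (n : ℕ) : ℕ := (Nat.sqrt n - 6) / 3

lemma xx_valid {n k : ℕ} (hk : k < 3 * RR n) : xx n k < n - 1 - k := by
  unfold RR at hk
  have h1 : k + 6 < Nat.sqrt n := by omega
  have h2 : Nat.sqrt n * Nat.sqrt n ≤ n := Nat.sqrt_le n
  have h3 : n % (k + 3) < k + 3 := Nat.mod_lt _ (by omega)
  have h4 : xx n k < (max k (n % (k + 3)) + 1) ^ 2 := Nat.pair_lt_max_add_one_sq _ _
  have h5 : max k (n % (k + 3)) + 1 ≤ k + 3 := by omega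
  have h6 : (max k (n % (k + 3)) + 1) ^ 2 ≤ (k + 3) ^ 2 := Nat.pow_le_pow_left h5 2
  nlinarith [Nat.sub_add_cancel (show 1 + k ≤ n by nlinarith), Nat.sub_sub n 1 k]

lemma xx_inj {n k k' : ℕ} (h : xx n k = xx n k') : k = k' := by
  unfold xx at h
  rw [Nat.pair_eq_pair] at h
  exact h.1

end SzP

namespace SzP

abbrev BB (L : ℕ) := Fin L → ZMod 2
abbrev VV (L : ℕ) := BB L × BB L × BB L
abbrev Lab (L : ℕ) := VV L × VV L
abbrev Idx (L : ℕ) := VV L × BB L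

def Phi {L : ℕ} (u : VV L) (x : BB L) : BB L := fun h =>
  ∑ n : Fin L, ∑ i : Fin L, (aa 0 h n i * u.1 n + aa 1 h n i * u.2.1 n + aa 2 h n i * u.2.2 n) * x i

lemma Phi_add_left {L : ℕ} (u v : VV L) (x : BB L) : Phi (u + v) x = Phi u x + Phi v x := by
  funext h
  simp only [Phi, Pi.add_apply, Prod.fst_add, Prod.snd_add, ← Finset.sum_add_distrib]
  refine Finset.sum_congr rfl fun n _ => Finset.sum_congr rfl fun i _ => ?_
  ring

lemma Phi_add_right {L : ℕ} (u : VV L) (x y : BB L) : Phi u (x + y) = Phi u x + Phi u y := by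
  funext h
  simp only [Phi, Pi.add_apply, ← Finset.sum_add_distrib]
  refine Finset.sum_congr rfl fun n _ => Finset.sum_congr rfl fun i _ => ?_
  ring

lemma bb_add_self {L : ℕ} (x : BB L) : x + x = 0 := by
  funext i; exact CharTwo.add_self_eq_zero _

lemma bb_add_self_left {L : ℕ} (x y : BB L) : x + (x + y) = y := by
  rw [← add_assoc, bb_add_self, zero_add]

def sg (𝕜 : Type*) [RCLike 𝕜] (a : ZMod 2) : 𝕜 := if a = 0 then 1 else -1

section
variable {𝕜 : Type*} [RCLike 𝕜]

lemma zmod2_cases (a : ZMod 2) : a = 0 ∨ a = 1 := by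
  revert a; decide

lemma sg_zero : sg 𝕜 0 = 1 := by simp [sg]
lemma sg_one : sg 𝕜 1 = -1 := by simp [sg]

lemma sg_add (a b : ZMod 2) : sg 𝕜 (a + b) = sg 𝕜 a * sg 𝕜 b := by
  have h2 : (1 : ZMod 2) + 1 = 0 := by decide
  rcases zmod2_cases a with rfl | rfl <;> rcases zmod2_cases b with rfl | rfl <;>
    simp [h2, sg_zero, sg_one]

lemma sg_norm (a : ZMod 2) : ‖sg 𝕜 a‖ = 1 := by
  rcases zmod2_cases a with rfl | rfl <;> simp [sg_zero, sg_one]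

lemma sg_mul_self (a : ZMod 2) : sg 𝕜 a * sg 𝕜 a = 1 := by
  rcases zmod2_cases a with rfl | rfl <;> simp [sg_zero, sg_one]

lemma sg_conj (a : ZMod 2) : (starRingEnd 𝕜) (sg 𝕜 a) = sg 𝕜 a := by
  rcases zmod2_cases a with rfl | rfl <;> simp [sg_zero, sg_one]

end

def fib {L : ℕ} (n : ℕ) (s : BB L) : Finset (BB L) :=
  Fintype.piFinset (fun i : Fin L => if (i : ℕ) < n then {s i} else Finset.univ)

lemma mem_fib {L n : ℕ} {s x : BB L} : x ∈ fib n s ↔ ∀ i : Fin L, (i : ℕ) < n → x i = s i := by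
  unfold fib
  rw [Fintype.mem_piFinset]
  refine forall_congr' fun i => ?_
  split_ifs with h <;> simp [h]

lemma card_fib {L n : ℕ} (s : BB L) (hn : n ≤ L) : (fib n s).card = 2 ^ (L - n) := by
  unfold fib
  rw [Fintype.card_piFinset]
  have : ∀ i : Fin L, (if (i : ℕ) < n then {s i} else (Finset.univ : Finset (ZMod 2))).card
      = if (i : ℕ) < n then 1 else 2 := by
    intro i; split_ifs <;> simp [ZMod.card]
  simp only [this]
  rw [Fin.prod_univ_eq_prod_range (fun i => if i < n then 1 else 2) L]
  obtain ⟨m, rfl⟩ := Nat.exists_eq_add_of_le hn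
  rw [Finset.prod_range_add]
  rw [Finset.prod_congr rfl (g := fun _ => 1)]
  · simp
  · intro i hi; simp [Finset.mem_range.1 hi]

lemma exists_max {L n : ℕ} {d : BB L} (hd : d ≠ 0) (hn : ∀ i : Fin L, (i : ℕ) < n → d i = 0) :
    ∃ j : Fin L, n ≤ j ∧ d j = 1 ∧ Phi (0, 0, d) (Pi.single j 1) = 0 := by
  have hne : (Finset.univ.filter (fun i => d i ≠ 0)).Nonempty := by
    by_contra h
    apply hd
    funext i
    by_contra hi
    exact h ⟨i, by simpa using hi⟩
  obtain ⟨j, hj, hmax⟩ := Finset.exists_max_image _ id hne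
  have hj' : d j ≠ 0 := by simpa using hj
  refine ⟨j, ?_, ?_, ?_⟩
  · by_contra h
    exact hj' (hn j (by omega))
  · rcases zmod2_cases (d j) with h | h
    · exact absurd h hj'
    · exact h
  · funext h
    simp only [Phi, Pi.zero_apply, mul_zero, zero_add]
    refine Finset.sum_eq_zero fun m _ => Finset.sum_eq_zero fun i _ => ?_
    by_cases hi : i = j
    · subst hi
      by_cases ha : aa 2 h m i = 0
      · simp [ha]
      · have h1 := aa_lt ha
        have : d m = 0 := by
          by_contra hm
          have := hmax m (by simpa using hm)
          simp only [id] at this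
          have : (m : ℕ) ≤ i := this
          omega
        simp [this]
    · simp [Pi.single_eq_of_ne hi]

section
variable {𝕜 : Type*} [RCLike 𝕜]

lemma flat_off {L n : ℕ} (s : BB L) (a b e e' : BB L) (g g' : BB L → 𝕜)
    (hee : e ≠ e') (hd : ∀ i : Fin L, (i : ℕ) < n → e i = e' i) :
    ∑ y ∈ fib n s, ∑ α : BB L, (sg 𝕜 (e ⬝ᵥ y) * g (α + Phi (a, b, e) y)) *
      (starRingEnd 𝕜) (sg 𝕜 (e' ⬝ᵥ y) * g' (α + Phi (a, b, e') y)) = 0 := by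
  have hd0 : e + e' ≠ 0 := by
    intro h
    apply hee
    rw [← bb_add_self_left e e', h, add_zero]
  obtain ⟨j, hj, hj1, hPhi⟩ := exists_max (n := n) hd0 (by
    intro i hi
    rw [Pi.add_apply, hd i hi]
    exact CharTwo.add_self_eq_zero _)
  have key : ∀ y, (∑ α : BB L, (sg 𝕜 (e ⬝ᵥ y) * g (α + Phi (a, b, e) y)) *
      (starRingEnd 𝕜) (sg 𝕜 (e' ⬝ᵥ y) * g' (α + Phi (a, b, e') y))) =
      sg 𝕜 ((e + e') ⬝ᵥ y) * ∑ α : BB L, g α * (starRingEnd 𝕜) (g' (α + Phi (0, 0, e + e') y)) := by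
    intro y
    rw [Finset.mul_sum]
    rw [← Equiv.sum_comp (Equiv.addRight (Phi (a, b, e) y))
      (fun α => sg 𝕜 ((e + e') ⬝ᵥ y) * (g α * (starRingEnd 𝕜) (g' (α + Phi (0, 0, e + e') y))))]
    refine Finset.sum_congr rfl fun α _ => ?_
    have h1 : ((0, 0, e + e') : VV L) = (a, b, e) + (a, b, e') := by
      ext1
      · simp [bb_add_self]
      · ext1
        · simp [bb_add_self]
        · rfl
    simp only [Equiv.coe_addRight]
    rw [h1, Phi_add_left, add_assoc α, bb_add_self_left, add_dotProduct, sg_add, map_mul, sg_conj]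
    ring
  simp only [key]
  refine Finset.sum_involution (fun y _ => y + Pi.single j 1) ?_ ?_ ?_ ?_
  · intro y _
    rw [Phi_add_right, hPhi, add_zero, dotProduct_add, sg_add]
    have : (e + e') ⬝ᵥ (Pi.single j 1) = 1 := by
      rw [dotProduct_single, hj1, mul_one]
    rw [this, sg_one]
    ring
  · intro y _ _ h
    have := congrFun h j
    simp at this
  · intro y hy
    rw [mem_fib] at hy ⊢
    intro i hi
    rw [Pi.add_apply, hy i hi, Pi.single_eq_of_ne, add_zero]
    rintro rfl
    omega
  · intro y _
    rw [add_assoc, bb_add_self, add_zero]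

lemma flat1 {L n : ℕ} (hn : n ≤ L) (s s2 : BB L) (a b : BB L) (g : BB L → BB L → 𝕜) :
    ∑ y ∈ fib n s, ∑ α : BB L,
      ‖∑ e ∈ fib n s2, sg 𝕜 (e ⬝ᵥ y) * g e (α + Phi (a, b, e) y)‖ ^ 2
      ≤ 2 ^ (L - n) * ∑ e : BB L, ∑ α : BB L, ‖g e α‖ ^ 2 := by
  have main : ∑ y ∈ fib n s, ∑ α : BB L,
      ‖∑ e ∈ fib n s2, sg 𝕜 (e ⬝ᵥ y) * g e (α + Phi (a, b, e) y)‖ ^ 2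
      = 2 ^ (L - n) * ∑ e ∈ fib n s2, ∑ α : BB L, ‖g e α‖ ^ 2 := by
    have inj : Function.Injective (RCLike.ofReal : ℝ → 𝕜) := RCLike.ofReal_injective
    apply inj
    push_cast
    simp only [← RCLike.mul_conj, map_sum, Finset.sum_mul_sum]
    have h1 : ∀ y ∈ fib n s, ∑ α : BB L, ∑ e ∈ fib n s2, ∑ e' ∈ fib n s2,
        (sg 𝕜 (e ⬝ᵥ y) * g e (α + Phi (a, b, e) y)) *
        (starRingEnd 𝕜) (sg 𝕜 (e' ⬝ᵥ y) * g e' (α + Phi (a, b, e') y)) =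
        ∑ e ∈ fib n s2, ∑ e' ∈ fib n s2, ∑ α : BB L,
        (sg 𝕜 (e ⬝ᵥ y) * g e (α + Phi (a, b, e) y)) *
        (starRingEnd 𝕜) (sg 𝕜 (e' ⬝ᵥ y) * g e' (α + Phi (a, b, e') y)) := by
      intro y _
      rw [Finset.sum_comm]
      refine Finset.sum_congr rfl fun e _ => ?_
      rw [Finset.sum_comm]
    rw [Finset.sum_congr rfl h1, Finset.sum_comm, Finset.mul_sum]
    refine Finset.sum_congr rfl fun e he => ?_
    rw [Finset.sum_comm, Finset.sum_eq_single_of_mem e he]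
    · have h2 : ∀ y ∈ fib n s, ∑ α : BB L, (sg 𝕜 (e ⬝ᵥ y) * g e (α + Phi (a, b, e) y)) *
        (starRingEnd 𝕜) (sg 𝕜 (e ⬝ᵥ y) * g e (α + Phi (a, b, e) y)) =
        ∑ α : BB L, g e α * (starRingEnd 𝕜) (g e α) := by
        intro y _
        rw [← Equiv.sum_comp (Equiv.addRight (Phi (a, b, e) y))
          (fun α => g e α * (starRingEnd 𝕜) (g e α))]
        refine Finset.sum_congr rfl fun α _ => ?_
        simp only [Equiv.coe_addRight]
        rw [map_mul, sg_conj]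
        linear_combination (g e (α + Phi (a, b, e) y) *
          (starRingEnd 𝕜) (g e (α + Phi (a, b, e) y))) * sg_mul_self (𝕜 := 𝕜) (e ⬝ᵥ y)
      rw [Finset.sum_congr rfl h2, Finset.sum_const, card_fib s hn, nsmul_eq_mul]
      push_cast
      rfl
    · intro e' he' hne
      refine flat_off s a b e e' (g e) (g e') hne.symm ?_
      intro i hi
      rw [mem_fib] at he he'
      rw [he i hi, he' i hi]
  rw [main]
  gcongr
  exact Finset.subset_univ _

end

end SzP

namespace SzP

def row {L : ℕ} (t : Lab L) : Idx L := (t.2, t.1.1 + Phi t.2 t.1.2.1)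
def col {L : ℕ} (t : Lab L) : Idx L := (t.1, t.2.1 + Phi t.1 t.2.2.1)
def chi (𝕜 : Type*) [RCLike 𝕜] {L : ℕ} (t : Lab L) : 𝕜 :=
  sg 𝕜 (t.2.2.2 ⬝ᵥ t.1.2.1 + t.1.2.2 ⬝ᵥ t.2.2.1)

def fibV {L : ℕ} (n : ℕ) (s : VV L) : Finset (VV L) := fib n s.1 ×ˢ (fib n s.2.1 ×ˢ fib n s.2.2)
def cls {L : ℕ} (n : ℕ) (s : Lab L) : Finset (Lab L) := fibV n s.1 ×ˢ fibV n s.2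

lemma row_swap {L : ℕ} (t : Lab L) : row t.swap = col t := rfl
lemma col_swap {L : ℕ} (t : Lab L) : col t.swap = row t := rfl
lemma chi_swap {𝕜 : Type*} [RCLike 𝕜] {L : ℕ} (t : Lab L) : chi 𝕜 t.swap = chi 𝕜 t := by
  simp only [chi, Prod.fst_swap, Prod.snd_swap]
  congr 1
  exact add_comm _ _

lemma rc_inj {L : ℕ} {t t' : Lab L} (h1 : row t = row t') (h2 : col t = col t') : t = t' := by
  have a := congrArg Prod.fst h1
  have b := congrArg Prod.fst h2
  exact Prod.ext b a

lemma mem_cls {L n : ℕ} {s t : Lab L} : t ∈ cls n s ↔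
    ((t.1.1 ∈ fib n s.1.1 ∧ t.1.2.1 ∈ fib n s.1.2.1 ∧ t.1.2.2 ∈ fib n s.1.2.2) ∧
    (t.2.1 ∈ fib n s.2.1 ∧ t.2.2.1 ∈ fib n s.2.2.1 ∧ t.2.2.2 ∈ fib n s.2.2.2)) := by
  simp only [cls, fibV, Finset.mem_product]

lemma card_fibV {L n : ℕ} (s : VV L) (hn : n ≤ L) : (fibV n s).card = 8 ^ (L - n) := by
  simp only [fibV, Finset.card_product, card_fib _ hn, ← mul_pow]
  norm_num

lemma card_cls {L n : ℕ} (s : Lab L) (hn : n ≤ L) : (cls n s).card = 64 ^ (L - n) := by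
  simp only [cls, Finset.card_product, card_fibV _ hn, ← mul_pow]
  norm_num

lemma mem_cls_swap {L n : ℕ} {s t : Lab L} : t.swap ∈ cls n s.swap ↔ t ∈ cls n s := by
  simp only [cls, Finset.mem_product, Prod.fst_swap, Prod.snd_swap]
  exact and_comm

lemma sum_cls_swap {M : Type*} [AddCommMonoid M] {L n : ℕ} (s : Lab L) (F : Lab L → M) :
    ∑ t ∈ cls n s.swap, F t = ∑ t ∈ cls n s, F t.swap := by
  symm
  refine Finset.sum_bij' (fun t _ => t.swap) (fun t _ => t.swap) ?_ ?_ ?_ ?_ ?_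
  · intro t ht; exact mem_cls_swap.2 ht
  · intro t ht; rw [← mem_cls_swap, Prod.swap_swap]; exact ht
  · intros; simp
  · intros; simp
  · intros; rfl

section
variable {𝕜 : Type*} [RCLike 𝕜]

lemma sum_split {L : ℕ} (A0 A1 A2 C0 C1 C2 : Finset (BB L)) (F : BB L → BB L → BB L → BB L → BB L → 𝕜)
   (G : BB L → BB L → BB L → BB L → BB L → 𝕜) :
   ∑ t ∈ (A0 ×ˢ (A1 ×ˢ A2)) ×ˢ (C0 ×ˢ (C1 ×ˢ C2)),
     F t.1.1 t.1.2.1 t.2.1 t.2.2.1 t.2.2.2 * G t.1.1 t.1.2.1 t.2.1 t.2.2.1 t.1.2.2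
   = ∑ x ∈ (A0 ×ˢ A1) ×ˢ (C0 ×ˢ C1), (∑ o ∈ C2, F x.1.1 x.1.2 x.2.1 x.2.2 o) *
      (∑ e ∈ A2, G x.1.1 x.1.2 x.2.1 x.2.2 e) := by
  simp only [Finset.sum_product]
  refine Finset.sum_congr rfl fun e0 _ => Finset.sum_congr rfl fun e1 _ => ?_
  rw [Finset.sum_comm]
  refine Finset.sum_congr rfl fun o0 _ => ?_
  rw [Finset.sum_comm]
  refine Finset.sum_congr rfl fun o1 _ => ?_
  rw [Finset.sum_mul_sum, Finset.sum_comm]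

lemma flat2 {L n : ℕ} (hn : n ≤ L) (s : Lab L) (g : Idx L → 𝕜) :
    ∑ x ∈ (fib n s.1.1 ×ˢ fib n s.1.2.1) ×ˢ (fib n s.2.1 ×ˢ fib n s.2.2.1),
      ‖∑ e ∈ fib n s.1.2.2, sg 𝕜 (e ⬝ᵥ x.2.2) *
        g ((x.1.1, x.1.2, e), x.2.1 + Phi (x.1.1, x.1.2, e) x.2.2)‖ ^ 2
    ≤ 2 ^ (L - n) * ∑ i, ‖g i‖ ^ 2 := by
  calc _ ≤ ∑ e0 : BB L, ∑ e1 : BB L, ∑ o1 ∈ fib n s.2.2.1, ∑ o0 : BB L,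
      ‖∑ e ∈ fib n s.1.2.2, sg 𝕜 (e ⬝ᵥ o1) *
        g ((e0, e1, e), o0 + Phi (e0, e1, e) o1)‖ ^ 2 := by
        simp only [Finset.sum_product]
        refine (Finset.sum_le_sum_of_subset_of_nonneg (Finset.subset_univ _) ?_).trans ?_
        · intros; positivity
        refine Finset.sum_le_sum fun e0 _ => ?_
        refine (Finset.sum_le_sum_of_subset_of_nonneg (Finset.subset_univ _) ?_).trans ?_
        · intros; positivity
        refine Finset.sum_le_sum fun e1 _ => ?_
        rw [Finset.sum_comm]
        refine Finset.sum_le_sum fun o1 _ => ?_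
        refine (Finset.sum_le_sum_of_subset_of_nonneg (Finset.subset_univ _) ?_)
        intros; positivity
    _ ≤ ∑ e0 : BB L, ∑ e1 : BB L, (2 ^ (L - n) * ∑ e : BB L, ∑ α : BB L, ‖g ((e0, e1, e), α)‖ ^ 2) := by
        refine Finset.sum_le_sum fun e0 _ => Finset.sum_le_sum fun e1 _ => ?_
        exact flat1 hn s.2.2.1 s.1.2.2 e0 e1 (fun e α => g ((e0, e1, e), α))
    _ = _ := by
        simp only [← Finset.mul_sum, Fintype.sum_prod_type]

lemma flat {L n : ℕ} (hn : n ≤ L) (s : Lab L) (f g : Idx L → 𝕜) :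
    ‖∑ t ∈ cls n s, chi 𝕜 t * f (row t) * g (col t)‖
      ≤ 2 ^ (L - n) * (√(∑ i, ‖f i‖ ^ 2) * √(∑ i, ‖g i‖ ^ 2)) := by
  have h1 : ∑ t ∈ cls n s, chi 𝕜 t * f (row t) * g (col t) =
     ∑ x ∈ (fib n s.1.1 ×ˢ fib n s.1.2.1) ×ˢ (fib n s.2.1 ×ˢ fib n s.2.2.1),
     (∑ o ∈ fib n s.2.2.2, sg 𝕜 (o ⬝ᵥ x.1.2) *
        f ((x.2.1, x.2.2, o), x.1.1 + Phi (x.2.1, x.2.2, o) x.1.2)) *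
     (∑ e ∈ fib n s.1.2.2, sg 𝕜 (e ⬝ᵥ x.2.2) *
        g ((x.1.1, x.1.2, e), x.2.1 + Phi (x.1.1, x.1.2, e) x.2.2)) := by
    rw [← sum_split (fib n s.1.1) (fib n s.1.2.1) (fib n s.1.2.2) (fib n s.2.1) (fib n s.2.2.1)
      (fib n s.2.2.2) (fun e0 e1 o0 o1 o => sg 𝕜 (o ⬝ᵥ e1) *
        f ((o0, o1, o), e0 + Phi (o0, o1, o) e1)) (fun e0 e1 o0 o1 e => sg 𝕜 (e ⬝ᵥ o1) *
        g ((e0, e1, e), o0 + Phi (e0, e1, e) o1))]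
    refine Finset.sum_congr rfl fun t _ => ?_
    simp only [chi, row, col, sg_add]
    ring
  rw [h1]
  have hG := flat2 hn s g
  have hF : ∑ x ∈ (fib n s.1.1 ×ˢ fib n s.1.2.1) ×ˢ (fib n s.2.1 ×ˢ fib n s.2.2.1),
     ‖∑ o ∈ fib n s.2.2.2, sg 𝕜 (o ⬝ᵥ x.1.2) *
        f ((x.2.1, x.2.2, o), x.1.1 + Phi (x.2.1, x.2.2, o) x.1.2)‖ ^ 2
      ≤ 2 ^ (L - n) * ∑ i, ‖f i‖ ^ 2 := by
    have := flat2 hn s.swap f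
    simp only [Prod.fst_swap, Prod.snd_swap] at this
    rw [Finset.sum_product_right]
    rw [Finset.sum_product] at this
    exact this
  refine (norm_sum_le _ _).trans ?_
  simp only [norm_mul]
  refine (Real.sum_mul_le_sqrt_mul_sqrt _ _ _).trans ?_
  refine (mul_le_mul (Real.sqrt_le_sqrt hF) (Real.sqrt_le_sqrt hG) (by positivity) (by positivity)).trans ?_
  rw [Real.sqrt_mul (by positivity), Real.sqrt_mul (by positivity)]
  rw [mul_mul_mul_comm, Real.mul_self_sqrt (by positivity)]

end
end SzP

namespace SzP

def cmp {L : ℕ} (τ : ℕ) (u : VV L) : BB L :=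
  if τ = 0 then u.1 else if τ = 1 then u.2.1 else u.2.2

lemma Phi_eq {L : ℕ} (u : VV L) (x : BB L) (h : Fin L) : Phi u x h =
    ∑ n : Fin L, ∑ i : Fin L, ∑ τ ∈ Finset.range 3, aa τ h n i * cmp τ u n * x i := by
  simp only [Phi, Finset.sum_range_succ, Finset.sum_range_zero, cmp]
  refine Finset.sum_congr rfl fun n _ => Finset.sum_congr rfl fun i _ => ?_
  simp
  ring

lemma cmp_add {L : ℕ} (τ : ℕ) (u v : VV L) : cmp τ (u + v) = cmp τ u + cmp τ v := by
  unfold cmp; split_ifs <;> rfl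

lemma mem_fibV {L n : ℕ} {u v : VV L} : u ∈ fibV n v ↔ ∀ τ, cmp τ u ∈ fib n (cmp τ v) := by
  simp only [fibV, Finset.mem_product]
  constructor
  · rintro ⟨h0, h1, h2⟩ τ
    unfold cmp; split_ifs <;> assumption
  · intro h
    exact ⟨h 0, h 1, h 2⟩

def Dd (L n τ : ℕ) {R : ℕ} (δ : Fin R → ZMod 2) : BB L := fun i =>
  ∑ j : Fin R, if (i : ℕ) = xx n (3 * j + τ) then δ j else 0

lemma Dd_ne {L n τ R : ℕ} {δ : Fin R → ZMod 2} {i : Fin L} (h : Dd L n τ δ i ≠ 0) :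
    ∃ k, (i : ℕ) = xx n k := by
  obtain ⟨j, -, hj⟩ := Finset.exists_ne_zero_of_sum_ne_zero h
  by_contra hh
  push Not at hh
  exact hj (if_neg (hh _))

lemma Dd_add {L n τ R : ℕ} (δ δ' : Fin R → ZMod 2) :
    Dd L n τ (δ + δ') = Dd L n τ δ + Dd L n τ δ' := by
  funext i
  simp only [Dd, Pi.add_apply, ← Finset.sum_add_distrib]
  refine Finset.sum_congr rfl fun j _ => ?_
  split_ifs <;> simp

lemma Dd_at {L n τ R : ℕ} (δ : Fin R → ZMod 2) (j : Fin R) (i : Fin L)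
    (hi : (i : ℕ) = xx n (3 * j + τ)) : Dd L n τ δ i = δ j := by
  unfold Dd
  rw [Finset.sum_eq_single j]
  · rw [if_pos hi]
  · intro j' _ hne
    rw [if_neg]
    rw [hi]
    intro h
    have := xx_inj h
    apply hne
    ext
    omega
  · simp

lemma Phi_lt {L : ℕ} (u : VV L) (x x' : BB L) (h : Fin L) (hx : ∀ i : Fin L, i < h → x i = x' i) :
    Phi u x h = Phi u x' h := by
  rw [Phi_eq, Phi_eq]
  refine Finset.sum_congr rfl fun n _ => Finset.sum_congr rfl fun i _ =>
    Finset.sum_congr rfl fun τ _ => ?_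
  by_cases ha : aa τ h n i = 0
  · simp [ha]
  · rw [hx i (aa_lt ha).1]

lemma Phi_prefix {L n τ R : ℕ} (δ : Fin R → ZMod 2) (o o' : VV L) (x : BB L)
    (ho : o ∈ fibV (n + 1) o') (hx : x ∈ fib (n + 1) (Dd L n τ δ)) :
    Phi o x ∈ fib (n + 1) (Phi o' (Dd L n τ δ)) := by
  rw [mem_fib]
  intro h hh
  rw [mem_fib] at hx
  rw [mem_fibV] at ho
  rw [Phi_eq, Phi_eq]
  refine Finset.sum_congr rfl fun n' _ => Finset.sum_congr rfl fun i _ =>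
    Finset.sum_congr rfl fun τ' _ => ?_
  by_cases ha : aa τ' h n' i = 0
  · simp [ha]
  · have h1 := aa_lt ha
    rw [hx i (by omega)]
    by_cases hn' : (n' : ℕ) < n + 1
    · rw [mem_fib.1 (ho τ') n' hn']
    · have : Dd L n τ δ i = 0 := by
        by_contra hne
        obtain ⟨k, hk⟩ := Dd_ne hne
        rw [hk] at ha
        have := aa_later (by omega) ha
        omega
      simp [this]

def act {L : ℕ} (D : BB L) (t : Lab L) : Lab L :=
  ((t.1.1 + Phi t.2 D, t.1.2.1 + D, t.1.2.2), t.2)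

lemma act_act {L : ℕ} (D : BB L) (t : Lab L) : act D (act D t) = t := by
  simp only [act, add_assoc, bb_add_self, add_zero]

lemma Phi_Dd {L n τ R : ℕ} (δ : Fin R → ZMod 2) (w : VV L) (h : Fin L)
    (hv : ∀ j : Fin R, xx n (3 * j + τ) < L) :
    Phi w (Dd L n τ δ) h = ∑ n' : Fin L, ∑ j : Fin R, ∑ τ' ∈ Finset.range 3,
      aa τ' h n' (xx n (3 * j + τ)) * cmp τ' w n' * δ j := by
  rw [Phi_eq]
  refine Finset.sum_congr rfl fun n' _ => ?_
  simp only [Dd, Finset.mul_sum]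
  have : ∀ i : Fin L, ∑ τ' ∈ Finset.range 3, ∑ j : Fin R, aa τ' h n' i * cmp τ' w n' *
      (if (i : ℕ) = xx n (3 * j + τ) then δ j else 0) =
      ∑ j : Fin R, ∑ τ' ∈ Finset.range 3, (if i = ⟨xx n (3 * j + τ), hv j⟩ then
        aa τ' h n' (xx n (3 * j + τ)) * cmp τ' w n' * δ j else 0) := by
    intro i
    rw [Finset.sum_comm]
    refine Finset.sum_congr rfl fun j _ => Finset.sum_congr rfl fun τ' _ => ?_
    by_cases hij : (i : ℕ) = xx n (3 * j + τ)
    · have : i = ⟨xx n (3 * j + τ), hv j⟩ := Fin.ext hij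
      rw [if_pos hij, if_pos this, hij]
    · have : ¬ i = ⟨xx n (3 * j + τ), hv j⟩ := by
        intro h; exact hij (congrArg Fin.val h)
      rw [if_neg hij, if_neg this, mul_zero]
  simp only [this]
  rw [Finset.sum_comm]
  refine Finset.sum_congr rfl fun j _ => ?_
  rw [Finset.sum_comm]
  refine Finset.sum_congr rfl fun τ' _ => ?_
  simp

lemma Phi_flip {L n τ R : ℕ} (hn : n < L) (hR : R ≤ RR n) (hτ : τ < 3) (δ : Fin R → ZMod 2)
    (w : VV L) (hw : ∀ τ', ∀ i : Fin L, (i : ℕ) < n → cmp τ' w i = 0)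
    (hw1 : cmp τ w ⟨n, hn⟩ = 1) (j : Fin R) (h : Fin L) (hh : (h : ℕ) = n - 1 - (3 * j + τ)) :
    Phi w (Dd L n τ δ) h = δ j := by
  have hval : ∀ j : Fin R, xx n (3 * j + τ) < n - 1 - (3 * j + τ) :=
    fun j => xx_valid (by have := j.2; omega)
  rw [Phi_Dd _ _ _ (fun j => by have := hval j; omega)]
  rw [Finset.sum_eq_single ⟨n, hn⟩, Finset.sum_eq_single j, Finset.sum_eq_single τ]
  · rw [hw1, hh]
    simp only
    rw [aa_diag (hval j), if_pos]
    · ring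
    · constructor
      · omega
      · rfl
  · intro τ' _ hne
    simp only
    rw [hh, aa_diag (hval j), if_neg]
    · ring
    · intro h; omega
  · simp [hτ]
  · intro j' _ hne
    refine Finset.sum_eq_zero fun τ' _ => ?_
    simp only
    rw [hh, aa_diag (hval j), if_neg]
    · ring
    · rintro ⟨-, h⟩
      apply hne
      ext
      omega
  · simp
  · intro n' _ hne
    refine Finset.sum_eq_zero fun j' _ => Finset.sum_eq_zero fun τ' _ => ?_
    by_cases h1 : (n' : ℕ) < n
    · rw [hw τ' n' h1]; ring
    · have h2 : n < (n' : ℕ) := by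
        have : (n' : ℕ) ≠ n := fun h => hne (Fin.ext h)
        omega
      by_cases ha : aa τ' h n' (xx n (3 * j' + τ)) = 0
      · rw [ha]; ring
      · have := aa_later h2 ha
        have := hval j
        omega
  · simp

lemma disjA {L n τ R : ℕ} (hn : n < L) (hR : R ≤ RR n) (hτ : τ < 3) (s c : Lab L)
    (hc1 : ∀ τ', ∀ i : Fin L, (i : ℕ) < n → cmp τ' c.1 i = 0)
    (hc2 : ∀ τ', ∀ i : Fin L, (i : ℕ) < n → cmp τ' c.2 i = 0)
    (hcτ : cmp τ c.2 ⟨n, hn⟩ = 1) (δ δ' : Fin R → ZMod 2) (hδ : δ ≠ δ') (t t' : Lab L)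
    (ht : t ∈ cls (n + 1) (act (Dd L n τ δ) s + c)) (ht' : t' ∈ cls (n + 1) (act (Dd L n τ δ') s + c)) :
    row t ≠ row t' ∧ col t ≠ col t' := by
  obtain ⟨j, hj⟩ := Function.ne_iff.1 hδ
  have hval : xx n (3 * j + τ) < n - 1 - (3 * j + τ) := xx_valid (by have := j.2; omega)
  rw [cls, Finset.mem_product] at ht ht'
  constructor
  · intro heq
    have h1 : t.2 = t'.2 := congrArg Prod.fst heq
    have h2 := congrFun (congrArg Prod.snd heq) ⟨n - 1 - (3 * j + τ), by omega⟩
    set h : Fin L := ⟨n - 1 - (3 * j + τ), by omega⟩ with hh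
    have hhn : (h : ℕ) < n := by
      have := xx_valid (n := n) (k := 3 * j + τ) (by have := j.2; omega)
      simp only [hh]; omega
    simp only [row, Pi.add_apply, ← h1] at h2
    have e0 := mem_fib.1 (mem_fibV.1 ht.1 0) h (by omega)
    have e0' := mem_fib.1 (mem_fibV.1 ht'.1 0) h (by omega)
    have c0 := hc1 0 h hhn
    have c1 : ∀ i : Fin L, i < h → c.1.2.1 i = 0 := fun i hi => hc1 1 i (by
      have : (i : ℕ) < h := hi
      omega)
    have e1 : ∀ i : Fin L, i < h → t.1.2.1 i = (s.1.2.1 + Dd L n τ δ) i := fun i hi => by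
      have h3 : (i : ℕ) < h := hi
      have := mem_fib.1 (mem_fibV.1 ht.1 1) i (by omega)
      simp only [cmp, act] at this
      simpa [c1 i hi] using this
    have e1' : ∀ i : Fin L, i < h → t'.1.2.1 i = (s.1.2.1 + Dd L n τ δ') i := fun i hi => by
      have h3 : (i : ℕ) < h := hi
      have := mem_fib.1 (mem_fibV.1 ht'.1 1) i (by omega)
      simp only [cmp, act] at this
      simpa [c1 i hi] using this
    rw [Phi_lt _ _ _ h e1, Phi_lt _ _ _ h e1'] at h2
    simp only [cmp, act, if_true] at e0 e0' c0
    simp only [Prod.fst_add, Pi.add_apply, c0, add_zero] at e0 e0'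
    rw [e0, e0', Phi_add_right, Phi_add_right] at h2
    simp only [Pi.add_apply] at h2
    have hw := Phi_flip hn hR hτ (δ + δ') (s.2 + t.2) (by
      intro τ' i hi
      have := mem_fib.1 (mem_fibV.1 ht.2 τ') i (by omega)
      rw [cmp_add, Pi.add_apply, this, Prod.snd_add, cmp_add, Pi.add_apply, hc2 τ' i hi, add_zero]
      exact CharTwo.add_self_eq_zero _) (by
      have := mem_fib.1 (mem_fibV.1 ht.2 τ) ⟨n, hn⟩ (by simp)
      rw [cmp_add, Pi.add_apply, this, Prod.snd_add, cmp_add, Pi.add_apply, hcτ, ← add_assoc]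
      have : cmp τ s.2 ⟨n, hn⟩ + cmp τ s.2 ⟨n, hn⟩ = 0 := CharTwo.add_self_eq_zero _
      simp only [act]
      rw [this, zero_add]) j h rfl
    rw [Dd_add, Phi_add_right, Phi_add_left, Phi_add_left] at hw
    simp only [Pi.add_apply] at hw
    have h5 : δ j + δ' j = 0 := by
      rw [← hw]
      have h6 : Phi s.2 (Dd L n τ δ) h + Phi t.2 (Dd L n τ δ) h =
        Phi s.2 (Dd L n τ δ') h + Phi t.2 (Dd L n τ δ') h := by
        linear_combination h2
      rw [h6]
      exact CharTwo.add_self_eq_zero _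
    apply hj
    rwa [CharTwo.add_eq_zero] at h5
  · intro heq
    have h1 : t.1 = t'.1 := (congrArg Prod.fst heq : (col t).1 = (col t').1)
    have hx : xx n (3 * j + τ) < L := by omega
    have e1 := mem_fib.1 (mem_fibV.1 ht.1 1) ⟨xx n (3 * j + τ), hx⟩ (by simp; omega)
    have e1' := mem_fib.1 (mem_fibV.1 ht'.1 1) ⟨xx n (3 * j + τ), hx⟩ (by simp; omega)
    rw [← h1, e1] at e1'
    simp only [cmp, act] at e1'
    simp at e1'
    rw [Dd_at δ j _ rfl, Dd_at δ' j _ rfl] at e1'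
    exact hj e1'

lemma cls_disj {L n τ R : ℕ} (hn : n < L) (hR : R ≤ RR n) (hτ : τ < 3) (s : Lab L)
    (δ δ' : Fin R → ZMod 2) (hδ : δ ≠ δ') (t : Lab L)
    (ht : t ∈ cls (n + 1) (act (Dd L n τ δ) s)) (ht' : t ∈ cls (n + 1) (act (Dd L n τ δ') s)) :
    False := by
  obtain ⟨j, hj⟩ := Function.ne_iff.1 hδ
  have hval : xx n (3 * j + τ) < n - 1 - (3 * j + τ) := xx_valid (by have := j.2; omega)
  rw [cls, Finset.mem_product] at ht ht'
  have hx : xx n (3 * j + τ) < L := by omega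
  have e1 := mem_fib.1 (mem_fibV.1 ht.1 1) ⟨xx n (3 * j + τ), hx⟩ (by simp; omega)
  have e1' := mem_fib.1 (mem_fibV.1 ht'.1 1) ⟨xx n (3 * j + τ), hx⟩ (by simp; omega)
  rw [e1] at e1'
  simp only [cmp, act] at e1'
  simp at e1'
  rw [Dd_at δ j _ rfl, Dd_at δ' j _ rfl] at e1'
  exact hj e1'

def rowsB {L : ℕ} (n : ℕ) (s : Lab L) : Finset (Idx L) :=
  (fibV (n + 1) s.2 ×ˢ fib (n + 1) s.1.1).image (fun x => (x.1, x.2 + Phi x.1 s.1.2.1))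

lemma card_rowsB {L n : ℕ} (hn : n < L) (s : Lab L) : (rowsB n s).card ≤ 16 ^ (L - (n + 1)) := by
  refine Finset.card_image_le.trans ?_
  rw [Finset.card_product, card_fibV _ hn, card_fib _ hn, ← mul_pow]
  norm_num

lemma row_mem_rowsB {L n τ R : ℕ} (s : Lab L) (δ : Fin R → ZMod 2) (t : Lab L)
    (ht : t ∈ cls (n + 1) (act (Dd L n τ δ) s)) : row t ∈ rowsB n s := by
  rw [cls, Finset.mem_product] at ht
  rw [rowsB, Finset.mem_image]
  refine ⟨(t.2, t.1.1 + Phi t.2 (t.1.2.1 + s.1.2.1)), ?_, ?_⟩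
  · rw [Finset.mem_product]
    refine ⟨ht.2, ?_⟩
    have h1 := Phi_prefix (τ := τ) δ t.2 s.2 (t.1.2.1 + s.1.2.1) ht.2 (by
      rw [mem_fib]
      intro i hi
      have := mem_fib.1 (mem_fibV.1 ht.1 1) i hi
      simp only [cmp, act] at this
      simp at this
      rw [Pi.add_apply, this]
      linear_combination CharTwo.add_self_eq_zero (s.1.2.1 i))
    rw [mem_fib] at h1 ⊢
    intro i hi
    have := mem_fib.1 (mem_fibV.1 ht.1 0) i hi
    simp only [cmp, act] at this
    simp at this
    simp only [Pi.add_apply]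
    rw [h1 i hi, this]
    linear_combination CharTwo.add_self_eq_zero (Phi s.2 (Dd L n τ δ) i)
  · simp only [row]
    rw [Phi_add_right, add_assoc, add_assoc, bb_add_self, add_zero]

end SzP

namespace SzP

def rsB {m : ℕ} (L : ℕ) (f : BB m) : BB L := fun i => if h : (i : ℕ) < m then f ⟨i, h⟩ else 0
def rsV {m : ℕ} (L : ℕ) (u : VV m) : VV L := (rsB L u.1, rsB L u.2.1, rsB L u.2.2)
def rs {m : ℕ} (L : ℕ) (t : Lab m) : Lab L := (rsV L t.1, rsV L t.2)

lemma rsB_add {m L : ℕ} (f g : BB m) : rsB L (f + g) = rsB L f + rsB L g := by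
  funext i; simp only [rsB, Pi.add_apply]; split_ifs <;> simp

lemma rs_add {m L : ℕ} (s t : Lab m) : rs L (s + t) = rs L s + rs L t := by
  simp only [rs, rsV, Prod.fst_add, Prod.snd_add, rsB_add]; rfl

lemma rs_swap {m L : ℕ} (s : Lab m) : rs L s.swap = (rs L s).swap := rfl

lemma cmp_rsV {m L : ℕ} (τ : ℕ) (u : VV m) : cmp τ (rsV L u) = rsB L (cmp τ u) := by
  unfold cmp; split_ifs <;> rfl

lemma fib_congr {L m : ℕ} {a b : BB L} (h : a ∈ fib m b) : fib m a = fib m b := by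
  ext x
  rw [mem_fib] at *
  rw [mem_fib]
  constructor
  · intro hx i hi; rw [hx i hi, h i hi]
  · intro hx i hi; rw [hx i hi, h i hi]

lemma fibV_congr {L m : ℕ} {a b : VV L} (h : a ∈ fibV m b) : fibV m a = fibV m b := by
  have h' := mem_fibV.1 h
  unfold fibV
  have h0 := fib_congr (h' 0)
  have h1 := fib_congr (h' 1)
  have h2 := fib_congr (h' 2)
  simp only [cmp] at h0 h1 h2
  simp at h0 h1 h2
  rw [h0, h1, h2]

lemma cls_congr {L m : ℕ} {a b : Lab L} (h : a ∈ cls m b) : cls m a = cls m b := by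
  rw [cls, Finset.mem_product] at h
  unfold cls
  rw [fibV_congr h.1, fibV_congr h.2]

lemma sum_castLE {M : Type*} [AddCommMonoid M] {m L : ℕ} (hm : m ≤ L) (F : Fin L → M)
    (hF : ∀ i : Fin L, m ≤ i → F i = 0) : ∑ i, F i = ∑ i : Fin m, F (Fin.castLE hm i) := by
  have : ∑ i : Fin m, F (Fin.castLE hm i) = ∑ i ∈ Finset.univ.map (Fin.castLEEmb hm), F i := by
    rw [Finset.sum_map]; rfl
  rw [this]
  symm
  refine Finset.sum_subset (Finset.subset_univ _) ?_
  intro i _ hi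
  apply hF
  by_contra h
  apply hi
  rw [Finset.mem_map]
  exact ⟨⟨i, by omega⟩, Finset.mem_univ _, rfl⟩

lemma Phi_rs {L n τ R : ℕ} (hn : n < L) (hR : R ≤ RR n) (hτ : τ < 3) (δ : Fin R → ZMod 2)
    (w : VV (n + 1)) (h : Fin L) (hh : (h : ℕ) < n + 1) :
    Phi (rsV L w) (Dd L n τ δ) h = Phi w (Dd (n + 1) n τ δ) ⟨h, hh⟩ := by
  have hval : ∀ j : Fin R, xx n (3 * j + τ) < n - 1 - (3 * j + τ) :=
    fun j => xx_valid (by have := j.2; omega)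
  rw [Phi_Dd _ _ _ (fun j => by have := hval j; omega),
    Phi_Dd _ _ _ (fun j => by have := hval j; omega)]
  rw [sum_castLE (m := n + 1) hn]
  · refine Finset.sum_congr rfl fun n' _ => Finset.sum_congr rfl fun j _ =>
      Finset.sum_congr rfl fun τ' _ => ?_
    have : cmp τ' (rsV L w) (Fin.castLE hn n') = cmp τ' w n' := by
      rw [cmp_rsV, rsB, dif_pos (by exact n'.2)]
      rfl
    rw [this]
    rfl
  · intro n' hn'
    refine Finset.sum_eq_zero fun j _ => Finset.sum_eq_zero fun τ' _ => ?_
    by_cases ha : aa τ' h n' (xx n (3 * j + τ)) = 0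
    · rw [ha]; ring
    · have := aa_later (by omega) ha
      omega

lemma rs_act {L n τ R : ℕ} (hn : n < L) (hR : R ≤ RR n) (hτ : τ < 3) (δ : Fin R → ZMod 2)
    (s : Lab (n + 1)) :
    rs L (act (Dd (n + 1) n τ δ) s) ∈ cls (n + 1) (act (Dd L n τ δ) (rs L s)) := by
  rw [mem_cls]
  refine ⟨⟨?_, ?_, ?_⟩, ?_, ?_, ?_⟩
  · rw [mem_fib]
    intro h hh
    simp only [act, rs, rsV, rsB, Pi.add_apply, hh, dif_pos]
    have := Phi_rs hn hR hτ δ s.2 h hh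
    rw [← this]
    rfl
  · rw [mem_fib]
    intro h hh
    simp only [act, rs, rsV, rsB, Pi.add_apply, hh, dif_pos]
    rfl
  all_goals
    rw [mem_fib]
    intro h hh
    rfl

lemma cls_add_right {L m : ℕ} {a b c : Lab L} (h : a ∈ cls m b) : a + c ∈ cls m (b + c) := by
  rw [mem_cls] at *
  simp only [mem_fib] at *
  obtain ⟨⟨h1, h2, h3⟩, h4, h5, h6⟩ := h
  refine ⟨⟨?_, ?_, ?_⟩, ?_, ?_, ?_⟩ <;> intro i hi <;>
    simp only [Prod.fst_add, Prod.snd_add, Pi.add_apply] <;> congr 1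
  exacts [h1 i hi, h2 i hi, h3 i hi, h4 i hi, h5 i hi, h6 i hi]

section
variable {𝕜 : Type*} [RCLike 𝕜]

lemma disj_bilin {ι : Type*} [Fintype ι] {L : ℕ} (T : ι → Finset (Lab L)) (b : ℝ)
    (hrow : ∀ i j, i ≠ j → ∀ t ∈ T i, ∀ t' ∈ T j, row t ≠ row t' ∧ col t ≠ col t')
    (hb : 0 ≤ b)
    (hflat : ∀ i, ∀ f g : Idx L → 𝕜, ‖∑ t ∈ T i, chi 𝕜 t * f (row t) * g (col t)‖
      ≤ b * (√(∑ i, ‖f i‖ ^ 2) * √(∑ i, ‖g i‖ ^ 2)))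
    (ε : ι → 𝕜) (hε : ∀ i, ‖ε i‖ ≤ 1) (f g : Idx L → 𝕜) :
    ‖∑ i, ε i * ∑ t ∈ T i, chi 𝕜 t * f (row t) * g (col t)‖
      ≤ b * (√(∑ i, ‖f i‖ ^ 2) * √(∑ i, ‖g i‖ ^ 2)) := by
  classical
  have gen : ∀ (ρ : Lab L → Idx L) (f : Idx L → 𝕜),
      (∀ i j, i ≠ j → ∀ t ∈ T i, ∀ t' ∈ T j, ρ t ≠ ρ t') →
      ∑ i, ∑ x, ‖if x ∈ (T i).image ρ then f x else 0‖ ^ 2 ≤ ∑ x, ‖f x‖ ^ 2 := by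
    intro ρ f hρ
    rw [Finset.sum_comm]
    refine Finset.sum_le_sum fun x _ => ?_
    by_cases hx : ∃ i, x ∈ (T i).image ρ
    · obtain ⟨i, hi⟩ := hx
      rw [Finset.sum_eq_single i]
      · rw [if_pos hi]
      · intro j _ hj
        rw [if_neg]
        · simp
        · intro hxj
          rw [Finset.mem_image] at hi hxj
          obtain ⟨t, ht, rfl⟩ := hi
          obtain ⟨t', ht', h'⟩ := hxj
          exact hρ j i hj t' ht' t ht h'
      · simp
    · push Not at hx
      rw [Finset.sum_eq_zero]
      · positivity
      · intro i _
        rw [if_neg (hx i)]; simp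
  set F : ι → Idx L → 𝕜 := fun i x => if x ∈ (T i).image row then f x else 0
  set G : ι → Idx L → 𝕜 := fun i x => if x ∈ (T i).image col then g x else 0
  have h1 : ∀ i, ∑ t ∈ T i, chi 𝕜 t * f (row t) * g (col t) =
      ∑ t ∈ T i, chi 𝕜 t * F i (row t) * G i (col t) := by
    intro i
    refine Finset.sum_congr rfl fun t ht => ?_
    simp only [F, G]
    rw [if_pos (Finset.mem_image_of_mem _ ht), if_pos (Finset.mem_image_of_mem _ ht)]
  calc _ ≤ ∑ i, b * (√(∑ x, ‖F i x‖ ^ 2) * √(∑ x, ‖G i x‖ ^ 2)) := by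
        refine (norm_sum_le _ _).trans (Finset.sum_le_sum fun i _ => ?_)
        rw [norm_mul, h1]
        refine (mul_le_of_le_one_left (norm_nonneg _) (hε i)).trans (hflat i _ _)
    _ = b * ∑ i, (√(∑ x, ‖F i x‖ ^ 2) * √(∑ x, ‖G i x‖ ^ 2)) := by rw [Finset.mul_sum]
    _ ≤ b * (√(∑ i, ∑ x, ‖F i x‖ ^ 2) * √(∑ i, ∑ x, ‖G i x‖ ^ 2)) := by
        gcongr
        exact Real.sum_sqrt_mul_sqrt_le _ (fun _ => by positivity) (fun _ => by positivity)
    _ ≤ _ := by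
        gcongr
        · exact gen row f (fun i j hij t ht t' ht' => (hrow i j hij t ht t' ht').1)
        · exact gen col g (fun i j hij t ht t' ht' => (hrow i j hij t ht t' ht').2)

lemma countB {ι : Type*} [Fintype ι] {L : ℕ} (S : ι → Finset (Lab L)) (R : Finset (Idx L))
    (hdisj : ∀ i j, i ≠ j → ∀ t ∈ S i, t ∈ S j → False)
    (hR : ∀ i, ∀ t ∈ S i, row t ∈ R) (ε : ι → 𝕜) (hε : ∀ i, ‖ε i‖ ≤ 1)
    (z : Idx L → Idx L → 𝕜) (b : ℝ) (hb : 0 ≤ b) (hz : ∀ r, ∑ c, ‖z r c‖ ^ 2 ≤ b ^ 2) :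
    ‖∑ i, ε i * ∑ t ∈ S i, chi 𝕜 t * z (row t) (col t)‖ ≤
      √(∑ i, ((S i).card : ℝ)) * (√(R.card) * b) := by
  classical
  have h2 : ∑ x ∈ Finset.univ.sigma S, ‖z (row x.2) (col x.2)‖ ^ 2 ≤ R.card * b ^ 2 := by
    calc _ = ∑ y ∈ (Finset.univ.sigma S).image (fun x => (row x.2, col x.2)), ‖z y.1 y.2‖ ^ 2 := by
          rw [Finset.sum_image]
          rintro ⟨i, t⟩ hx ⟨j, t'⟩ hy hxy
          simp only [Finset.coe_sigma, Set.mem_sigma_iff, Finset.mem_coe] at hx hy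
          simp only [Prod.mk.injEq] at hxy
          have : t = t' := rc_inj hxy.1 hxy.2
          subst this
          by_cases hij : i = j
          · subst hij; rfl
          · exact (hdisj i j hij t hx.2 hy.2).elim
      _ ≤ ∑ y ∈ R ×ˢ Finset.univ, ‖z y.1 y.2‖ ^ 2 := by
          refine Finset.sum_le_sum_of_subset_of_nonneg ?_ (fun _ _ _ => by positivity)
          intro y hy
          rw [Finset.mem_image] at hy
          obtain ⟨⟨i, t⟩, hx, rfl⟩ := hy
          rw [Finset.mem_sigma] at hx
          rw [Finset.mem_product]
          exact ⟨hR i t hx.2, Finset.mem_univ _⟩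
      _ ≤ _ := by
          rw [Finset.sum_product]
          refine (Finset.sum_le_sum fun r _ => hz r).trans ?_
          rw [Finset.sum_const, nsmul_eq_mul]
  calc _ ≤ ∑ x ∈ Finset.univ.sigma S, 1 * ‖z (row x.2) (col x.2)‖ := by
        rw [Finset.sum_sigma]
        refine (norm_sum_le _ _).trans (Finset.sum_le_sum fun i _ => ?_)
        rw [norm_mul]
        refine (mul_le_of_le_one_left (norm_nonneg _) (hε i)).trans ?_
        refine (norm_sum_le _ _).trans (Finset.sum_le_sum fun t _ => ?_)
        rw [norm_mul, chi, sg_norm]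
    _ ≤ √(∑ x ∈ Finset.univ.sigma S, (1 : ℝ) ^ 2) *
        √(∑ x ∈ Finset.univ.sigma S, ‖z (row x.2) (col x.2)‖ ^ 2) :=
        Real.sum_mul_le_sqrt_mul_sqrt _ _ _
    _ ≤ _ := by
        gcongr
        · simp
        · refine (Real.sqrt_le_sqrt h2).trans ?_
          rw [Real.sqrt_mul (by positivity), Real.sqrt_sq hb]

/-- Action package. -/
def Good (𝕜 : Type*) [RCLike 𝕜] (n R : ℕ) (c : Lab (n + 1))
    (A : (Fin R → ZMod 2) → Equiv.Perm (Lab (n + 1))) : Prop :=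
  ∀ L, n < L → ∀ (s : Lab (n + 1)) (ε : (Fin R → ZMod 2) → 𝕜), (∀ δ, ‖ε δ‖ ≤ 1) →
  (∀ f g : Idx L → 𝕜,
    ‖∑ δ, ε δ * ∑ t ∈ cls (n + 1) (rs L (A δ s + c)), chi 𝕜 t * f (row t) * g (col t)‖
      ≤ 2 ^ (L - (n + 1)) * (√(∑ i, ‖f i‖ ^ 2) * √(∑ i, ‖g i‖ ^ 2))) ∧
  (∀ (z : Idx L → Idx L → 𝕜) (b : ℝ), 0 ≤ b → (∀ r, ∑ c, ‖z r c‖ ^ 2 ≤ b ^ 2) →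
    (∀ c, ∑ r, ‖z r c‖ ^ 2 ≤ b ^ 2) →
    ‖∑ δ, ε δ * ∑ t ∈ cls (n + 1) (rs L (A δ s)), chi 𝕜 t * z (row t) (col t)‖
      ≤ √(2 ^ R) * (32 ^ (L - (n + 1)) * b))

lemma sqrt_aux (R m : ℕ) (b : ℝ) (hb : 0 ≤ b) (k : ℕ) (hk : k ≤ 16 ^ m) :
    √(((2 : ℝ) ^ R * 64 ^ m)) * (√(k : ℝ) * b) ≤ √(2 ^ R) * (32 ^ m * b) := by
  have hk' : (k : ℝ) ≤ 16 ^ m := by exact_mod_cast hk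
  have h1 : √(k : ℝ) ≤ 4 ^ m := by
    refine Real.sqrt_le_iff.2 ⟨by positivity, hk'.trans (le_of_eq ?_)⟩
    rw [← pow_mul, mul_comm, pow_mul]; norm_num
  have h2 : √((64 : ℝ) ^ m) = 8 ^ m := by
    rw [Real.sqrt_eq_iff_mul_self_eq (by positivity) (by positivity), ← mul_pow]; norm_num
  rw [Real.sqrt_mul (by positivity), h2, mul_assoc]
  refine mul_le_mul_of_nonneg_left ?_ (by positivity)
  calc (8 : ℝ) ^ m * (√(k : ℝ) * b) ≤ 8 ^ m * (4 ^ m * b) := by gcongr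
    _ = 32 ^ m * b := by rw [← mul_assoc, ← mul_pow]; norm_num

lemma good_o {n R τ : ℕ} (hR : R ≤ RR n) (hτ : τ < 3) (c : Lab (n + 1))
    (hc1 : ∀ τ', ∀ i : Fin (n + 1), (i : ℕ) < n → cmp τ' c.1 i = 0)
    (hc2 : ∀ τ', ∀ i : Fin (n + 1), (i : ℕ) < n → cmp τ' c.2 i = 0)
    (hcτ : cmp τ c.2 (Fin.last n) = 1) :
    ∃ A, Good 𝕜 n R c A := by
  obtain ⟨A, hA⟩ : ∃ A : (Fin R → ZMod 2) → Equiv.Perm (Lab (n + 1)),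
      ∀ δ s, A δ s = act (Dd (n + 1) n τ δ) s :=
    ⟨fun δ => Function.Involutive.toPerm (act (Dd (n + 1) n τ δ)) (act_act _), fun _ _ => rfl⟩
  refine ⟨A, ?_⟩
  intro L hL s ε hε
  have e1 : ∀ δ, cls (n + 1) (rs L (act (Dd (n + 1) n τ δ) s)) =
      cls (n + 1) (act (Dd L n τ δ) (rs L s)) := fun δ => cls_congr (rs_act hL hR hτ δ s)
  have e2 : ∀ δ, cls (n + 1) (rs L (act (Dd (n + 1) n τ δ) s + c)) =
      cls (n + 1) (act (Dd L n τ δ) (rs L s) + rs L c) := fun δ => by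
    rw [rs_add]
    exact cls_congr (cls_add_right (rs_act hL hR hτ δ s))
  simp only [hA, e1, e2]
  have z1 : ∀ τ', ∀ i : Fin L, (i : ℕ) < n → cmp τ' (rs L c).1 i = 0 := by
    intro τ' i hi
    simp only [rs]
    rw [cmp_rsV, rsB]
    rw [dif_pos (by omega)]
    exact hc1 τ' _ hi
  have z2 : ∀ τ', ∀ i : Fin L, (i : ℕ) < n → cmp τ' (rs L c).2 i = 0 := by
    intro τ' i hi
    simp only [rs]
    rw [cmp_rsV, rsB]
    rw [dif_pos (by omega)]
    exact hc2 τ' _ hi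
  have z3 : cmp τ (rs L c).2 ⟨n, hL⟩ = 1 := by
    simp only [rs]
    rw [cmp_rsV, rsB]
    rw [dif_pos (by simp)]
    exact hcτ
  constructor
  · intro f g
    refine disj_bilin _ _ ?_ (by positivity) ?_ ε hε f g
    · intro δ δ' hδ t ht t' ht'
      exact disjA hL hR hτ (rs L s) (rs L c) z1 z2 z3 δ δ' hδ t t' ht ht'
    · intro δ f g
      exact flat hL _ f g
  · intro z b hb hz1 _
    refine (countB (fun δ => cls (n + 1) (act (Dd L n τ δ) (rs L s))) (rowsB n (rs L s)) ?_ ?_ ε hε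
      z b hb hz1).trans ?_
    · intro δ δ' hδ t ht ht'
      exact cls_disj hL hR hτ _ δ δ' hδ t ht ht'
    · intro δ t ht
      exact row_mem_rowsB _ δ t ht
    · simp only [card_cls _ (Nat.succ_le_of_lt hL)]
      rw [Finset.sum_const]
      have : (Finset.univ : Finset (Fin R → ZMod 2)).card = 2 ^ R := by
        simp [ZMod.card]
      rw [this, nsmul_eq_mul]
      push_cast
      exact sqrt_aux _ _ b hb _ (card_rowsB hL _)

lemma good_swap {n R : ℕ} (c : Lab (n + 1)) (A : (Fin R → ZMod 2) → Equiv.Perm (Lab (n + 1)))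
    (h : Good 𝕜 n R c.swap A) :
    Good 𝕜 n R c (fun δ => (Equiv.prodComm _ _).trans ((A δ).trans (Equiv.prodComm _ _))) := by
  intro L hL s ε hε
  obtain ⟨h1, h2⟩ := h L hL s.swap ε hε
  have e1 : ∀ δ, (Equiv.prodComm _ _).trans ((A δ).trans (Equiv.prodComm _ _)) s = (A δ s.swap).swap :=
    fun δ => rfl
  have e2 : ∀ δ, (A δ s.swap).swap + c = (A δ s.swap + c.swap).swap := fun δ => rfl
  constructor
  · intro f g
    simp only [e1, e2, rs_swap, sum_cls_swap, row_swap, col_swap, chi_swap]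
    have := h1 g f
    rw [mul_comm (√(∑ i, ‖f i‖ ^ 2))]
    refine le_trans (le_of_eq ?_) this
    congr 1
    refine Finset.sum_congr rfl fun δ _ => ?_
    congr 1
    refine Finset.sum_congr rfl fun δ _ => ?_
    ring
  · intro z b hb hz1 hz2
    simp only [e1, rs_swap, sum_cls_swap, row_swap, col_swap, chi_swap]
    exact h2 (fun r c => z c r) b hb hz2 hz1

end
end SzP

namespace SzP

abbrev C3 := ZMod 2 × ZMod 2 × ZMod 2
abbrev Cc := C3 × C3

def ioB (n : ℕ) (a : ZMod 2) : BB (n + 1) := Pi.single (Fin.last n) a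
def ioV (n : ℕ) (a : C3) : VV (n + 1) := (ioB n a.1, ioB n a.2.1, ioB n a.2.2)
def io (n : ℕ) (a : Cc) : Lab (n + 1) := (ioV n a.1, ioV n a.2)

lemma ioB_add (n : ℕ) (a b : ZMod 2) : ioB n (a + b) = ioB n a + ioB n b := Pi.single_add _ _ _

lemma io_add (n : ℕ) (a b : Cc) : io n (a + b) = io n a + io n b := by
  simp only [io, ioV, Prod.fst_add, Prod.snd_add, ioB_add]; rfl

lemma io_zero (n : ℕ) : io n 0 = 0 := by
  have := io_add n 0 0
  simpa using this

lemma io_lt (n : ℕ) (a : C3) (τ : ℕ) (i : Fin (n + 1)) (hi : (i : ℕ) < n) : cmp τ (ioV n a) i = 0 := by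
  have : i ≠ Fin.last n := by
    rintro rfl
    simp at hi
  unfold cmp ioV ioB
  split_ifs <;> exact Pi.single_eq_of_ne this _

lemma io_last {n : ℕ} {a : C3} (ha : a ≠ 0) : ∃ τ < 3, cmp τ (ioV n a) (Fin.last n) = 1 := by
  obtain ⟨a0, a1, a2⟩ := a
  rcases zmod2_cases a0 with rfl | rfl
  · rcases zmod2_cases a1 with rfl | rfl
    · rcases zmod2_cases a2 with rfl | rfl
      · exact absurd rfl ha
      · exact ⟨2, by norm_num, by simp [cmp, ioV, ioB]⟩
    · exact ⟨1, by norm_num, by simp [cmp, ioV, ioB]⟩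
  · exact ⟨0, by norm_num, by simp [cmp, ioV, ioB]⟩

section
variable {𝕜 : Type*} [RCLike 𝕜]

lemma exists_good {n R : ℕ} (hR : R ≤ RR n) {c : Cc} (hc : c ≠ 0) :
    ∃ A, Good 𝕜 n R (io n c) A := by
  by_cases h2 : c.2 = 0
  · have h1 : c.1 ≠ 0 := fun h1 => hc (Prod.ext h1 h2)
    obtain ⟨τ, hτ, h⟩ := io_last (n := n) h1
    obtain ⟨A, hA⟩ := good_o (𝕜 := 𝕜) hR hτ (io n c).swap (fun τ' i hi => io_lt _ _ _ _ hi)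
      (fun τ' i hi => io_lt _ _ _ _ hi) h
    exact ⟨_, good_swap _ _ hA⟩
  · obtain ⟨τ, hτ, h⟩ := io_last (n := n) h2
    exact good_o (𝕜 := 𝕜) hR hτ (io n c) (fun τ' i hi => io_lt _ _ _ _ hi)
      (fun τ' i hi => io_lt _ _ _ _ hi) h

end

lemma mem_fib_succ {L n : ℕ} (hn : n < L) (x : BB L) (s : BB (n + 1)) (a : ZMod 2) :
    x ∈ fib (n + 1) (rsB L (s + ioB n a)) ↔
      x ∈ fib n (rsB L (rsB n s)) ∧ x ⟨n, hn⟩ + s (Fin.last n) = a := by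
  rw [mem_fib, mem_fib]
  have key : ∀ i : Fin L, (hi : (i : ℕ) < n) →
      rsB L (s + ioB n a) i = rsB L (rsB n s) i := by
    intro i hi
    unfold rsB
    rw [dif_pos (by omega), dif_pos hi, dif_pos (by simp; omega), Pi.add_apply]
    have : ioB n a ⟨i, by omega⟩ = 0 := by
      unfold ioB
      apply Pi.single_eq_of_ne
      intro h
      have := congrArg Fin.val h
      simp at this
      omega
    rw [this, add_zero]
  have key2 : rsB L (s + ioB n a) ⟨n, hn⟩ = s (Fin.last n) + a := by
    unfold rsB
    rw [dif_pos (by simp), Pi.add_apply]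
    have : ioB n a (Fin.last n) = a := Pi.single_eq_same _ _
    exact congrArg _ this
  constructor
  · intro h
    refine ⟨fun i hi => by rw [h i (by omega), key i hi], ?_⟩
    rw [h ⟨n, hn⟩ (by simp), key2]
    linear_combination CharTwo.add_self_eq_zero (s (Fin.last n))
  · rintro ⟨h1, h2⟩ i hi
    by_cases hin : (i : ℕ) < n
    · rw [h1 i hin, key i hin]
    · have : i = ⟨n, hn⟩ := Fin.ext (by simp; omega)
      subst this
      rw [key2, ← h2]
      linear_combination -CharTwo.add_self_eq_zero (s (Fin.last n))

def bits {L n : ℕ} (hn : n < L) (s : Lab (n + 1)) (t : Lab L) : Cc :=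
  ((t.1.1 ⟨n, hn⟩ + s.1.1 (Fin.last n), t.1.2.1 ⟨n, hn⟩ + s.1.2.1 (Fin.last n),
    t.1.2.2 ⟨n, hn⟩ + s.1.2.2 (Fin.last n)),
   (t.2.1 ⟨n, hn⟩ + s.2.1 (Fin.last n), t.2.2.1 ⟨n, hn⟩ + s.2.2.1 (Fin.last n),
    t.2.2.2 ⟨n, hn⟩ + s.2.2.2 (Fin.last n)))

lemma and6_aux {a1 a2 a3 a4 a5 a6 b1 b2 b3 b4 b5 b6 : Prop} :
    ((a1 ∧ a2 ∧ a3) ∧ a4 ∧ a5 ∧ a6) ∧ ((b1 ∧ b2 ∧ b3) ∧ b4 ∧ b5 ∧ b6) ↔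
    (((a1 ∧ b1) ∧ (a2 ∧ b2) ∧ (a3 ∧ b3)) ∧ (a4 ∧ b4) ∧ (a5 ∧ b5) ∧ (a6 ∧ b6)) := by
  constructor
  · rintro ⟨⟨⟨h1, h2, h3⟩, h4, h5, h6⟩, ⟨k1, k2, k3⟩, k4, k5, k6⟩
    exact ⟨⟨⟨h1, k1⟩, ⟨h2, k2⟩, ⟨h3, k3⟩⟩, ⟨h4, k4⟩, ⟨h5, k5⟩, ⟨h6, k6⟩⟩
  · rintro ⟨⟨⟨h1, k1⟩, ⟨h2, k2⟩, ⟨h3, k3⟩⟩, ⟨h4, k4⟩, ⟨h5, k5⟩, ⟨h6, k6⟩⟩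
    exact ⟨⟨⟨h1, h2, h3⟩, h4, h5, h6⟩, ⟨k1, k2, k3⟩, k4, k5, k6⟩

lemma cls_part {M : Type*} [AddCommMonoid M] {L n : ℕ} (hn : n < L) (s : Lab (n + 1)) (F : Lab L → M) :
    ∑ t ∈ cls n (rs L (rs n s)), F t = ∑ c : Cc, ∑ t ∈ cls (n + 1) (rs L (s + io n c)), F t := by
  rw [← Finset.sum_fiberwise _ (bits hn s)]
  refine Finset.sum_congr rfl fun c _ => Finset.sum_congr ?_ fun _ _ => rfl
  ext t
  rw [Finset.mem_filter, mem_cls, mem_cls]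
  obtain ⟨⟨c1, c2, c3⟩, c4, c5, c6⟩ := c
  have e1 := mem_fib_succ hn t.1.1 s.1.1 c1
  have e2 := mem_fib_succ hn t.1.2.1 s.1.2.1 c2
  have e3 := mem_fib_succ hn t.1.2.2 s.1.2.2 c3
  have e4 := mem_fib_succ hn t.2.1 s.2.1 c4
  have e5 := mem_fib_succ hn t.2.2.1 s.2.2.1 c5
  have e6 := mem_fib_succ hn t.2.2.2 s.2.2.2 c6
  simp only [bits, Prod.mk.injEq]
  change _ ↔ ((_ ∈ fib (n + 1) (rsB L (s.1.1 + ioB n c1)) ∧ _ ∈ fib (n + 1) (rsB L (s.1.2.1 + ioB n c2))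
    ∧ _ ∈ fib (n + 1) (rsB L (s.1.2.2 + ioB n c3))) ∧ (_ ∈ fib (n + 1) (rsB L (s.2.1 + ioB n c4)) ∧
    _ ∈ fib (n + 1) (rsB L (s.2.2.1 + ioB n c5))
    ∧ _ ∈ fib (n + 1) (rsB L (s.2.2.2 + ioB n c6))))
  rw [e1, e2, e3, e4, e5, e6]
  exact and6_aux

lemma rs_rs_self {n : ℕ} (s : Lab n) : rs n s = s := by
  have : ∀ f : BB n, rsB n f = f := fun f => by
    funext i; simp [rsB]
  simp only [rs, rsV, this]

lemma sum_pr {M : Type*} [AddCommMonoid M] {n : ℕ} (F : Lab n → M) :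
    ∑ s : Lab (n + 1), F (rs n s) = 64 • ∑ s : Lab n, F s := by
  rw [← Finset.sum_fiberwise _ (fun s => rs n s), Finset.smul_sum]
  refine Finset.sum_congr rfl fun s _ => ?_
  have : (Finset.univ.filter fun t : Lab (n + 1) => rs n t = s) = cls n (rs (n + 1) s) := by
    have hB : ∀ (x : BB (n + 1)) (y : BB n), rsB n x = y ↔ x ∈ fib n (rsB (n + 1) y) := by
      intro x y
      rw [mem_fib]
      constructor
      · rintro rfl i hi
        unfold rsB
        rw [dif_pos hi, dif_pos (by simp; omega)]
      · intro h
        funext i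
        have := h ⟨i, by omega⟩ i.2
        unfold rsB at this ⊢
        rw [dif_pos i.2] at this
        rw [dif_pos (by omega), this]
    ext t
    rw [Finset.mem_filter, mem_cls]
    obtain ⟨⟨c1, c2, c3⟩, c4, c5, c6⟩ := s
    simp only [rs, rsV, Prod.mk.injEq, hB, Finset.mem_univ, true_and]
  rw [Finset.sum_congr this (g := fun _ => F s)]
  · rw [Finset.sum_const, card_cls _ (by omega)]
    simp
  · intro t ht
    rw [← this, Finset.mem_filter] at ht
    rw [ht.2]

end SzP

namespace SzP

abbrev Eu (𝕜 : Type*) [RCLike 𝕜] (L : ℕ) := EuclideanSpace 𝕜 (Idx L)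
abbrev Mat (𝕜 : Type*) [RCLike 𝕜] (L : ℕ) := Eu 𝕜 L →L[𝕜] Eu 𝕜 L

section
variable {𝕜 : Type*} [RCLike 𝕜]

def eop {L : ℕ} (i j : Idx L) : Mat 𝕜 L :=
  (EuclideanSpace.proj j : Eu 𝕜 L →L[𝕜] 𝕜).smulRight (EuclideanSpace.single i 1)

lemma eop_apply {L : ℕ} (i j k : Idx L) (v : Eu 𝕜 L) :
    (eop i j v) k = if k = i then v j else 0 := by
  simp [eop, Pi.single_apply]

lemma eop_bil {L : ℕ} (i j : Idx L) (v : Eu 𝕜 L) (g : Idx L → 𝕜) :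
    ∑ k, g k * (eop i j v) k = g i * v j := by
  simp [eop_apply]

lemma opn_le {L : ℕ} (Y : Mat 𝕜 L) (b : ℝ) (hb : 0 ≤ b)
    (h : ∀ (v : Eu 𝕜 L) (g : Idx L → 𝕜), ‖∑ k, g k * (Y v) k‖ ≤
      b * (√(∑ i, ‖g i‖ ^ 2) * √(∑ i, ‖v i‖ ^ 2))) : ‖Y‖ ≤ b := by
  refine ContinuousLinearMap.opNorm_le_bound _ hb fun v => ?_
  have h1 := h v (fun k => (starRingEnd 𝕜) ((Y v) k))
  simp only [RCLike.conj_mul, RCLike.norm_conj] at h1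
  rw [← EuclideanSpace.norm_eq, ← EuclideanSpace.norm_eq] at h1
  have h2 : (∑ k, ((‖(Y v) k‖ : ℝ) : 𝕜) ^ 2) = ((‖Y v‖ ^ 2 : ℝ) : 𝕜) := by
    rw [EuclideanSpace.norm_sq_eq]
    push_cast
    rfl
  rw [h2, RCLike.norm_ofReal, abs_of_nonneg (by positivity)] at h1
  by_cases h0 : ‖Y v‖ = 0
  · rw [h0]; positivity
  · have : 0 < ‖Y v‖ := lt_of_le_of_ne (norm_nonneg _) (Ne.symm h0)
    nlinarith

lemma col_bd {L : ℕ} (Z : Mat 𝕜 L) (c : Idx L) :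
    ∑ r, ‖(Z (EuclideanSpace.single c 1)) r‖ ^ 2 ≤ ‖Z‖ ^ 2 := by
  rw [← EuclideanSpace.norm_sq_eq]
  have := Z.le_opNorm (EuclideanSpace.single c 1)
  simp at this
  gcongr

lemma row_bd {L : ℕ} (Z : Mat 𝕜 L) (r : Idx L) :
    ∑ c, ‖(Z (EuclideanSpace.single c 1)) r‖ ^ 2 ≤ ‖Z‖ ^ 2 := by
  set z : Idx L → 𝕜 := fun c => (Z (EuclideanSpace.single c 1)) r with hz
  set v : Eu 𝕜 L := ∑ c, (starRingEnd 𝕜) (z c) • EuclideanSpace.single c 1 with hv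
  have hvc : ∀ c, v c = (starRingEnd 𝕜) (z c) := by
    intro c
    simp [hv, Pi.single_apply]
  have h1 : (Z v) r = ((∑ c, ‖z c‖ ^ 2 : ℝ) : 𝕜) := by
    rw [hv, map_sum]
    simp only [map_smul]
    push_cast
    simp only [WithLp.ofLp_sum, Finset.sum_apply, PiLp.smul_apply, smul_eq_mul]
    refine Finset.sum_congr rfl fun c _ => ?_
    rw [← RCLike.conj_mul]
  have h2 : ‖v‖ ^ 2 = ∑ c, ‖z c‖ ^ 2 := by
    rw [EuclideanSpace.norm_sq_eq]
    simp [hvc]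
  have h3 : ‖(Z v) r‖ ≤ ‖Z v‖ := PiLp.norm_apply_le _ _
  have h4 := Z.le_opNorm v
  rw [h1, RCLike.norm_ofReal, ← h2, abs_of_nonneg (by positivity)] at h3
  change ∑ c, ‖z c‖ ^ 2 ≤ _
  rw [← h2]
  by_cases h0 : ‖v‖ = 0
  · rw [h0]; nlinarith [sq_nonneg ‖Z‖]
  · have : 0 < ‖v‖ := lt_of_le_of_ne (norm_nonneg _) (Ne.symm h0)
    have : ‖v‖ ≤ ‖Z‖ := by nlinarith
    gcongr

def yop {L : ℕ} (n : ℕ) (s : Lab L) : Mat 𝕜 L := ∑ t ∈ cls n s, chi 𝕜 t • eop (row t) (col t)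

def ystar {L : ℕ} (n : ℕ) (s : Lab L) : Mat 𝕜 L →ₗ[𝕜] 𝕜 where
  toFun Z := ∑ t ∈ cls n s, chi 𝕜 t * (Z (EuclideanSpace.single (col t) 1)) (row t)
  map_add' Z W := by simp [mul_add, Finset.sum_add_distrib]
  map_smul' a Z := by
    simp only [ContinuousLinearMap.smul_apply, PiLp.smul_apply, smul_eq_mul, RingHom.id_apply,
      Finset.mul_sum]
    refine Finset.sum_congr rfl fun t _ => ?_
    ring

lemma ystar_apply {L : ℕ} (n : ℕ) (s : Lab L) (Z : Mat 𝕜 L) :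
    ystar n s Z = ∑ t ∈ cls n s, chi 𝕜 t * (Z (EuclideanSpace.single (col t) 1)) (row t) := rfl

lemma yop_bil {L n : ℕ} (s : Lab L) (v : Eu 𝕜 L) (g : Idx L → 𝕜) :
    ∑ k, g k * ((yop n s : Mat 𝕜 L) v) k = ∑ t ∈ cls n s, chi 𝕜 t * g (row t) * v (col t) := by
  simp only [yop, ContinuousLinearMap.sum_apply, WithLp.ofLp_sum, Finset.sum_apply,
    ContinuousLinearMap.smul_apply, PiLp.smul_apply, smul_eq_mul, Finset.mul_sum]
  rw [Finset.sum_comm]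
  refine Finset.sum_congr rfl fun t _ => ?_
  rw [mul_assoc, ← eop_bil, Finset.mul_sum]
  refine Finset.sum_congr rfl fun k _ => ?_
  ring

lemma ystar_yop {L n : ℕ} (hn : n ≤ L) (s : Lab L) :
    ystar n s (yop n s : Mat 𝕜 L) = 64 ^ (L - n) := by
  rw [ystar_apply]
  have : ∀ t ∈ cls n s, chi 𝕜 t * ((yop n s : Mat 𝕜 L) (EuclideanSpace.single (col t) 1)) (row t) = 1 := by
    intro t ht
    simp only [yop, ContinuousLinearMap.sum_apply, WithLp.ofLp_sum, Finset.sum_apply,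
      ContinuousLinearMap.smul_apply, PiLp.smul_apply, smul_eq_mul]
    rw [Finset.sum_eq_single_of_mem t ht]
    · rw [eop_apply]
      simp [chi, sg_mul_self]
    · intro t' _ hne
      rw [eop_apply]
      split_ifs with h
      · rw [EuclideanSpace.single_apply, if_neg, mul_zero]
        intro h'
        exact hne (rc_inj h.symm h')
      · rw [mul_zero]
  rw [Finset.sum_congr rfl this, Finset.sum_const, card_cls _ hn]
  simp

/-- normalized operators -/
def yh (𝕜 : Type*) [RCLike 𝕜] (L : ℕ) {n : ℕ} (s : Lab n) : Mat 𝕜 L :=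
  if n ≤ L then ((2 : 𝕜) ^ L)⁻¹ • yop n (rs L s) else 0

def ys (𝕜 : Type*) [RCLike 𝕜] (L : ℕ) {n : ℕ} (s : Lab n) : Mat 𝕜 L →ₗ[𝕜] 𝕜 :=
  ((2 : 𝕜) ^ L / 64 ^ (L - n)) • ystar n (rs L s)

lemma yh_part {L n : ℕ} (hn : n < L) (s : Lab (n + 1)) :
    yh 𝕜 L (rs n s) = ∑ c : Cc, yh 𝕜 L (s + io n c) := by
  unfold yh
  simp only [if_pos hn.le, if_pos (Nat.succ_le_of_lt hn), ← Finset.smul_sum, yop]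
  rw [cls_part hn]

lemma ys_part {L n : ℕ} (hn : n < L) (s : Lab (n + 1)) (Z : Mat 𝕜 L) :
    ys 𝕜 L (rs n s) Z = 64⁻¹ * ∑ c : Cc, ys 𝕜 L (s + io n c) Z := by
  unfold ys
  simp only [LinearMap.smul_apply, ystar_apply, smul_eq_mul]
  rw [cls_part hn, ← Finset.mul_sum, ← mul_assoc]
  congr 1
  obtain ⟨m, rfl⟩ : ∃ m, L = n + 1 + m := Nat.exists_eq_add_of_le hn
  have e1 : n + 1 + m - n = m + 1 := by omega
  have e2 : n + 1 + m - (n + 1) = m := by omega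
  rw [e1, e2, pow_succ (64 : 𝕜)]
  field_simp

lemma ys_yh {L n : ℕ} (hn : n ≤ L) (s : Lab n) : ys 𝕜 L s (yh 𝕜 L s) = 1 := by
  unfold ys yh
  rw [if_pos hn, LinearMap.smul_apply, map_smul, ystar_yop hn]
  simp only [smul_eq_mul]
  field_simp

lemma yh_good {n R : ℕ} {c : Lab (n + 1)} {A} (hA : Good 𝕜 n R c A) (L : ℕ) (s : Lab (n + 1))
    (ε : (Fin R → ZMod 2) → 𝕜) (hε : ∀ δ, ‖ε δ‖ ≤ 1) :
    ‖∑ δ, ε δ • yh 𝕜 L (A δ s + c)‖ ≤ (2 ^ (n + 1))⁻¹ := by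
  by_cases hL : n + 1 ≤ L
  · unfold yh
    simp only [if_pos hL]
    refine opn_le _ _ (by positivity) fun v g => ?_
    have h1 := (hA L hL s ε hε).1 g v
    have h2 : ∑ k, g k * ((∑ δ, ε δ • ((2 : 𝕜) ^ L)⁻¹ • (yop (n + 1) (rs L (A δ s + c)) : Mat 𝕜 L)) v) k
      = ((2 : 𝕜) ^ L)⁻¹ * ∑ δ, ε δ * ∑ t ∈ cls (n + 1) (rs L (A δ s + c)),
        chi 𝕜 t * g (row t) * v (col t) := by
      simp only [← yop_bil, ContinuousLinearMap.sum_apply, WithLp.ofLp_sum, Finset.sum_apply,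
        ContinuousLinearMap.smul_apply, PiLp.smul_apply, smul_eq_mul, Finset.mul_sum]
      rw [Finset.sum_comm]
      refine Finset.sum_congr rfl fun δ _ => Finset.sum_congr rfl fun k _ => ?_
      ring
    rw [h2, norm_mul]
    calc _ ≤ ‖((2 : 𝕜) ^ L)⁻¹‖ * (2 ^ (L - (n + 1)) * (√(∑ i, ‖g i‖ ^ 2) * √(∑ i, ‖v i‖ ^ 2))) := by
          gcongr
      _ = _ := by
          rw [← mul_assoc]
          congr 1
          obtain ⟨m, rfl⟩ : ∃ m, L = n + 1 + m := Nat.exists_eq_add_of_le hL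
          rw [Nat.add_sub_cancel_left, norm_inv, norm_pow, RCLike.norm_ofNat, pow_add _ (n + 1) m]
          field_simp
  · have h0 : ∀ δ, yh 𝕜 L (A δ s + c) = 0 := fun δ => if_neg hL
    have h1 : ∑ δ, ε δ • yh 𝕜 L (A δ s + c) = 0 :=
      Finset.sum_eq_zero fun δ _ => by rw [h0]; exact smul_zero (A := Mat 𝕜 L) (ε δ)
    rw [h1, norm_zero]
    positivity

lemma ys_good {n R : ℕ} {c : Lab (n + 1)} {A} (hA : Good 𝕜 n R c A) {L : ℕ} (hL : n < L)
    (s : Lab (n + 1)) (ε : (Fin R → ZMod 2) → 𝕜) (hε : ∀ δ, ‖ε δ‖ ≤ 1) (Z : Mat 𝕜 L) :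
    ‖∑ δ, ε δ * ys 𝕜 L (A δ s) Z‖ ≤ √(2 ^ R) * 2 ^ (n + 1) * ‖Z‖ := by
  have h1 := (hA L hL s ε hε).2 (fun r c => (Z (EuclideanSpace.single c 1)) r) ‖Z‖ (norm_nonneg _)
    (row_bd Z) (col_bd Z)
  have h2 : ∑ δ, ε δ * ys 𝕜 L (A δ s) Z = ((2 : 𝕜) ^ L / 64 ^ (L - (n + 1))) *
      ∑ δ, ε δ * ∑ t ∈ cls (n + 1) (rs L (A δ s)),
        chi 𝕜 t * (Z (EuclideanSpace.single (col t) 1)) (row t) := by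
    unfold ys
    simp only [LinearMap.smul_apply, ystar_apply, smul_eq_mul]
    rw [Finset.mul_sum]
    refine Finset.sum_congr rfl fun δ _ => ?_
    ring
  rw [h2, norm_mul]
  calc _ ≤ ‖((2 : 𝕜) ^ L / 64 ^ (L - (n + 1)))‖ * (√(2 ^ R) * (32 ^ (L - (n + 1)) * ‖Z‖)) := by
        gcongr
    _ = _ := by
        obtain ⟨m, rfl⟩ : ∃ m, L = n + 1 + m := Nat.exists_eq_add_of_le hL
        rw [Nat.add_sub_cancel_left, norm_div, norm_pow, norm_pow, RCLike.norm_ofNat,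
          RCLike.norm_ofNat, pow_add _ (n + 1) m]
        have : (64 : ℝ) ^ m = 2 ^ m * 32 ^ m := by rw [← mul_pow]; norm_num
        rw [this]
        field_simp

lemma ys_bd {L n : ℕ} (hL : n < L) (s : Lab n) (Z : Mat 𝕜 L) :
    ‖ys 𝕜 L s Z‖ ≤ 2 ^ (n + 1) * ‖Z‖ := by
  have hs : s = rs n (rs (n + 1) s) := by
    have : ∀ f : BB n, f = rsB n (rsB (n + 1) f) := fun f => by
      funext i; unfold rsB
      rw [dif_pos (by omega), dif_pos (by simp)]
    simp only [rs, rsV, ← this]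
  obtain ⟨A, hA⟩ := exists_good (𝕜 := 𝕜) (n := n) (R := 0) (Nat.zero_le _)
    (c := ((1, 0, 0), 0)) (by intro h; exact absurd (congrArg (fun x : Cc => x.1.1) h) (by decide))
  have h1 : ∀ s' : Lab (n + 1), ‖ys 𝕜 L s' Z‖ ≤ 2 ^ (n + 1) * ‖Z‖ := by
    intro s'
    have := ys_good hA hL ((A 0).symm s') (fun _ => 1) (by simp) Z
    have e : ∀ δ : Fin 0 → ZMod 2, δ = 0 := fun δ => Subsingleton.elim _ _
    have e2 : ∑ δ : Fin 0 → ZMod 2, (1 : 𝕜) * ys 𝕜 L (A δ ((A 0).symm s')) Z = ys 𝕜 L s' Z := by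
      rw [Fintype.sum_subsingleton _ (0 : Fin 0 → ZMod 2), one_mul, Equiv.apply_symm_apply]
    rw [e2] at this
    simpa using this
  rw [hs, ys_part hL, norm_mul]
  have hc : (Finset.univ : Finset Cc).card = 64 := by
    simp [ZMod.card]
  calc _ ≤ ‖(64 : 𝕜)⁻¹‖ * (64 * (2 ^ (n + 1) * ‖Z‖)) := by
        gcongr
        refine (norm_sum_le_of_le _ (fun c _ => h1 _)).trans (le_of_eq ?_)
        rw [Finset.sum_const, hc, nsmul_eq_mul]
        norm_num
    _ = _ := by
        rw [norm_inv, RCLike.norm_ofNat]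
        ring

lemma yh_bd {L n : ℕ} (s : Lab n) : ‖yh 𝕜 L s‖ ≤ (2 ^ n)⁻¹ := by
  by_cases hL : n ≤ L
  · unfold yh
    simp only [if_pos hL]
    refine opn_le _ _ (by positivity) fun v g => ?_
    have h1 := flat hL (rs L s) g v
    have h2 : ∑ k, g k * ((((2 : 𝕜) ^ L)⁻¹ • (yop n (rs L s) : Mat 𝕜 L)) v) k
      = ((2 : 𝕜) ^ L)⁻¹ * ∑ t ∈ cls n (rs L s), chi 𝕜 t * g (row t) * v (col t) := by
      simp only [← yop_bil,
        ContinuousLinearMap.smul_apply, PiLp.smul_apply, smul_eq_mul, Finset.mul_sum]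
      refine Finset.sum_congr rfl fun k _ => ?_
      ring
    rw [h2, norm_mul]
    calc _ ≤ ‖((2 : 𝕜) ^ L)⁻¹‖ * (2 ^ (L - n) * (√(∑ i, ‖g i‖ ^ 2) * √(∑ i, ‖v i‖ ^ 2))) := by
          gcongr
      _ = _ := by
          rw [← mul_assoc]
          congr 1
          obtain ⟨m, rfl⟩ : ∃ m, L = n + m := Nat.exists_eq_add_of_le hL
          rw [Nat.add_sub_cancel_left, norm_inv, norm_pow, RCLike.norm_ofNat, pow_add _ n m]
          field_simp
  · unfold yh
    simp only [if_neg hL, norm_zero]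
    positivity

end
end SzP

namespace SzP

section signs
variable {𝕜 : Type*} [RCLike 𝕜]

lemma sign_orth {ι : Type*} [Fintype ι] [DecidableEq ι] (i j : ι) :
    ∑ ω : ι → ZMod 2, sg 𝕜 (ω i) * sg 𝕜 (ω j) = if i = j then 2 ^ Fintype.card ι else 0 := by
  split_ifs with h
  · subst h
    simp [sg_mul_self, ZMod.card]
  · have h1 := (Equiv.sum_comp (Equiv.addRight (Pi.single i 1 : ι → ZMod 2))
      (fun ω : ι → ZMod 2 => sg 𝕜 (ω i) * sg 𝕜 (ω j))).symm
    have h2 : ∑ ω : ι → ZMod 2, sg 𝕜 ((Equiv.addRight (Pi.single i 1 : ι → ZMod 2) ω) i) *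
        sg 𝕜 ((Equiv.addRight (Pi.single i 1 : ι → ZMod 2) ω) j)
        = - ∑ ω : ι → ZMod 2, sg 𝕜 (ω i) * sg 𝕜 (ω j) := by
      rw [← Finset.sum_neg_distrib]
      refine Finset.sum_congr rfl fun ω _ => ?_
      simp [Ne.symm h, sg_add, sg_one, Pi.single_apply]
    rw [h2] at h1
    exact self_eq_neg.mp h1

lemma decouple {Q : Type*} [SeminormedAddCommGroup Q] [NormedSpace 𝕜 Q] {ι : Type*} [Fintype ι]
    [DecidableEq ι] (g : ι → Q →L[𝕜] 𝕜) (y : ι → Q) (B : ℝ)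
    (h : ∀ ω : ι → ZMod 2, ‖(∑ i, sg 𝕜 (ω i) * g i (∑ j, sg 𝕜 (ω j) • y j))‖ ≤ B) :
    ‖∑ i, g i (y i)‖ ≤ B := by
  have h1 : ∑ ω : ι → ZMod 2, (∑ i, sg 𝕜 (ω i) * g i (∑ j, sg 𝕜 (ω j) • y j))
      = 2 ^ Fintype.card ι * ∑ i, g i (y i) := by
    simp only [map_sum, map_smul, smul_eq_mul, Finset.mul_sum]
    rw [Finset.sum_comm]
    refine Finset.sum_congr rfl fun i _ => ?_
    rw [Finset.sum_comm]
    have : ∀ j, ∑ ω : ι → ZMod 2, sg 𝕜 (ω i) * (sg 𝕜 (ω j) * g i (y j)) =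
        (if i = j then 2 ^ Fintype.card ι else 0) * g i (y j) := by
      intro j
      rw [← sign_orth, Finset.sum_mul]
      refine Finset.sum_congr rfl fun _ _ => ?_
      ring
    simp [this]
  have h2 : ‖∑ ω : ι → ZMod 2, (∑ i, sg 𝕜 (ω i) * g i (∑ j, sg 𝕜 (ω j) • y j))‖
      ≤ 2 ^ Fintype.card ι * B := by
    refine (norm_sum_le_of_le _ fun ω _ => h ω).trans (le_of_eq ?_)
    simp [ZMod.card]
  rw [h1, norm_mul, norm_pow, RCLike.norm_ofNat] at h2
  exact le_of_mul_le_mul_left h2 (by positivity)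

lemma perm_avg {S Δ : Type*} [Fintype S] [Fintype Δ] (G : S → 𝕜) (A : Δ → Equiv.Perm S) (B : ℝ)
    (h : ∀ s, ‖∑ δ, G (A δ s)‖ ≤ B) :
    (Fintype.card Δ : ℝ) * ‖∑ s, G s‖ ≤ Fintype.card S * B := by
  have h1 : ∑ s, ∑ δ, G (A δ s) = Fintype.card Δ * ∑ s, G s := by
    rw [Finset.sum_comm]
    simp [Equiv.sum_comp]
  have h2 : ‖∑ s, ∑ δ, G (A δ s)‖ ≤ Fintype.card S * B := by
    refine (norm_sum_le_of_le _ fun s _ => h s).trans (le_of_eq ?_)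
    simp
  rwa [h1, norm_mul, RCLike.norm_natCast] at h2

end signs

def rr (n : ℕ) : ℕ := RR n / 4

lemma rr_bd : ∃ C : ℝ, ∀ n : ℕ, 1 ≤ n → ((1 : ℝ) / 2) ^ rr n ≤ C * (1 / (n : ℝ) ^ 2) := by
  have ht := tendsto_pow_const_mul_const_pow_of_abs_lt_one 4 (r := (1 / 2 : ℝ))
    (by rw [abs_of_pos] <;> norm_num)
  obtain ⟨C, hC⟩ := ht.bddAbove_range
  refine ⟨33 ^ 4 * (2 * C), fun n h0 => ?_⟩
  have h1 : n ≤ (33 * (rr n + 1)) ^ 2 := by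
    have h2 := Nat.lt_succ_sqrt n
    have h3 : Nat.sqrt n + 1 ≤ 33 * (rr n + 1) := by
      unfold rr RR
      omega
    calc n ≤ (Nat.sqrt n + 1) * (Nat.sqrt n + 1) := h2.le
      _ ≤ (33 * (rr n + 1)) * (33 * (rr n + 1)) := Nat.mul_le_mul h3 h3
      _ = _ := by ring
  have hk := hC ⟨rr n + 1, rfl⟩
  simp only [pow_succ] at hk
  push_cast at hk
  have h1' : (n : ℝ) ≤ (33 * (rr n + 1)) ^ 2 := by exact_mod_cast h1
  have h2' : (n : ℝ) ^ 2 ≤ ((33 * (rr n + 1)) ^ 2) ^ 2 := by gcongr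
  rw [mul_one_div, le_div_iff₀ (by positivity)]
  have hp : 0 ≤ ((1 : ℝ) / 2) ^ rr n := by positivity
  calc ((1 : ℝ) / 2) ^ rr n * (n : ℝ) ^ 2 ≤ ((1 : ℝ) / 2) ^ rr n * ((33 * (rr n + 1)) ^ 2) ^ 2 := by
        gcongr
    _ ≤ _ := by nlinarith

end SzP

namespace SzP
open Filter Topology

lemma rr_summable : Summable fun n => ((1 : ℝ) / 2) ^ rr n := by
  obtain ⟨C, hC⟩ := rr_bd
  have h : Summable fun n : ℕ => C * (1 / (n : ℝ) ^ 2) :=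
    (Real.summable_one_div_nat_pow.mpr (by norm_num)).mul_left C
  rw [← summable_nat_add_iff 1] at h ⊢
  refine Summable.of_nonneg_of_le (fun n => by positivity) (fun n => ?_) h
  exact hC (n + 1) (by omega)

lemma compact_null {Q : Type*} [SeminormedAddCommGroup Q] (F : ℕ → Set Q) (hF : ∀ n, (F n).Finite)
    (ρ : ℕ → ℝ) (hρ : Tendsto ρ atTop (𝓝 0)) (h : ∀ n, ∀ y ∈ F n, ‖y‖ ≤ ρ n) :
    IsCompact (insert 0 (⋃ n, F n)) := by
  have ht : Tendsto (fun p : Σ n, F n => (p.2 : Q)) cofinite (𝓝 0) := by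
    rw [Metric.nhds_basis_ball.tendsto_right_iff]
    intro ε hε
    obtain ⟨N, hN⟩ := eventually_atTop.mp (hρ.eventually_lt_const hε)
    rw [Filter.eventually_cofinite]
    refine Set.Finite.subset (Set.Finite.biUnion (Set.finite_lt_nat N)
      (fun n _ => ?_ : ∀ n ∈ {i | i < N}, (Set.range (Sigma.mk (β := fun n => F n) n)).Finite)) ?_
    · have := (hF n).to_subtype
      exact Set.finite_range _
    · rintro ⟨n, y⟩ hy
      simp only [Set.mem_iUnion]
      refine ⟨n, ?_, y, rfl⟩
      by_contra hn
      apply hy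
      simp only [Metric.mem_ball, dist_zero_right]
      exact (h n y y.2).trans_lt (hN n (not_lt.mp hn))
  have := ht.isCompact_insert_range_of_cofinite
  convert this using 2
  ext y
  simp

section
variable {𝕜 : Type*} [RCLike 𝕜] {Q : Type*} [SeminormedAddCommGroup Q] [NormedSpace 𝕜 Q]

def beta (x : ∀ n, Lab n → Q) (g : ∀ n, Lab n → Q →L[𝕜] 𝕜) (n : ℕ) (T : Q →L[𝕜] Q) : 𝕜 :=
  (Fintype.card (Lab n) : 𝕜)⁻¹ * ∑ s, g n s (T (x n s))

lemma card_lab (n : ℕ) : Fintype.card (Lab (n + 1)) = 64 * Fintype.card (Lab n) := by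
  have := sum_pr (n := n) (fun _ => (1 : ℕ))
  simpa using this

lemma card_lab_ne (n : ℕ) : (Fintype.card (Lab n) : ℝ) ≠ 0 := by
  have : Nonempty (Lab n) := ⟨0⟩
  exact_mod_cast Fintype.card_ne_zero

lemma card_lab_ne' (n : ℕ) : (Fintype.card (Lab n) : 𝕜) ≠ 0 := by
  have : Nonempty (Lab n) := ⟨0⟩
  exact_mod_cast Fintype.card_ne_zero

lemma beta_step (x : ∀ n, Lab n → Q) (g : ∀ n, Lab n → Q →L[𝕜] 𝕜)
    (h1 : ∀ n (s : Lab (n + 1)), x n (rs n s) = ∑ c : Cc, x (n + 1) (s + io n c))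
    (h2 : ∀ n (s : Lab (n + 1)) (y : Q),
      g n (rs n s) y = 64⁻¹ * ∑ c : Cc, g (n + 1) (s + io n c) y)
    (n : ℕ) (T : Q →L[𝕜] Q) :
    beta x g n T = (Fintype.card (Lab (n + 1)) : 𝕜)⁻¹ *
      ∑ c : Cc, ∑ s, g (n + 1) s (T (x (n + 1) (s + io n c))) := by
  unfold beta
  have e1 := sum_pr (fun s : Lab n => g n s (T (x n s)))
  have hc : Fintype.card Cc = 64 := by simp [ZMod.card]
  have e2 : ∑ s : Lab (n + 1), g n (rs n s) (T (x n (rs n s))) =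
      ∑ c : Cc, ∑ s, g (n + 1) s (T (x (n + 1) (s + io n c))) := by
    simp only [h1, h2, map_sum]
    have : ∀ c : Cc, ∑ s : Lab (n + 1), ∑ c' : Cc, g (n + 1) (s + io n c) (T (x (n + 1) (s + io n c')))
        = ∑ c : Cc, ∑ s, g (n + 1) s (T (x (n + 1) (s + io n c))) := by
      intro c
      have e3 : ∀ s : Lab (n + 1), ∑ c' : Cc, g (n + 1) (s + io n c) (T (x (n + 1) (s + io n c')))
        = ∑ c' : Cc, g (n + 1) (s + io n c) (T (x (n + 1) ((s + io n c) + io n c'))) := by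
        intro s
        rw [← Equiv.sum_comp (Equiv.addLeft c)]
        refine Finset.sum_congr rfl fun c' _ => ?_
        rw [Equiv.coe_addLeft, io_add, add_assoc]
      simp only [e3]
      rw [Finset.sum_comm (s := (Finset.univ : Finset Cc))]
      exact Equiv.sum_comp (Equiv.addRight (io n c)) (fun s => ∑ c' : Cc, g (n + 1) s
        (T (x (n + 1) (s + io n c'))))
    rw [← Finset.mul_sum, Finset.sum_comm, Finset.sum_congr rfl fun c _ => this c, Finset.sum_const,
      Finset.card_univ, hc, nsmul_eq_mul, ← mul_assoc]
    norm_num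
  rw [← e2, e1, card_lab]
  have := card_lab_ne' (𝕜 := 𝕜) n
  simp only [nsmul_eq_mul]
  push_cast
  field_simp

theorem enflo [T2Space Q] (x : ∀ n, Lab n → Q) (g : ∀ n, Lab n → Q →L[𝕜] 𝕜)
    (h1 : ∀ n (s : Lab (n + 1)), x n (rs n s) = ∑ c : Cc, x (n + 1) (s + io n c))
    (h2 : ∀ n (s : Lab (n + 1)) (y : Q),
      g n (rs n s) y = 64⁻¹ * ∑ c : Cc, g (n + 1) (s + io n c) y)
    (h3 : ∀ n s, g n s (x n s) = 1) (C : ℝ) (hC : 0 < C)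
    (hx : ∀ n (s : Lab (n + 1)), ‖x (n + 1) s‖ ≤ C * (2 ^ n)⁻¹)
    (hA : ∀ n R c A, Good 𝕜 n R c A → ∀ (s : Lab (n + 1)) (ε : (Fin R → ZMod 2) → 𝕜), (∀ δ, ‖ε δ‖ ≤ 1) →
      ‖∑ δ, ε δ • x (n + 1) (A δ s + c)‖ ≤ C * (2 ^ n)⁻¹)
    (hB : ∀ n R c A, Good 𝕜 n R c A → ∀ (s : Lab (n + 1)) (ε : (Fin R → ZMod 2) → 𝕜), (∀ δ, ‖ε δ‖ ≤ 1) → ∀ y : Q,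
      ‖∑ δ, ε δ * g (n + 1) (A δ s) y‖ ≤ C * √(2 ^ R) * 2 ^ n * ‖y‖) :
    ¬ HasAP 𝕜 Q := by
  intro hAP
  have hG : ∀ n (c : Cc), ∃ A : (Fin (4 * rr n) → ZMod 2) → Equiv.Perm (Lab (n + 1)),
      c ≠ 0 → Good 𝕜 n (4 * rr n) (io n c) A := by
    intro n c
    by_cases hc : c = 0
    · exact ⟨fun _ => 1, fun h => absurd hc h⟩
    · obtain ⟨A, hA⟩ := exists_good (𝕜 := 𝕜) (n := n) (R := 4 * rr n) (by unfold rr; omega) hc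
      exact ⟨A, fun _ => hA⟩
  choose A hGA using hG
  have hsq : ∀ n, √((2 : ℝ) ^ (4 * rr n)) = 4 ^ rr n := by
    intro n
    rw [show (2 : ℝ) ^ (4 * rr n) = (4 ^ rr n) ^ 2 by
      rw [← pow_mul, show (4 : ℝ) = 2 ^ 2 by norm_num, ← pow_mul]; congr 1; ring]
    exact Real.sqrt_sq (by positivity)
  have hcardΔ : ∀ n, (Fintype.card (Fin (4 * rr n) → ZMod 2) : ℝ) = 16 ^ rr n := by
    intro n
    simp only [Fintype.card_pi, ZMod.card, Finset.prod_const, Finset.card_univ, Fintype.card_fin]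
    push_cast
    rw [pow_mul]; norm_num
  -- compact set
  let W : ∀ n, Cc × Lab (n + 1) × ((Fin (4 * rr n) → ZMod 2) → ZMod 2) → Q := fun n w =>
    (((2 : 𝕜) ^ rr n)⁻¹ * 2 ^ n) • ∑ δ, sg 𝕜 (w.2.2 δ) • x (n + 1) (A n w.1 δ w.2.1 + io n w.1)
  let F : ℕ → Set Q := fun n => W n '' {w | w.1 ≠ 0}
  have hK1 : IsCompact (insert 0 (⋃ n, F n)) := by
    refine compact_null F (fun n => Set.toFinite _) (fun n => C * ((1 : ℝ) / 2) ^ rr n) ?_ ?_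
    · simpa using rr_summable.tendsto_atTop_zero.const_mul C
    · rintro n _ ⟨⟨c, s, ω⟩, hc, rfl⟩
      have := hA n _ _ _ (hGA n c hc) s (fun δ => sg 𝕜 (ω δ)) (fun δ => (sg_norm _).le)
      simp only [W, norm_smul, norm_mul, norm_inv, norm_pow, RCLike.norm_ofNat]
      calc _ ≤ ((2 : ℝ) ^ rr n)⁻¹ * 2 ^ n * (C * (2 ^ n)⁻¹) := by gcongr
        _ = _ := by rw [one_div, inv_pow]; field_simp
  have hK : IsCompact (insert 0 (⋃ n, F n) ∪ Set.range (x 0)) :=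
    hK1.union (Set.finite_range _).isCompact
  set Sr : ℝ := ∑' n, ((1 : ℝ) / 2) ^ rr n with hSr
  set M : ℝ := ‖(Fintype.card (Lab 0) : 𝕜)⁻¹‖ * ∑ s, ‖g 0 s‖ with hM
  have hM0 : 0 ≤ M := by positivity
  have hS0 : 0 ≤ Sr := tsum_nonneg fun n => by positivity
  set K0 : ℝ := M + 64 * C * Sr with hK0
  have hK00 : 0 ≤ K0 := by positivity
  set e : ℝ := 1 / (2 * (K0 + 1)) with he
  have he0 : 0 < e := by positivity
  obtain ⟨T, hfin, hT⟩ := hAP _ hK e he0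
  set D : Q →L[𝕜] Q := T - ContinuousLinearMap.id 𝕜 Q with hD
  have hDK : ∀ y ∈ (insert 0 (⋃ n, F n) ∪ Set.range (x 0)), ‖D y‖ ≤ e := fun y hy => (hT y hy).le
  have hβ : ∀ n, beta x g n D = beta x g n T - 1 := by
    intro n
    unfold beta
    have : ∀ s, g n s (D (x n s)) = g n s (T (x n s)) - 1 := by
      intro s
      rw [← h3 n s]
      simp [hD]
    simp only [this, Finset.sum_sub_distrib, mul_sub]
    rw [Finset.sum_const, Finset.card_univ, nsmul_eq_mul, mul_one, inv_mul_cancel₀ (card_lab_ne' n)]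
  have hb0 : ‖beta x g 0 D‖ ≤ M * e := by
    unfold beta
    rw [norm_mul, hM, mul_assoc, Finset.sum_mul]
    gcongr
    refine norm_sum_le_of_le _ fun s _ => ?_
    refine ((g 0 s).le_opNorm _).trans ?_
    gcongr
    exact hDK _ (Or.inr ⟨s, rfl⟩)
  have hstep : ∀ n, ‖beta x g (n + 1) D - beta x g n D‖ ≤ 64 * C * e * ((1 : ℝ) / 2) ^ rr n := by
    intro n
    rw [beta_step x g h1 h2 n D]
    have hc : ∀ c : Cc, c ≠ 0 → ‖∑ s, g (n + 1) s (D (x (n + 1) (s + io n c)))‖ ≤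
        Fintype.card (Lab (n + 1)) * (C * e * ((1 : ℝ) / 2) ^ rr n) := by
      intro c hc
      have := perm_avg (fun s => g (n + 1) s (D (x (n + 1) (s + io n c)))) (A n c)
        (C * e * 8 ^ rr n) (fun s => ?_)
      · rw [hcardΔ] at this
        have h16 : (16 : ℝ) ^ rr n = 2 ^ rr n * 8 ^ rr n := by rw [← mul_pow]; norm_num
        rw [h16] at this
        rw [one_div, inv_pow, ← mul_le_mul_iff_of_pos_left (show (0 : ℝ) < 2 ^ rr n * 8 ^ rr n by positivity)]
        refine this.trans (le_of_eq ?_)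
        field_simp
      · refine decouple (fun δ => g (n + 1) (A n c δ s))
          (fun δ => D (x (n + 1) (A n c δ s + io n c))) _ (fun ω => ?_)
        refine (hB n _ _ _ (hGA n c hc) s (fun δ => sg 𝕜 (ω δ)) (fun δ => (sg_norm _).le) _).trans ?_
        have hy := hDK (W n (c, s, ω)) (Or.inl (Or.inr (Set.mem_iUnion.mpr ⟨n, (c, s, ω), hc, rfl⟩)))
        simp only [W, map_smul, map_sum, norm_smul, norm_mul, norm_inv, norm_pow, RCLike.norm_ofNat] at hy
        rw [hsq]
        have h8 : (8 : ℝ) ^ rr n = 4 ^ rr n * 2 ^ rr n := by rw [← mul_pow]; norm_num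
        rw [h8]
        set Y := ‖∑ δ, sg 𝕜 (ω δ) • D (x (n + 1) (A n c δ s + io n c))‖ with hY
        have : 2 ^ n * Y ≤ e * 2 ^ rr n := by
          rw [inv_mul_eq_div, div_mul_eq_mul_div, div_le_iff₀ (by positivity)] at hy
          exact hy
        calc C * 4 ^ rr n * 2 ^ n * Y = C * 4 ^ rr n * (2 ^ n * Y) := by ring
          _ ≤ C * 4 ^ rr n * (e * 2 ^ rr n) := by gcongr
          _ = _ := by ring
    rw [← Finset.add_sum_erase _ _ (Finset.mem_univ (0 : Cc))]
    unfold beta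
    simp only [io_zero, add_zero]
    rw [mul_add, sub_add_cancel_left, norm_neg, norm_mul, norm_inv, RCLike.norm_natCast]
    have hsum : ‖∑ c ∈ Finset.univ.erase (0 : Cc), ∑ s, g (n + 1) s (D (x (n + 1) (s + io n c)))‖ ≤
        64 * (Fintype.card (Lab (n + 1)) * (C * e * ((1 : ℝ) / 2) ^ rr n)) := by
      refine (norm_sum_le_of_le _ fun c hc' => hc c (Finset.ne_of_mem_erase hc')).trans ?_
      rw [Finset.sum_const, nsmul_eq_mul]
      gcongr
      have : (Finset.univ.erase (0 : Cc)).card ≤ 64 := by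
        refine (Finset.card_erase_le).trans (le_of_eq ?_)
        simp [ZMod.card]
      exact_mod_cast this
    have hne := card_lab_ne (n + 1)
    calc _ ≤ (Fintype.card (Lab (n + 1)) : ℝ)⁻¹ *
        (64 * (Fintype.card (Lab (n + 1)) * (C * e * ((1 : ℝ) / 2) ^ rr n))) := by gcongr
      _ = _ := by field_simp
  have hN : ∀ N, ‖beta x g N D‖ ≤ 1 / 2 := by
    intro N
    have h4 : ‖beta x g N D‖ ≤ M * e + ∑ n ∈ Finset.range N, 64 * C * e * ((1 : ℝ) / 2) ^ rr n := by
      induction N with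
      | zero => simpa using hb0
      | succ N ih =>
        rw [Finset.sum_range_succ]
        have := hstep N
        have h5 := norm_sub_norm_le (beta x g (N + 1) D) (beta x g N D)
        linarith
    have h5 : ∑ n ∈ Finset.range N, ((1 : ℝ) / 2) ^ rr n ≤ Sr :=
      rr_summable.sum_le_tsum _ (fun n _ => by positivity)
    rw [← Finset.mul_sum] at h4
    have h6 : 64 * C * e * ∑ n ∈ Finset.range N, ((1 : ℝ) / 2) ^ rr n ≤ 64 * C * e * Sr := by gcongr
    have h7 : e * K0 ≤ 1 / 2 := by
      rw [he, div_mul_eq_mul_div, div_le_div_iff₀ (by positivity) (by norm_num)]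
      linarith
    rw [hK0] at h7
    linarith
  -- finite rank part
  have hlim : Tendsto (fun n => ‖beta x g (n + 1) T‖) atTop (𝓝 0) := by
    have hcoord : ∃ (k : ℕ) (v : Fin k → Q) (φ : Fin k → Q →L[𝕜] 𝕜), ∀ y, T y = ∑ i, φ i y • v i := by
      let V := LinearMap.range (T : Q →ₗ[𝕜] Q)
      let b := Module.finBasis 𝕜 V
      refine ⟨_, fun i => (b i : Q), fun i => (LinearMap.toContinuousLinearMap (b.coord i)).comp
        (T.codRestrict V (fun y => ⟨y, rfl⟩)), fun y => ?_⟩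
      have := congrArg (fun z : V => (z : Q)) (b.sum_repr (T.codRestrict V (fun y => ⟨y, rfl⟩) y))
      simp only [Submodule.coe_sum, Submodule.coe_smul] at this
      exact this.symm
    obtain ⟨k, v, φ, hφ⟩ := hcoord
    set Z := ∑ i, C * ‖φ i‖ * (C * ‖v i‖) with hZ
    have hbd : ∀ n, ‖beta x g (n + 1) T‖ ≤ Z * ((1 : ℝ) / 2) ^ rr n := by
      intro n
      obtain ⟨c, hc⟩ : ∃ c : Cc, c ≠ 0 :=
        ⟨((1, 0, 0), 0), fun h => absurd (congrArg (fun x : Cc => x.1.1) h) (by decide)⟩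
      have hs : ∀ s, ‖∑ δ, g (n + 1) (A n c δ s) (T (x (n + 1) (A n c δ s)))‖ ≤ Z * 4 ^ rr n := by
        intro s
        have e5 : ∑ δ, g (n + 1) (A n c δ s) (T (x (n + 1) (A n c δ s))) =
            ∑ i, ∑ δ, φ i (x (n + 1) (A n c δ s)) * g (n + 1) (A n c δ s) (v i) := by
          simp only [hφ, map_sum, map_smul, smul_eq_mul]
          rw [Finset.sum_comm]
        rw [e5, hZ, Finset.sum_mul]
        refine norm_sum_le_of_le _ fun i _ => ?_
        set t : ℝ := ‖φ i‖ * (C * (2 ^ n)⁻¹) with ht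
        have ht0 : 0 ≤ t := by positivity
        have hε : ∀ δ, ‖φ i (x (n + 1) (A n c δ s))‖ ≤ t := fun δ =>
          ((φ i).le_opNorm _).trans (by rw [ht]; gcongr; exact hx _ _)
        have := hB n _ _ _ (hGA n c hc) s (fun δ => (t : 𝕜)⁻¹ * φ i (x (n + 1) (A n c δ s)))
          (fun δ => by
            rw [norm_mul, norm_inv, RCLike.norm_ofReal, abs_of_nonneg ht0]
            exact inv_mul_le_one_of_le₀ (hε δ) ht0) (v i)
        have e6 : ∑ δ, φ i (x (n + 1) (A n c δ s)) * g (n + 1) (A n c δ s) (v i) =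
            (t : 𝕜) * ∑ δ, ((t : 𝕜)⁻¹ * φ i (x (n + 1) (A n c δ s))) * g (n + 1) (A n c δ s) (v i) := by
          rw [Finset.mul_sum]
          refine Finset.sum_congr rfl fun δ _ => ?_
          by_cases h0 : t = 0
          · have := hε δ
            rw [h0, norm_le_zero_iff] at this
            simp [this]
          · have : (t : 𝕜) ≠ 0 := by exact_mod_cast h0
            field_simp
        rw [e6, norm_mul, RCLike.norm_ofReal, abs_of_nonneg ht0]
        calc _ ≤ t * (C * √(2 ^ (4 * rr n)) * 2 ^ n * ‖v i‖) := by gcongr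
          _ = _ := by rw [hsq, ht]; field_simp
      have h7 := perm_avg (fun s => g (n + 1) s (T (x (n + 1) s))) (A n c) _ hs
      rw [hcardΔ] at h7
      have hZ0 : 0 ≤ Z := Finset.sum_nonneg fun i _ => by positivity
      have hcl := card_lab_ne (n + 1)
      have hcl' : (0 : ℝ) < Fintype.card (Lab (n + 1)) := lt_of_le_of_ne (Nat.cast_nonneg _) hcl.symm
      unfold beta
      rw [norm_mul, norm_inv, RCLike.norm_natCast, inv_mul_le_iff₀ hcl']
      have h16 : (16 : ℝ) ^ rr n = 2 ^ rr n * 2 ^ rr n * 4 ^ rr n := by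
        rw [← mul_pow, ← mul_pow]; norm_num
      have h2p : (1 : ℝ) ≤ 2 ^ rr n := one_le_pow₀ (by norm_num)
      rw [h16] at h7
      have h8 : 2 ^ rr n * 2 ^ rr n * ‖∑ s, g (n + 1) s (T (x (n + 1) s))‖ ≤
          Fintype.card (Lab (n + 1)) * Z := by
        have h4p : (0 : ℝ) < 4 ^ rr n := by positivity
        nlinarith
      rw [one_div, inv_pow, ← mul_assoc, ← div_eq_mul_inv, le_div_iff₀ (by positivity)]
      refine le_trans ?_ h8
      rw [mul_comm]
      gcongr
      nlinarith
    refine squeeze_zero (fun n => norm_nonneg _) hbd ?_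
    simpa using rr_summable.tendsto_atTop_zero.const_mul Z
  have h9 : ∀ n, 1 / 2 ≤ ‖beta x g (n + 1) T‖ := by
    intro n
    have h10 := hN (n + 1)
    rw [hβ] at h10
    have h11 := norm_sub_norm_le (1 : 𝕜) (beta x g (n + 1) T)
    rw [norm_one, norm_sub_rev] at h11
    linarith
  have := ge_of_tendsto' hlim h9
  norm_num at this

end
end SzP

namespace SzP
open Filter Topology

lemma pow_le_cexp (s : ℝ) (hs : 0 ≤ s) : ∃ C : ℝ, 0 ≤ C ∧ ∀ y : ℝ, 0 ≤ y → y ^ s ≤ C * Real.exp y := by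
  set k := ⌈s⌉₊ with hk
  refine ⟨1 + k.factorial, by positivity, fun y hy => ?_⟩
  have h1 : y ^ s ≤ 1 + y ^ k := by
    rcases le_total y 1 with h | h
    · have : y ^ s ≤ 1 := Real.rpow_le_one hy h hs
      have : 0 ≤ y ^ k := by positivity
      linarith
    · have : y ^ s ≤ y ^ (k : ℝ) := Real.rpow_le_rpow_of_exponent_le h (Nat.le_ceil s)
      rw [Real.rpow_natCast] at this
      linarith
  have h2 := Real.pow_div_factorial_le_exp y hy k
  rw [div_le_iff₀ (by positivity)] at h2
  have h3 := Real.one_le_exp hy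
  nlinarith

lemma exp_avg {ι : Type} [Fintype ι] [DecidableEq ι] (a : ι → ℝ) (ha : ∑ i, a i ^ 2 ≤ 1) :
    ∑ ω : ι → ZMod 2, Real.exp (∑ i, sg ℝ (ω i) * a i) ≤ 2 ^ Fintype.card ι * Real.exp 1 := by
  have h1 : ∑ ω : ι → ZMod 2, Real.exp (∑ i, sg ℝ (ω i) * a i) = ∏ i, (2 * Real.cosh (a i)) := by
    have h2 : ∀ i, 2 * Real.cosh (a i) = ∑ j : ZMod 2, Real.exp (sg ℝ j * a i) := by
      intro i
      rw [show (Finset.univ : Finset (ZMod 2)) = {0, 1} from rfl, Finset.sum_pair (by decide), Real.cosh_eq,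
        sg_zero, sg_one]
      simp
      ring
    simp only [h2, Real.exp_sum]
    rw [Finset.prod_univ_sum]
    simp
  rw [h1, Finset.prod_mul_distrib, Finset.prod_const, Finset.card_univ]
  gcongr
  calc ∏ i, Real.cosh (a i) ≤ ∏ i, Real.exp (a i ^ 2 / 2) :=
        Finset.prod_le_prod (fun i _ => (Real.cosh_pos _).le) (fun i _ => Real.cosh_le_exp_half_sq _)
    _ = Real.exp ((∑ i, a i ^ 2) / 2) := by rw [← Real.exp_sum, Finset.sum_div]
    _ ≤ _ := by
      apply Real.exp_le_exp.mpr
      have : 0 ≤ ∑ i, a i ^ 2 := Finset.sum_nonneg fun i _ => sq_nonneg _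
      linarith

lemma khin_real (s : ℝ) (hs : 0 ≤ s) : ∃ C : ℝ, 0 ≤ C ∧ ∀ (ι : Type) [Fintype ι] [DecidableEq ι]
    (a : ι → ℝ), ∑ i, a i ^ 2 ≤ 1 →
    ∑ ω : ι → ZMod 2, |∑ i, sg ℝ (ω i) * a i| ^ s ≤ C * 2 ^ Fintype.card ι := by
  obtain ⟨C, hC, h⟩ := pow_le_cexp s hs
  refine ⟨C * (2 * Real.exp 1), by positivity, fun ι _ _ a ha => ?_⟩
  have h1 := exp_avg a ha
  have h2 := exp_avg (fun i => - a i) (by simpa using ha)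
  calc _ ≤ ∑ ω : ι → ZMod 2, C * (Real.exp (∑ i, sg ℝ (ω i) * a i) + Real.exp (∑ i, sg ℝ (ω i) * (- a i))) := by
        refine Finset.sum_le_sum fun ω _ => (h _ (abs_nonneg _)).trans ?_
        gcongr
        simp only [mul_neg, Finset.sum_neg_distrib]
        exact Real.exp_abs_le _
    _ = C * (∑ ω : ι → ZMod 2, Real.exp (∑ i, sg ℝ (ω i) * a i) +
          ∑ ω : ι → ZMod 2, Real.exp (∑ i, sg ℝ (ω i) * (- a i))) := by
        rw [← Finset.mul_sum, Finset.sum_add_distrib]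
    _ ≤ C * (2 ^ Fintype.card ι * Real.exp 1 + 2 ^ Fintype.card ι * Real.exp 1) := by gcongr
    _ = _ := by ring

variable {𝕜 : Type*} [RCLike 𝕜]

lemma sg_re (a : ZMod 2) (z : 𝕜) : RCLike.re (sg 𝕜 a * z) = sg ℝ a * RCLike.re z := by
  rcases zmod2_cases a with rfl | rfl <;> simp [sg_zero, sg_one]

lemma sg_im (a : ZMod 2) (z : 𝕜) : RCLike.im (sg 𝕜 a * z) = sg ℝ a * RCLike.im z := by
  rcases zmod2_cases a with rfl | rfl <;> simp [sg_zero, sg_one]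

lemma khin (s : ℝ) (hs : 0 < s) : ∃ C : ℝ, 0 ≤ C ∧ ∀ (𝕜 : Type*) [RCLike 𝕜] (ι : Type) [Fintype ι]
    [DecidableEq ι] (a : ι → 𝕜),
    ∑ ω : ι → ZMod 2, ‖∑ i, sg 𝕜 (ω i) * a i‖ ^ s ≤
      C * 2 ^ Fintype.card ι * √(∑ i, ‖a i‖ ^ 2) ^ s := by
  obtain ⟨C, hC, h⟩ := khin_real s hs.le
  refine ⟨2 ^ s * (2 * C), by positivity, fun 𝕜 _ ι _ _ a => ?_⟩
  have norml : ∀ a : ι → 𝕜, ∑ i, ‖a i‖ ^ 2 ≤ 1 → ∑ ω : ι → ZMod 2, ‖∑ i, sg 𝕜 (ω i) * a i‖ ^ s ≤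
      2 ^ s * (2 * C) * 2 ^ Fintype.card ι := by
    intro a ha
    have h1 := h ι (fun i => RCLike.re (a i)) ((Finset.sum_le_sum fun i _ => by
      rw [← sq_abs]; gcongr; exact RCLike.abs_re_le_norm _).trans ha)
    have h2 := h ι (fun i => RCLike.im (a i)) ((Finset.sum_le_sum fun i _ => by
      rw [← sq_abs]; gcongr; exact RCLike.abs_im_le_norm _).trans ha)
    calc _ ≤ ∑ ω : ι → ZMod 2, 2 ^ s * (|∑ i, sg ℝ (ω i) * RCLike.re (a i)| ^ s +
          |∑ i, sg ℝ (ω i) * RCLike.im (a i)| ^ s) := by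
          refine Finset.sum_le_sum fun ω _ => ?_
          set z := ∑ i, sg 𝕜 (ω i) * a i with hz
          have hr : ∑ i, sg ℝ (ω i) * RCLike.re (a i) = RCLike.re z := by
            rw [hz, map_sum]; simp only [sg_re]
          have hi : ∑ i, sg ℝ (ω i) * RCLike.im (a i) = RCLike.im z := by
            rw [hz, map_sum]; simp only [sg_im]
          rw [hr, hi]
          have hle : ‖z‖ ≤ |RCLike.re z| + |RCLike.im z| := by
            have h5 := RCLike.norm_sq_eq_def (z := z)
            refine abs_le_of_sq_le_sq' ?_ (by positivity) |>.2
            nlinarith [abs_nonneg (RCLike.re z), abs_nonneg (RCLike.im z),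
              mul_nonneg (abs_nonneg (RCLike.re z)) (abs_nonneg (RCLike.im z)),
              abs_mul_abs_self (RCLike.re z), abs_mul_abs_self (RCLike.im z)]
          set u := |RCLike.re z|
          set v := |RCLike.im z|
          have hu : 0 ≤ u := abs_nonneg _
          have hv : 0 ≤ v := abs_nonneg _
          have hu' : 0 ≤ u ^ s := by positivity
          have hv' : 0 ≤ v ^ s := by positivity
          rcases le_total u v with huv | huv
          · calc ‖z‖ ^ s ≤ (2 * v) ^ s := by gcongr; linarith
              _ = 2 ^ s * v ^ s := Real.mul_rpow (by norm_num) hv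
              _ ≤ _ := by gcongr; linarith
          · calc ‖z‖ ^ s ≤ (2 * u) ^ s := by gcongr; linarith
              _ = 2 ^ s * u ^ s := Real.mul_rpow (by norm_num) hu
              _ ≤ _ := by gcongr; linarith
      _ = 2 ^ s * (∑ ω : ι → ZMod 2, |∑ i, sg ℝ (ω i) * RCLike.re (a i)| ^ s +
          ∑ ω : ι → ZMod 2, |∑ i, sg ℝ (ω i) * RCLike.im (a i)| ^ s) := by
          rw [← Finset.mul_sum, Finset.sum_add_distrib]
      _ ≤ 2 ^ s * (C * 2 ^ Fintype.card ι + C * 2 ^ Fintype.card ι) := by gcongr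
      _ = _ := by ring
  set N := √(∑ i, ‖a i‖ ^ 2) with hN
  have hN2 : N ^ 2 = ∑ i, ‖a i‖ ^ 2 := Real.sq_sqrt (Finset.sum_nonneg fun i _ => by positivity)
  by_cases h0 : N = 0
  · have ha : ∀ i, a i = 0 := by
      intro i
      rw [h0] at hN2
      have := (Finset.sum_eq_zero_iff_of_nonneg (fun i _ => by positivity)).mp
        (hN2.symm.trans (by norm_num)) i (Finset.mem_univ i)
      simpa using this
    simp [ha, h0, Real.zero_rpow hs.ne']
  · have hNp : 0 < N := lt_of_le_of_ne (Real.sqrt_nonneg _) (Ne.symm h0)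
    have h1 := norml (fun i => (N : 𝕜)⁻¹ * a i) (by
      simp only [norm_mul, norm_inv, RCLike.norm_ofReal, abs_of_pos hNp, mul_pow]
      rw [← Finset.mul_sum, ← hN2]
      field_simp
      rfl)
    have h2 : ∀ ω : ι → ZMod 2, ‖∑ i, sg 𝕜 (ω i) * a i‖ ^ s =
        N ^ s * ‖∑ i, sg 𝕜 (ω i) * ((N : 𝕜)⁻¹ * a i)‖ ^ s := by
      intro ω
      have : ∑ i, sg 𝕜 (ω i) * a i = (N : 𝕜) * ∑ i, sg 𝕜 (ω i) * ((N : 𝕜)⁻¹ * a i) := by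
        rw [Finset.mul_sum]
        refine Finset.sum_congr rfl fun i _ => ?_
        have : (N : 𝕜) ≠ 0 := by exact_mod_cast h0
        field_simp
      rw [this, norm_mul, RCLike.norm_ofReal, abs_of_pos hNp, Real.mul_rpow hNp.le (norm_nonneg _)]
    simp only [h2]
    rw [← Finset.mul_sum, mul_comm]
    gcongr

end SzP

namespace SzP
open Filter Topology

abbrev Om (L : ℕ) := Idx L → ZMod 2
abbrev JJ := Σ L, Om L

instance : Infinite JJ := Infinite.of_injective (fun L : ℕ => (⟨L, 0⟩ : JJ)) fun _ _ h =>
  congrArg Sigma.fst h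

def enc : Option JJ ≃ ℕ := (Classical.choice (nonempty_denumerable (Option JJ))).eqv

def eb (L : ℕ) (ω : Om L) : ℕ := enc (some ⟨L, ω⟩)

def i0 : ℕ := enc none

def cd (L : ℕ) : ℝ := 2 ^ Fintype.card (Idx L)

lemma cd_pos (L : ℕ) : 0 < cd L := by unfold cd; positivity

lemma sum_cover (F : ℕ → ℝ) (hF : ∀ k, 0 ≤ F k) (h0 : F i0 = 0) (s : Finset ℕ) :
    ∃ N, ∑ k ∈ s, F k ≤ ∑ L ∈ Finset.range N, ∑ ω : Om L, F (eb L ω) := by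
  classical
  let lev : ℕ → ℕ := fun k => match enc.symm k with
    | none => 0
    | some j => j.1
  refine ⟨s.sup lev + 1, ?_⟩
  let t : Finset ℕ := insert i0 (((Finset.range (s.sup lev + 1)).sigma (fun L => (Finset.univ : Finset (Om L)))).map
    (Function.Embedding.some.trans enc.toEmbedding))
  have hst : s ⊆ t := by
    intro k hk
    rcases h : enc.symm k with _ | ⟨L, ω⟩
    · apply Finset.mem_insert.mpr; left
      rw [Equiv.symm_apply_eq] at h; exact h
    · apply Finset.mem_insert.mpr; right
      rw [Finset.mem_map]
      refine ⟨⟨L, ω⟩, ?_, ?_⟩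
      · simp only [Finset.mem_sigma, Finset.mem_range, Finset.mem_univ, and_true]
        have := Finset.le_sup (f := lev) hk
        have h' : lev k = L := by simp only [lev, h]
        omega
      · rw [Equiv.symm_apply_eq] at h; exact h.symm
  refine (Finset.sum_le_sum_of_subset_of_nonneg hst fun k _ _ => hF k).trans (le_of_eq ?_)
  rw [Finset.sum_insert, h0, zero_add, Finset.sum_map, Finset.sum_sigma]
  · rfl
  · intro h
    rw [Finset.mem_map] at h
    obtain ⟨j, _, hj⟩ := h
    have := enc.injective hj
    simp at this

section
variable {𝕜 : Type*} [RCLike 𝕜]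

def asmF (p : ℝ) (a : ∀ L, Eu 𝕜 L) (k : ℕ) : 𝕜 := match enc.symm k with
  | none => 0
  | some ⟨L, ω⟩ => ((cd L ^ (-(1 / p)) : ℝ) : 𝕜) * ∑ i, sg 𝕜 (ω i) * a L i

lemma asmF_eb (p : ℝ) (a : ∀ L, Eu 𝕜 L) (L : ℕ) (ω : Om L) :
    asmF p a (eb L ω) = ((cd L ^ (-(1 / p)) : ℝ) : 𝕜) * ∑ i, sg 𝕜 (ω i) * a L i := by
  simp [asmF, eb]

lemma asmF_i0 (p : ℝ) (a : ∀ L, Eu 𝕜 L) : asmF p a i0 = 0 := by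
  simp [asmF, i0]

def Wf (p : ℝ) (L : ℕ) (u : ℕ → 𝕜) : Eu 𝕜 L :=
  WithLp.toLp 2 fun i => ((cd L ^ (1 / p - 1) : ℝ) : 𝕜) * ∑ ω : Om L, sg 𝕜 (ω i) * u (eb L ω)

lemma Wf_apply (p : ℝ) (L : ℕ) (u : ℕ → 𝕜) (i : Idx L) :
    (Wf p L u) i = ((cd L ^ (1 / p - 1) : ℝ) : 𝕜) * ∑ ω : Om L, sg 𝕜 (ω i) * u (eb L ω) := rfl

lemma Wf_asm (p : ℝ) (a : ∀ L, Eu 𝕜 L) (L : ℕ) : Wf p L (asmF p a) = a L := by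
  ext i
  rw [Wf_apply]
  have h1 : ∑ ω : Om L, sg 𝕜 (ω i) * asmF p a (eb L ω) =
      ((cd L ^ (-(1 / p)) : ℝ) : 𝕜) * ((cd L : ℝ) * a L i) := by
    simp only [asmF_eb, Finset.mul_sum]
    rw [Finset.sum_comm]
    have : ∀ j, ∑ ω : Om L, sg 𝕜 (ω i) * (((cd L ^ (-(1 / p)) : ℝ) : 𝕜) * (sg 𝕜 (ω j) * a L j)) =
        ((cd L ^ (-(1 / p)) : ℝ) : 𝕜) * ((if i = j then 2 ^ Fintype.card (Idx L) else 0) * a L j) := by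
      intro j
      rw [← sign_orth, Finset.sum_mul, Finset.mul_sum]
      refine Finset.sum_congr rfl fun _ _ => ?_
      ring
    simp only [this, ← Finset.mul_sum]
    simp only [ite_mul, zero_mul, Finset.sum_ite_eq, Finset.mem_univ, if_true]
    unfold cd
    push_cast
    rfl
  rw [h1, ← mul_assoc, ← mul_assoc, ← RCLike.ofReal_mul, ← RCLike.ofReal_mul,
    ← Real.rpow_add (cd_pos L)]
  nth_rewrite 2 [← Real.rpow_one (cd L)]
  rw [← Real.rpow_add (cd_pos L)]
  ring_nf
  simp

lemma asm_bd (q : ℝ) (hq : 0 < q) : ∃ K : ℝ, 0 ≤ K ∧ ∀ (a : ∀ L, Eu 𝕜 L) (L : ℕ),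
    ∑ ω : Om L, ‖asmF q a (eb L ω)‖ ^ q ≤ K * ‖a L‖ ^ q := by
  obtain ⟨C, hC, h⟩ := khin q hq
  refine ⟨C, hC, fun a L => ?_⟩
  have h1 := h 𝕜 (Idx L) (fun i => a L i)
  rw [← EuclideanSpace.norm_eq] at h1
  have hc := cd_pos L
  have h2 : ∀ ω : Om L, ‖asmF q a (eb L ω)‖ ^ q = (cd L)⁻¹ * ‖∑ i, sg 𝕜 (ω i) * a L i‖ ^ q := by
    intro ω
    rw [asmF_eb, norm_mul, RCLike.norm_ofReal, abs_of_pos (by positivity),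
      Real.mul_rpow (by positivity) (norm_nonneg _), ← Real.rpow_mul hc.le]
    congr 1
    rw [← Real.rpow_neg_one]
    congr 1
    field_simp
  simp only [h2]
  rw [← Finset.mul_sum, inv_mul_le_iff₀ hc]
  refine h1.trans (le_of_eq ?_)
  unfold cd
  ring

lemma asm_mem (q : ℝ≥0∞) [Fact (1 ≤ q)] (hq : q ≠ ⊤) : ∃ K : ℝ, 0 ≤ K ∧ ∀ (a : ∀ L, Eu 𝕜 L) (B : ℝ),
    0 ≤ B → (∀ N, ∑ L ∈ Finset.range N, ‖a L‖ ^ q.toReal ≤ B ^ q.toReal) →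
    ∃ h : Memℓp (asmF q.toReal a) q, ‖(⟨asmF q.toReal a, h⟩ : lp (fun _ : ℕ => 𝕜) q)‖ ≤ K * B := by
  have hq0 : 0 < q.toReal := ENNReal.toReal_pos (ne_of_gt (lt_of_lt_of_le one_pos Fact.out)) hq
  obtain ⟨K, hK, h⟩ := asm_bd (𝕜 := 𝕜) q.toReal hq0
  refine ⟨K ^ (1 / q.toReal), by positivity, fun a B hB hN => ?_⟩
  have key : ∀ s : Finset ℕ, ∑ k ∈ s, ‖asmF q.toReal a k‖ ^ q.toReal ≤ (K ^ (1 / q.toReal) * B) ^ q.toReal := by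
    intro s
    obtain ⟨N, hs⟩ := sum_cover (fun k => ‖asmF q.toReal a k‖ ^ q.toReal) (fun k => by positivity)
      (by rw [asmF_i0, norm_zero, Real.zero_rpow hq0.ne']) s
    refine hs.trans ?_
    rw [Real.mul_rpow (by positivity) hB, ← Real.rpow_mul hK, one_div_mul_cancel hq0.ne', Real.rpow_one]
    calc _ ≤ ∑ L ∈ Finset.range N, K * ‖a L‖ ^ q.toReal := Finset.sum_le_sum fun L _ => h a L
      _ = K * ∑ L ∈ Finset.range N, ‖a L‖ ^ q.toReal := by rw [Finset.mul_sum]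
      _ ≤ _ := by gcongr; exact hN N
  exact ⟨memℓp_gen' key, lp.norm_le_of_forall_sum_le hq0 (by positivity) key⟩

def alph (p : ℝ) (L : ℕ) (u : ℕ → 𝕜) : ℝ := ∑ ω : Om L, ‖u (eb L ω)‖ ^ p

lemma alph_nonneg (p : ℝ) (L : ℕ) (u : ℕ → 𝕜) : 0 ≤ alph p L u :=
  Finset.sum_nonneg fun _ _ => by positivity

lemma Wf_bd (p : ℝ) (hp : 1 < p) : ∃ K : ℝ, 0 ≤ K ∧ ∀ (L : ℕ) (u : ℕ → 𝕜),
    ‖Wf p L u‖ ≤ K * alph p L u ^ (1 / p) := by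
  set p' := p.conjExponent with hp'
  have hpp : p.HolderConjugate p' := Real.HolderConjugate.conjExponent hp
  obtain ⟨C, hC, h⟩ := khin p' hpp.symm.pos
  refine ⟨C ^ (1 / p'), by positivity, fun L u => ?_⟩
  set w := Wf p L u with hw
  set b : Idx L → 𝕜 := fun i => (starRingEnd 𝕜) (w i) with hb
  have hc := cd_pos L
  have hal := alph_nonneg p L u
  have h1 := h 𝕜 (Idx L) b
  have hbn : √(∑ i, ‖b i‖ ^ 2) = ‖w‖ := by
    rw [EuclideanSpace.norm_eq]; simp [hb]
  rw [hbn] at h1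
  have h2 : ((‖w‖ ^ 2 : ℝ) : 𝕜) = ((cd L ^ (1 / p - 1) : ℝ) : 𝕜) *
      ∑ ω : Om L, u (eb L ω) * ∑ i, sg 𝕜 (ω i) * b i := by
    rw [EuclideanSpace.norm_sq_eq]
    push_cast
    have : ∀ i, ((‖w i‖ : ℝ) : 𝕜) ^ 2 = b i * w i := fun i => by rw [hb]; simp only [RCLike.conj_mul]
    simp only [this]
    simp only [hw, Wf_apply, Finset.mul_sum]
    rw [Finset.sum_comm]
    refine Finset.sum_congr rfl fun ω _ => Finset.sum_congr rfl fun i _ => ?_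
    push_cast
    ring
  have h3 : ‖w‖ ^ 2 ≤ cd L ^ (1 / p - 1) * (alph p L u ^ (1 / p) * (C * cd L * ‖w‖ ^ p') ^ (1 / p')) := by
    calc ‖w‖ ^ 2 = ‖((‖w‖ ^ 2 : ℝ) : 𝕜)‖ := by
          rw [RCLike.norm_ofReal, abs_of_nonneg (by positivity)]
      _ ≤ cd L ^ (1 / p - 1) * ∑ ω : Om L, ‖u (eb L ω)‖ * ‖∑ i, sg 𝕜 (ω i) * b i‖ := by
          rw [h2, norm_mul, RCLike.norm_ofReal, abs_of_pos (by positivity)]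
          gcongr
          exact norm_sum_le_of_le _ fun ω _ => (norm_mul _ _).le
      _ ≤ cd L ^ (1 / p - 1) * (alph p L u ^ (1 / p) *
          (∑ ω : Om L, ‖∑ i, sg 𝕜 (ω i) * b i‖ ^ p') ^ (1 / p')) := by
          gcongr
          exact Real.inner_le_Lp_mul_Lq_of_nonneg _ hpp (fun _ _ => norm_nonneg _) (fun _ _ => norm_nonneg _)
      _ ≤ _ := by
          gcongr
          · exact one_div_nonneg.mpr hpp.symm.nonneg
          · exact h1
  have h4 : cd L ^ (1 / p - 1) * (alph p L u ^ (1 / p) * (C * cd L * ‖w‖ ^ p') ^ (1 / p')) =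
      (C ^ (1 / p') * alph p L u ^ (1 / p)) * ‖w‖ := by
    rw [Real.mul_rpow (by positivity) (by positivity), Real.mul_rpow hC hc.le,
      ← Real.rpow_mul (norm_nonneg w), mul_one_div_cancel hpp.symm.ne_zero, Real.rpow_one]
    have h5 : cd L ^ (1 / p - 1) * cd L ^ (1 / p') = 1 := by
      rw [← Real.rpow_add hc]
      have := hpp.inv_add_inv_eq_one
      rw [show 1 / p - 1 + 1 / p' = 0 by rw [one_div, one_div]; linarith, Real.rpow_zero]
    linear_combination (alph p L u ^ (1 / p) * C ^ (1 / p') * ‖w‖) * h5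
  rw [h4] at h3
  by_cases h0 : ‖w‖ = 0
  · rw [h0]; positivity
  · have : 0 < ‖w‖ := lt_of_le_of_ne (norm_nonneg _) (Ne.symm h0)
    nlinarith

lemma sum_alph (p : ℝ≥0∞) (hp0 : 0 < p.toReal) (u : lp (fun _ : ℕ => 𝕜) p) (s : Finset ℕ) :
    ∑ L ∈ s, alph p.toReal L u ≤ ‖u‖ ^ p.toReal := by
  unfold alph
  have := lp.sum_rpow_le_norm_rpow hp0 u ((s.sigma (fun L => (Finset.univ : Finset (Om L)))).map
    (Function.Embedding.some.trans enc.toEmbedding))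
  rw [Finset.sum_map, Finset.sum_sigma] at this
  exact this

end
end SzP

namespace SzP
open Filter Topology
section
variable {𝕜 : Type*} [RCLike 𝕜]

def asmL (p : ℝ) : (∀ L, Eu 𝕜 L) →ₗ[𝕜] (ℕ → 𝕜) where
  toFun := asmF p
  map_add' a b := by
    funext k
    rcases h : enc.symm k with _ | ⟨L, ω⟩
    · simp [asmF, h]
    · simp [asmF, h, mul_add, Finset.sum_add_distrib]
  map_smul' c a := by
    funext k
    rcases h : enc.symm k with _ | ⟨L, ω⟩
    · simp [asmF, h]
    · simp only [asmF, h, Pi.smul_apply, PiLp.smul_apply, smul_eq_mul, RingHom.id_apply, Finset.mul_sum]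
      refine Finset.sum_congr rfl fun i _ => ?_
      ring

lemma asmL_apply (p : ℝ) (a : ∀ L, Eu 𝕜 L) : asmL p a = asmF p a := rfl

lemma exists_W (p : ℝ≥0∞) [Fact (1 ≤ p)] (hp : 1 < p.toReal) : ∃ K : ℝ, 0 ≤ K ∧
    ∃ W : ∀ L, lp (fun _ : ℕ => 𝕜) p →L[𝕜] Eu 𝕜 L, (∀ L u, W L u = Wf p.toReal L u) ∧
      (∀ L u, ‖W L u‖ ≤ K * alph p.toReal L u ^ (1 / p.toReal)) ∧ ∀ L, ‖W L‖ ≤ K := by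
  have hp0 : 0 < p.toReal := by linarith
  obtain ⟨K, hK, h⟩ := Wf_bd (𝕜 := 𝕜) p.toReal hp
  have hb : ∀ (L : ℕ) (u : lp (fun _ : ℕ => 𝕜) p), ‖Wf p.toReal L u‖ ≤ K * ‖u‖ := by
    intro L u
    refine (h L u).trans ?_
    gcongr
    have := sum_alph p hp0 u {L}
    rw [Finset.sum_singleton] at this
    calc _ ≤ (‖u‖ ^ p.toReal) ^ (1 / p.toReal) := by
          gcongr
          exact alph_nonneg _ _ _
      _ = ‖u‖ := by
          rw [← Real.rpow_mul (norm_nonneg _), mul_one_div_cancel hp0.ne', Real.rpow_one]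
  let Wl : ∀ L, lp (fun _ : ℕ => 𝕜) p →ₗ[𝕜] Eu 𝕜 L := fun L =>
    { toFun := fun u => Wf p.toReal L u
      map_add' := fun u v => by
        ext i
        simp only [Wf_apply, PiLp.add_apply, lp.coeFn_add, Pi.add_apply, mul_add, Finset.sum_add_distrib]
      map_smul' := fun c u => by
        ext i
        simp only [Wf_apply, PiLp.smul_apply, lp.coeFn_smul, Pi.smul_apply, smul_eq_mul,
          RingHom.id_apply, Finset.mul_sum]
        refine Finset.sum_congr rfl fun i _ => ?_
        ring }
  refine ⟨K, hK, fun L => (Wl L).mkContinuous K (hb L), fun L u => rfl, fun L u => h L u, fun L => ?_⟩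
  exact LinearMap.mkContinuous_norm_le _ hK _

lemma exists_V (p : ℝ≥0∞) [Fact (1 ≤ p)] (hp : p ≠ ⊤) : ∃ K : ℝ, 0 ≤ K ∧
    ∃ V : ∀ L, Eu 𝕜 L →L[𝕜] lp (fun _ : ℕ => 𝕜) p,
      (∀ L a, (V L a : ℕ → 𝕜) = asmF p.toReal (Pi.single L a)) ∧ ∀ L, ‖V L‖ ≤ K := by
  have hp0 : 0 < p.toReal := ENNReal.toReal_pos (ne_of_gt (lt_of_lt_of_le one_pos Fact.out)) hp
  obtain ⟨K, hK, h⟩ := asm_mem (𝕜 := 𝕜) p hp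
  have hh : ∀ (L : ℕ) (a : Eu 𝕜 L), ∃ h : Memℓp (asmF p.toReal (Pi.single L a)) p,
      ‖(⟨_, h⟩ : lp (fun _ : ℕ => 𝕜) p)‖ ≤ K * ‖a‖ := by
    intro L a
    refine h _ _ (norm_nonneg a) fun N => ?_
    calc _ ≤ ∑ L' ∈ Finset.range N, if L' = L then ‖a‖ ^ p.toReal else 0 := by
          refine Finset.sum_le_sum fun L' _ => ?_
          split_ifs with h
          · subst h; rw [Pi.single_eq_same]
          · rw [Pi.single_eq_of_ne h, norm_zero, Real.zero_rpow hp0.ne']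
      _ ≤ _ := by
          rw [Finset.sum_ite_eq']
          split_ifs
          · exact le_rfl
          · positivity
  let Vl : ∀ L, Eu 𝕜 L →ₗ[𝕜] lp (fun _ : ℕ => 𝕜) p := fun L =>
    { toFun := fun a => ⟨_, (hh L a).choose⟩
      map_add' := fun a b => by
        apply lp.ext
        rw [lp.coeFn_add]
        change asmL p.toReal _ = asmL p.toReal _ + asmL p.toReal _
        rw [Pi.single_add, map_add]
      map_smul' := fun c a => by
        apply lp.ext
        rw [lp.coeFn_smul]
        change asmL p.toReal _ = _ • asmL p.toReal _
        rw [Pi.single_smul, map_smul, RingHom.id_apply] }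
  refine ⟨K, hK, fun L => (Vl L).mkContinuous K (fun a => (hh L a).choose_spec), fun L u => rfl, fun L => ?_⟩
  exact LinearMap.mkContinuous_norm_le _ hK _


def BF (𝕜 : Type*) [RCLike 𝕜] : Submodule 𝕜 (∀ L, Mat 𝕜 L) where
  carrier := {z | ∃ b : ℝ, ∀ L, ‖z L‖ ≤ b}
  add_mem' := by
    rintro z w ⟨b, hb⟩ ⟨c, hc⟩
    exact ⟨b + c, fun L => (norm_add_le _ _).trans (add_le_add (hb L) (hc L))⟩
  zero_mem' := ⟨0, fun L => by simp⟩
  smul_mem' := by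
    rintro c z ⟨b, hb⟩
    refine ⟨‖c‖ * b, fun L => ?_⟩
    rw [Pi.smul_apply, norm_smul]
    gcongr
    exact hb L

lemma lam_bd (p q : ℝ≥0∞) [Fact (1 ≤ p)] [Fact (1 ≤ q)] (hp0 : 0 < p.toReal)
    (hpq' : p.toReal ≤ q.toReal) (hq0 : 0 < q.toReal) (K5 : ℝ) (hasm : ∀ (a : ∀ L, Eu 𝕜 L) (B : ℝ),
      0 ≤ B → (∀ N, ∑ L ∈ Finset.range N, ‖a L‖ ^ q.toReal ≤ B ^ q.toReal) →
      ∃ h : Memℓp (asmF q.toReal a) q, ‖(⟨_, h⟩ : lp (fun _ : ℕ => 𝕜) q)‖ ≤ K5 * B)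
    (K3 : ℝ) (hK3 : 0 ≤ K3) (Wp : ∀ L, lp (fun _ : ℕ => 𝕜) p →L[𝕜] Eu 𝕜 L)
    (hWpb : ∀ L u, ‖Wp L u‖ ≤ K3 * alph p.toReal L u ^ (1 / p.toReal))
    (z : ∀ L, Mat 𝕜 L) (b : ℝ) (hb0 : 0 ≤ b) (hb : ∀ L, ‖z L‖ ≤ b) (u : lp (fun _ : ℕ => 𝕜) p) :
      ∃ h : Memℓp (asmF q.toReal (fun L => z L (Wp L u))) q,
      ‖(⟨_, h⟩ : lp (fun _ : ℕ => 𝕜) q)‖ ≤ K5 * (b * K3 * ‖u‖) := by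
  refine hasm _ _ (by positivity) fun N => ?_
  have h1 : ∀ L, ‖z L (Wp L u)‖ ^ q.toReal ≤
      (b * K3) ^ q.toReal * (‖u‖ ^ (q.toReal - p.toReal) * alph p.toReal L u) := by
    intro L
    have hal := alph_nonneg p.toReal L u
    have h2 : ‖z L (Wp L u)‖ ≤ (b * K3) * alph p.toReal L u ^ (1 / p.toReal) := by
      refine ((z L).le_opNorm _).trans ?_
      rw [mul_assoc]
      gcongr
      · exact hb L
      · exact hWpb L u
    have h3 : alph p.toReal L u ≤ ‖u‖ ^ p.toReal := by
      simpa using sum_alph p hp0 u {L}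
    have h4 : (alph p.toReal L u ^ (1 / p.toReal)) ^ q.toReal ≤
        ‖u‖ ^ (q.toReal - p.toReal) * alph p.toReal L u := by
      set t := alph p.toReal L u ^ (1 / p.toReal) with ht
      have ht0 : 0 ≤ t := by positivity
      have htp : t ^ p.toReal = alph p.toReal L u := by
        rw [ht, ← Real.rpow_mul hal, one_div_mul_cancel hp0.ne', Real.rpow_one]
      rw [← htp] at h3 ⊢
      have htu : t ≤ ‖u‖ := (Real.rpow_le_rpow_iff ht0 (norm_nonneg _) hp0).mp h3
      calc t ^ q.toReal = t ^ (q.toReal - p.toReal) * t ^ p.toReal := by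
            rw [← Real.rpow_add_of_nonneg ht0 (by linarith) hp0.le, sub_add_cancel]
        _ ≤ _ := by gcongr
    calc _ ≤ ((b * K3) * alph p.toReal L u ^ (1 / p.toReal)) ^ q.toReal := by gcongr
      _ = (b * K3) ^ q.toReal * (alph p.toReal L u ^ (1 / p.toReal)) ^ q.toReal :=
          Real.mul_rpow (by positivity) (by positivity)
      _ ≤ _ := by gcongr
  calc _ ≤ ∑ L ∈ Finset.range N, (b * K3) ^ q.toReal * (‖u‖ ^ (q.toReal - p.toReal) * alph p.toReal L u) :=
        Finset.sum_le_sum fun L _ => h1 L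
    _ = (b * K3) ^ q.toReal * (‖u‖ ^ (q.toReal - p.toReal) * ∑ L ∈ Finset.range N, alph p.toReal L u) := by
        rw [Finset.mul_sum, Finset.mul_sum]
    _ ≤ (b * K3) ^ q.toReal * (‖u‖ ^ (q.toReal - p.toReal) * ‖u‖ ^ p.toReal) := by
        gcongr
        exact sum_alph p hp0 u _
    _ = _ := by
        rw [← Real.rpow_add_of_nonneg (norm_nonneg _) (by linarith) hp0.le, sub_add_cancel,
          ← Real.mul_rpow (by positivity) (norm_nonneg _)]

theorem blocks (p q : ℝ≥0∞) [Fact (1 ≤ p)] [Fact (1 ≤ q)] (hp1 : 1 < p.toReal) (hp : p ≠ ⊤)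
    (hpq : p ≤ q) (hq : q ≠ ⊤) :
    ∃ C : ℝ, 0 ≤ C ∧ ∃ (V : ∀ L, Eu 𝕜 L →L[𝕜] lp (fun _ : ℕ => 𝕜) p)
      (W : ∀ L, lp (fun _ : ℕ => 𝕜) q →L[𝕜] Eu 𝕜 L)
      (Λ : BF 𝕜 →ₗ[𝕜] (lp (fun _ : ℕ => 𝕜) p →L[𝕜] lp (fun _ : ℕ => 𝕜) q)),
      (∀ (z : BF 𝕜) (b : ℝ), 0 ≤ b → (∀ L, ‖z.1 L‖ ≤ b) → ‖Λ z‖ ≤ C * b) ∧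
      (∀ L, ‖V L‖ ≤ C) ∧ (∀ L, ‖W L‖ ≤ C) ∧ (∀ z, Λ z (lp.single p i0 1) = 0) ∧
      (∀ z L a, W L (Λ z (V L a)) = z.1 L a) ∧
      (∀ y, Tendsto (fun L => ‖W L y‖) atTop (𝓝 0)) ∧
      (∀ z N, (∀ L, N ≤ L → z.1 L = 0) →
        FiniteDimensional 𝕜 (LinearMap.range ((Λ z : lp (fun _ : ℕ => 𝕜) p →L[𝕜] lp (fun _ : ℕ => 𝕜) q) :
          lp (fun _ : ℕ => 𝕜) p →ₗ[𝕜] lp (fun _ : ℕ => 𝕜) q))) := by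
  have hp0 : 0 < p.toReal := by linarith
  have hpq' : p.toReal ≤ q.toReal := ENNReal.toReal_mono hq hpq
  have hq1 : 1 < q.toReal := by linarith
  have hq0 : 0 < q.toReal := by linarith
  obtain ⟨K1, hK1, Vp, hVp, hVpn⟩ := exists_V (𝕜 := 𝕜) p hp
  obtain ⟨K2, hK2, Vq, hVq, hVqn⟩ := exists_V (𝕜 := 𝕜) q hq
  obtain ⟨K3, hK3, Wp, hWp, hWpb, hWpn⟩ := exists_W (𝕜 := 𝕜) p hp1
  obtain ⟨K4, hK4, Wq, hWq, hWqb, hWqn⟩ := exists_W (𝕜 := 𝕜) q hq1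
  obtain ⟨K5, hK5, hasm⟩ := asm_mem (𝕜 := 𝕜) q hq
  have hh := lam_bd p q hp0 hpq' hq0 K5 hasm K3 hK3 Wp hWpb
  have hm : ∀ (z : BF 𝕜) (u : lp (fun _ : ℕ => 𝕜) p),
      Memℓp (asmF q.toReal (fun L => z.1 L (Wp L u))) q := by
    intro z u
    obtain ⟨b, hb⟩ := z.2
    exact (hh z.1 b ((norm_nonneg _).trans (hb 0)) hb u).1
  let Λ0 : BF 𝕜 → lp (fun _ : ℕ => 𝕜) p →ₗ[𝕜] lp (fun _ : ℕ => 𝕜) q := fun z =>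
    { toFun := fun u => ⟨_, hm z u⟩
      map_add' := fun u v => by
        apply lp.ext
        rw [lp.coeFn_add]
        change asmL q.toReal _ = asmL q.toReal _ + asmL q.toReal _
        rw [← map_add]
        congr 1
        funext L
        simp only [map_add, Pi.add_apply]
      map_smul' := fun c u => by
        apply lp.ext
        rw [lp.coeFn_smul]
        change asmL q.toReal _ = _ • asmL q.toReal _
        rw [← map_smul]
        congr 1
        funext L
        simp only [map_smul, Pi.smul_apply, RingHom.id_apply] }
  have hΛb : ∀ (z : BF 𝕜) (b : ℝ), 0 ≤ b → (∀ L, ‖z.1 L‖ ≤ b) → ∀ u, ‖Λ0 z u‖ ≤ K5 * K3 * b * ‖u‖ := by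
    intro z b h0 hb u
    refine (hh z.1 b h0 hb u).2.trans (le_of_eq (by ring))
  have hΛe : ∀ z : BF 𝕜, ∃ C, ∀ u, ‖Λ0 z u‖ ≤ C * ‖u‖ := by
    intro z
    obtain ⟨b, hb⟩ := z.2
    exact ⟨_, hΛb z b ((norm_nonneg _).trans (hb 0)) hb⟩
  let Λ : BF 𝕜 →ₗ[𝕜] (lp (fun _ : ℕ => 𝕜) p →L[𝕜] lp (fun _ : ℕ => 𝕜) q) :=
    { toFun := fun z => (Λ0 z).mkContinuousOfExistsBound (hΛe z)
      map_add' := fun z w => by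
        apply ContinuousLinearMap.ext
        intro u
        apply lp.ext
        rw [ContinuousLinearMap.add_apply, lp.coeFn_add]
        change asmL q.toReal _ = asmL q.toReal _ + asmL q.toReal _
        rw [← map_add]
        rfl
      map_smul' := fun c z => by
        apply ContinuousLinearMap.ext
        intro u
        apply lp.ext
        rw [ContinuousLinearMap.smul_apply, lp.coeFn_smul]
        change asmL q.toReal _ = _ • asmL q.toReal _
        rw [← map_smul]
        rfl }
  have hΛ : ∀ (z : BF 𝕜) u, (Λ z u : ℕ → 𝕜) = asmF q.toReal (fun L => z.1 L (Wp L u)) := fun z u => rfl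
  refine ⟨max (K5 * K3) (max K1 K4), le_max_of_le_left (by positivity), Vp, Wq, Λ, fun z b h0 hb => ?_,
    fun L => (hVpn L).trans (le_max_of_le_right (le_max_left _ _)),
    fun L => (hWqn L).trans (le_max_of_le_right (le_max_right _ _)), ?_, ?_, ?_, ?_⟩
  · refine ContinuousLinearMap.opNorm_le_bound _ (by positivity) fun u => ?_
    refine (hΛb z b h0 hb u).trans ?_
    gcongr
    exact le_max_left _ _
  · intro z
    apply lp.ext
    rw [hΛ]
    have : ∀ L, Wp L (lp.single p i0 1) = 0 := by
      intro L
      rw [hWp]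
      ext i
      rw [Wf_apply]
      have : ∀ ω : Om L, (lp.single p i0 (1 : 𝕜) : lp (fun _ : ℕ => 𝕜) p) (eb L ω) = 0 := by
        intro ω
        apply lp.single_apply_ne
        intro h
        have := enc.injective h
        simp at this
      simp only [this, mul_zero, Finset.sum_const_zero, PiLp.zero_apply]
    simp only [this, map_zero]
    change asmL q.toReal 0 = _
    rw [map_zero]
    rfl
  · intro z L a
    rw [hWq, hΛ, Wf_asm, hWp, hVp, Wf_asm, Pi.single_eq_same]
  · intro y
    have hs : Summable fun L => alph q.toReal L y :=
      summable_of_sum_le (fun L => alph_nonneg _ _ _) (sum_alph q hq0 y)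
    have h1 : Tendsto (fun L => K4 * alph q.toReal L y ^ (1 / q.toReal)) atTop (𝓝 (K4 * 0 ^ (1 / q.toReal))) :=
      (hs.tendsto_atTop_zero.rpow_const (Or.inr (by positivity))).const_mul K4
    rw [Real.zero_rpow (by positivity), mul_zero] at h1
    exact squeeze_zero (fun L => norm_nonneg _) (fun L => hWqb L y) h1
  · intro z N hz
    let G : (∀ L : Fin N, Eu 𝕜 L) →ₗ[𝕜] lp (fun _ : ℕ => 𝕜) q :=
      ∑ L : Fin N, (Vq L : Eu 𝕜 L →ₗ[𝕜] lp (fun _ : ℕ => 𝕜) q) ∘ₗ LinearMap.proj L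
    refine Submodule.finiteDimensional_of_le (S₂ := LinearMap.range G) ?_
    rintro _ ⟨u, rfl⟩
    refine ⟨fun L => z.1 L (Wp L u), ?_⟩
    apply lp.ext
    change _ = asmL q.toReal (fun L => z.1 L (Wp L u))
    have hfam : (fun L => z.1 L (Wp L u)) = ∑ L : Fin N, Pi.single (M := fun L => Eu 𝕜 L) (L : ℕ) (z.1 L (Wp L u)) := by
      rw [Fin.sum_univ_eq_sum_range (fun L => Pi.single (M := fun L => Eu 𝕜 L) L (z.1 L (Wp L u))) N]
      funext L
      rw [Finset.sum_apply]
      by_cases hL : L < N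
      · rw [Finset.sum_eq_single_of_mem L (Finset.mem_range.mpr hL), Pi.single_eq_same]
        intro b _ hb
        exact Pi.single_eq_of_ne hb.symm _
      · rw [hz L (not_lt.mp hL), Finset.sum_eq_zero]
        · rfl
        · intro b hb
          have : L ≠ b := by have := Finset.mem_range.mp hb; omega
          exact Pi.single_eq_of_ne this _
    rw [hfam, map_sum]
    simp only [G, LinearMap.sum_apply, LinearMap.comp_apply, LinearMap.proj_apply]
    rw [lp.coeFn_sum]
    refine Finset.sum_congr rfl fun L _ => ?_
    exact hVq _ _

end
end SzP

namespace SzP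
open Filter Topology
section
variable {𝕜 : Type*} [RCLike 𝕜] {E F : Type*} [NormedAddCommGroup E] [NormedSpace 𝕜 E]
  [NormedAddCommGroup F] [NormedSpace 𝕜 F]

lemma sign_prod {d : ℕ} (r : Fin d → Fin d) :
    ∑ ε : Fin d → ZMod 2, (∏ i, sg 𝕜 (ε i)) * ∏ j, sg 𝕜 (ε (r j)) =
      if Function.Bijective r then 2 ^ d else 0 := by
  classical
  split_ifs with h
  · have : ∀ ε : Fin d → ZMod 2, (∏ i, sg 𝕜 (ε i)) * ∏ j, sg 𝕜 (ε (r j)) = 1 := by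
      intro ε
      rw [h.prod_comp (fun j => sg 𝕜 (ε j)), ← Finset.prod_mul_distrib]
      simp [sg_mul_self]
    simp [this, ZMod.card]
  · have hs : ¬ Function.Surjective r := fun hs => h (Finite.injective_iff_bijective.mp
      (Finite.injective_iff_surjective.mpr hs))
    simp only [Function.Surjective, not_forall, not_exists] at hs
    obtain ⟨i, hi⟩ := hs
    have h1 := (Equiv.sum_comp (Equiv.addRight (Pi.single i 1 : Fin d → ZMod 2))
      (fun ε : Fin d → ZMod 2 => (∏ i, sg 𝕜 (ε i)) * ∏ j, sg 𝕜 (ε (r j)))).symm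
    have h2 : ∀ ε : Fin d → ZMod 2, (∏ k, sg 𝕜 ((Equiv.addRight (Pi.single i 1 : Fin d → ZMod 2) ε) k)) *
        ∏ j, sg 𝕜 ((Equiv.addRight (Pi.single i 1 : Fin d → ZMod 2) ε) (r j)) =
        - ((∏ i, sg 𝕜 (ε i)) * ∏ j, sg 𝕜 (ε (r j))) := by
      intro ε
      simp only [Equiv.coe_addRight, Pi.add_apply, sg_add, Finset.prod_mul_distrib]
      have e1 : ∏ k, sg 𝕜 ((Pi.single i 1 : Fin d → ZMod 2) k) = -1 := by
        rw [Finset.prod_eq_single i]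
        · rw [Pi.single_eq_same, sg_one]
        · intro b _ hb
          rw [Pi.single_eq_of_ne hb, sg_zero]
        · simp
      have e2 : ∏ j, sg 𝕜 ((Pi.single i 1 : Fin d → ZMod 2) (r j)) = 1 := by
        refine Finset.prod_eq_one fun j _ => ?_
        rw [Pi.single_eq_of_ne (hi j), sg_zero]
      rw [e1, e2]
      ring
    rw [Finset.sum_congr rfl fun ε _ => h2 ε, Finset.sum_neg_distrib] at h1
    exact self_eq_neg.mp h1

def pk (d : ℕ) : ℕ := Nat.card {r : Fin d → Fin d // Function.Bijective r} * 2 ^ d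

lemma pk_ne (d : ℕ) : pk d ≠ 0 := by
  have : Nonempty {r : Fin d → Fin d // Function.Bijective r} := ⟨⟨id, Function.bijective_id⟩⟩
  exact mul_ne_zero Nat.card_pos.ne' (by simp)

lemma polarize {d : ℕ} (P : HomPoly 𝕜 d E F) (v : Fin d → E) :
    (pk d : 𝕜) • P.1 v = ∑ ε : Fin d → ZMod 2,
      (∏ i, sg 𝕜 (ε i)) • P.eval (∑ i, sg 𝕜 (ε i) • v i) := by
  classical
  have h1 : ∀ ε : Fin d → ZMod 2, P.eval (∑ i, sg 𝕜 (ε i) • v i) =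
      ∑ r : Fin d → Fin d, (∏ j, sg 𝕜 (ε (r j))) • P.1 (v ∘ r) := by
    intro ε
    unfold HomPoly.eval
    rw [ContinuousMultilinearMap.map_sum]
    refine Finset.sum_congr rfl fun r _ => ?_
    exact P.1.map_smul_univ (fun j => sg 𝕜 (ε (r j))) (fun j => v (r j))
  have h2 : ∑ ε : Fin d → ZMod 2, (∏ i, sg 𝕜 (ε i)) • P.eval (∑ i, sg 𝕜 (ε i) • v i) =
      ∑ r : Fin d → Fin d, if Function.Bijective r then (2 ^ d : 𝕜) • P.1 v else 0 := by
    simp_rw [h1, Finset.smul_sum, smul_smul]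
    rw [Finset.sum_comm]
    refine Finset.sum_congr rfl fun r _ => ?_
    rw [← Finset.sum_smul, sign_prod]
    split_ifs with h
    · have := P.2 (Equiv.ofBijective r h) v
      rw [Equiv.coe_ofBijective] at this
      rw [this]
    · rw [zero_smul]
  rw [h2, ← Finset.sum_filter, Finset.sum_const, ← Nat.cast_smul_eq_nsmul 𝕜, smul_smul, pk,
    Nat.card_eq_fintype_card, Fintype.card_subtype]
  push_cast
  rfl

/-- the basic multilinear map -/
def f0 (m : ℕ) (φ : E →L[𝕜] 𝕜) : (E →L[𝕜] F) →L[𝕜] ContinuousMultilinearMap 𝕜 (fun _ : Fin (m + 1) => E) F :=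
  ((continuousMultilinearCurryLeftEquiv 𝕜 (fun _ : Fin (m + 1) => E) F).symm.toContinuousLinearEquiv :
    _ →L[𝕜] ContinuousMultilinearMap 𝕜 (fun _ : Fin (m + 1) => E) F) ∘L
    ContinuousLinearMap.compL 𝕜 E F _ (ContinuousMultilinearMap.smulRightL 𝕜 (fun _ : Fin m => E) F
      ((ContinuousMultilinearMap.mkPiAlgebra 𝕜 (Fin m) 𝕜).compContinuousLinearMap (fun _ => φ)))

lemma f0_apply (m : ℕ) (φ : E →L[𝕜] 𝕜) (T : E →L[𝕜] F) (v : Fin (m + 1) → E) :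
    f0 m φ T v = (∏ j : Fin m, φ (v j.succ)) • T (v 0) := by
  rfl

def th0 (m : ℕ) (φ : E →L[𝕜] 𝕜) : (E →L[𝕜] F) →L[𝕜] ContinuousMultilinearMap 𝕜 (fun _ : Fin (m + 1) => E) F :=
  ∑ σ : Equiv.Perm (Fin (m + 1)),
   ((ContinuousMultilinearMap.domDomCongrₗᵢ 𝕜 E F σ).toContinuousLinearEquiv : _ →L[𝕜] _) ∘L f0 m φ

lemma th0_apply (m : ℕ) (φ : E →L[𝕜] 𝕜) (T : E →L[𝕜] F) (v : Fin (m + 1) → E) :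
    th0 m φ T v = ∑ σ : Equiv.Perm (Fin (m + 1)), (∏ j : Fin m, φ (v (σ j.succ))) • T (v (σ 0)) := by
  unfold th0
  rw [ContinuousLinearMap.sum_apply, ContinuousMultilinearMap.sum_apply]
  rfl

lemma th0_mem (m : ℕ) (φ : E →L[𝕜] 𝕜) (T : E →L[𝕜] F) : th0 m φ T ∈ SymmCM 𝕜 (m + 1) E F := by
  intro τ v
  rw [th0_apply, th0_apply]
  exact Fintype.sum_equiv (Equiv.mulLeft τ) _ _ fun σ => rfl

/-- symmetrized polynomial of an operator -/
def th (m : ℕ) (φ : E →L[𝕜] 𝕜) : (E →L[𝕜] F) →L[𝕜] HomPoly 𝕜 (m + 1) E F :=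
  (th0 m φ).codRestrict _ (th0_mem m φ)

/-- freezing all but one variable -/
def fz (m : ℕ) (e : E) : HomPoly 𝕜 (m + 1) E F →L[𝕜] (E →L[𝕜] F) :=
  (ContinuousLinearMap.compL 𝕜 E _ F (ContinuousMultilinearMap.apply 𝕜 (fun _ : Fin m => E) F (fun _ => e))) ∘L
  ((continuousMultilinearCurryLeftEquiv 𝕜 (fun _ : Fin (m + 1) => E) F).toContinuousLinearEquiv :
    ContinuousMultilinearMap 𝕜 (fun _ : Fin (m + 1) => E) F →L[𝕜] _) ∘L
  (SymmCM 𝕜 (m + 1) E F).subtypeL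

lemma th_bd (m : ℕ) (φ : E →L[𝕜] 𝕜) : ∃ K : ℝ, 0 ≤ K ∧ ∀ T : E →L[𝕜] F, ‖th m φ T‖ ≤ K * ‖T‖ :=
  ⟨‖(th0 m φ : (E →L[𝕜] F) →L[𝕜] _)‖, ContinuousLinearMap.opNorm_nonneg _, fun T => (th0 m φ).le_opNorm T⟩

lemma fz_bd (m : ℕ) (e : E) : ∃ K : ℝ, 0 ≤ K ∧ ∀ P : HomPoly 𝕜 (m + 1) E F, ‖fz m e P‖ ≤ K * ‖P‖ := by
  refine ⟨‖e‖ ^ m, by positivity, fun P => ?_⟩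
  refine ContinuousLinearMap.opNorm_le_bound _ (by positivity) fun u => ?_
  refine (P.1.le_opNorm _).trans (le_of_eq ?_)
  rw [Fin.prod_univ_succ]
  simp only [Fin.cons_zero, Fin.cons_succ, Finset.prod_const, Finset.card_univ, Fintype.card_fin]
  change ‖P‖ * _ = _
  ring

lemma fz_apply (m : ℕ) (e : E) (P : HomPoly 𝕜 (m + 1) E F) (u : E) :
    fz m e P u = P.1 (Fin.cons u fun _ => e) := rfl

def kk (m : ℕ) : ℕ := (Finset.univ.filter fun σ : Equiv.Perm (Fin (m + 1)) => σ 0 = 0).card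

lemma kk_ne (m : ℕ) : kk m ≠ 0 :=
  (Finset.card_pos.mpr ⟨1, by simp⟩).ne'

lemma fz_th (m : ℕ) (φ : E →L[𝕜] 𝕜) (e : E) (he : φ e = 1) (T : E →L[𝕜] F) (hT : T e = 0) (u : E) :
    fz m e (th m φ T) u = (kk m : 𝕜) • T u := by
  rw [fz_apply]
  change th0 m φ T _ = _
  rw [th0_apply]
  have h : ∀ σ : Equiv.Perm (Fin (m + 1)),
      (∏ j : Fin m, φ ((Fin.cons u (fun _ => e) : Fin (m + 1) → E) (σ j.succ))) •
        T ((Fin.cons u (fun _ => e) : Fin (m + 1) → E) (σ 0)) = if σ 0 = 0 then T u else 0 := by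
    intro σ
    split_ifs with h
    · rw [h, Fin.cons_zero, Finset.prod_eq_one, one_smul]
      intro j _
      have : σ j.succ ≠ 0 := by
        rw [← h]
        intro h'
        exact Fin.succ_ne_zero j (σ.injective h')
      obtain ⟨k, hk⟩ := Fin.exists_succ_eq.mpr this
      rw [← hk, Fin.cons_succ, he]
    · obtain ⟨k, hk⟩ := Fin.exists_succ_eq.mpr h
      rw [← hk, Fin.cons_succ, hT, smul_zero]
  rw [Finset.sum_congr rfl fun σ _ => h σ, ← Finset.sum_filter, Finset.sum_const, Nat.cast_smul_eq_nsmul]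
  rfl

lemma th_compact (m : ℕ) (φ : E →L[𝕜] 𝕜) (T : E →L[𝕜] F)
    (hT : FiniteDimensional 𝕜 (LinearMap.range (T : E →ₗ[𝕜] F))) :
    th m φ T ∈ compactPolys 𝕜 (m + 1) E F := by
  intro S hS
  obtain ⟨R, hR0, hR⟩ := hS.exists_pos_norm_le
  set X := LinearMap.range (T : E →ₗ[𝕜] F)
  set P := th m φ T
  haveI : ProperSpace X := FiniteDimensional.proper 𝕜 X
  have hc : IsCompact ((Subtype.val : X → F) '' Metric.closedBall 0 (‖P‖ * R ^ (m + 1))) :=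
    (isCompact_closedBall _ _).image continuous_subtype_val
  refine hc.of_isClosed_subset isClosed_closure (closure_minimal ?_ hc.isClosed)
  rintro _ ⟨x, hx, rfl⟩
  have hmem : P.eval x ∈ X := by
    change th0 m φ T _ ∈ X
    rw [th0_apply]
    exact Submodule.sum_mem _ fun σ _ => Submodule.smul_mem _ _ ⟨_, rfl⟩
  refine ⟨⟨P.eval x, hmem⟩, ?_, rfl⟩
  rw [mem_closedBall_zero_iff]
  change ‖P.1 _‖ ≤ _
  refine (P.1.le_opNorm _).trans ?_
  rw [Finset.prod_const, Finset.card_univ, Fintype.card_fin]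
  gcongr
  · exact le_rfl
  · exact hR x hx

/-- uniform convergence on compact sets -/
lemma unif_compact {G : ℕ → Type*} [∀ L, NormedAddCommGroup (G L)] [∀ L, NormedSpace 𝕜 (G L)]
    (Φ : ∀ L, F →L[𝕜] G L) (C : ℝ) (hC : ∀ L, ‖Φ L‖ ≤ C)
    (h0 : ∀ y, Tendsto (fun L => ‖Φ L y‖) atTop (𝓝 0)) (K : Set F) (hK : IsCompact K) (η : ℝ) (hη : 0 < η) :
    ∃ N, ∀ L, N ≤ L → ∀ y ∈ K, ‖Φ L y‖ ≤ η := by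
  have hC0 : 0 ≤ C := (norm_nonneg _).trans (hC 0)
  obtain ⟨t, htK, htf, hcov⟩ := Metric.finite_approx_of_totallyBounded hK.totallyBounded (η / (2 * (C + 1))) (by positivity)
  have h1 : ∀ᶠ L in atTop, ∀ y ∈ t, ‖Φ L y‖ < η / 2 :=
    (Filter.eventually_all_finite htf).mpr fun y _ => (h0 y).eventually (gt_mem_nhds (by positivity))
  obtain ⟨N, hN⟩ := eventually_atTop.mp h1
  refine ⟨N, fun L hL y hy => ?_⟩
  obtain ⟨w, hw, hyw⟩ := Set.mem_iUnion₂.mp (hcov hy)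
  rw [Metric.mem_ball, dist_eq_norm] at hyw
  have e1 : Φ L y = Φ L (y - w) + Φ L w := by rw [← map_add, sub_add_cancel]
  have e2 : ‖Φ L (y - w)‖ ≤ η / 2 := by
    refine ((Φ L).le_opNorm _).trans ?_
    calc _ ≤ (C + 1) * (η / (2 * (C + 1))) := by
          gcongr
          linarith [hC L]
      _ = η / 2 := by field_simp
  rw [e1]
  have := norm_add_le (Φ L (y - w)) (Φ L w)
  have := hN L hL w hw
  linarith

lemma compact_fz {G : ℕ → Type*} [∀ L, NormedAddCommGroup (G L)] [∀ L, NormedSpace 𝕜 (G L)]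
    (Φ : ∀ L, F →L[𝕜] G L) (C : ℝ) (hC : ∀ L, ‖Φ L‖ ≤ C)
    (h0 : ∀ y, Tendsto (fun L => ‖Φ L y‖) atTop (𝓝 0)) (m : ℕ) (e : E) (P : HomPoly 𝕜 (m + 1) E F)
    (hP : P ∈ compactPolys 𝕜 (m + 1) E F) (η : ℝ) (hη : 0 < η) :
    ∃ N, ∀ L, N ≤ L → ‖(Φ L) ∘L (fz m e P)‖ ≤ η := by
  have hK := hP (Metric.closedBall 0 (1 + m * ‖e‖)) Metric.isBounded_closedBall
  have hpk : (0 : ℝ) < pk (m + 1) := by exact_mod_cast Nat.pos_of_ne_zero (pk_ne _)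
  obtain ⟨N, hN⟩ := unif_compact Φ C hC h0 _ hK (η * pk (m + 1) / 2 ^ (m + 1)) (by positivity)
  refine ⟨N, fun L hL => ?_⟩
  refine ContinuousLinearMap.opNorm_le_of_unit_norm (𝕜 := 𝕜) hη.le fun u hu => ?_
  rw [ContinuousLinearMap.comp_apply, fz_apply]
  set v : Fin (m + 1) → E := Fin.cons u fun _ => e with hv
  have h1 := congrArg (Φ L) (polarize P v)
  rw [map_smul, map_sum] at h1
  have h2 := congrArg norm h1
  rw [norm_smul, RCLike.norm_natCast] at h2
  have h3 : ‖∑ ε : Fin (m + 1) → ZMod 2, Φ L ((∏ i, sg 𝕜 (ε i)) • P.eval (∑ i, sg 𝕜 (ε i) • v i))‖ ≤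
      ∑ ε : Fin (m + 1) → ZMod 2, η * pk (m + 1) / 2 ^ (m + 1) := by
    refine norm_sum_le_of_le _ fun ε _ => ?_
    rw [map_smul, norm_smul, norm_prod]
    simp only [sg_norm, Finset.prod_const_one, one_mul]
    refine hN L hL _ (subset_closure ⟨_, ?_, rfl⟩)
    rw [mem_closedBall_zero_iff]
    refine (norm_sum_le _ _).trans ?_
    simp only [norm_smul, sg_norm, one_mul]
    rw [Fin.sum_univ_succ]
    simp [hv, hu]
  rw [Finset.sum_const, Finset.card_univ, nsmul_eq_mul] at h3
  simp only [Fintype.card_pi, ZMod.card, Finset.prod_const, Finset.card_univ, Fintype.card_fin] at h3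
  push_cast at h3
  rw [mul_div_cancel₀ _ (by positivity), ← h2, mul_comm] at h3
  exact le_of_mul_le_mul_right h3 hpk
end
end SzP

namespace SzP
open Filter Topology
section
variable {𝕜 : Type*} [RCLike 𝕜] {E F : Type*} [NormedAddCommGroup E] [NormedSpace 𝕜 E]
  [NormedAddCommGroup F] [NormedSpace 𝕜 F]

lemma compactPolys_closed [CompleteSpace F] (n : ℕ) :
    IsClosed (compactPolys 𝕜 n E F : Set (HomPoly 𝕜 n E F)) := by
  rw [← isSeqClosed_iff_isClosed]
  intro Ps P hPs hlim S hS
  obtain ⟨R, hR0, hR⟩ := hS.exists_pos_norm_le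
  refine TotallyBounded.isCompact_of_isClosed (TotallyBounded.closure ?_) isClosed_closure
  rw [Metric.totallyBounded_iff]
  intro ε hε
  have h1 : ∀ᶠ k in atTop, dist (Ps k) P < ε / 2 / R ^ n :=
    (tendsto_iff_dist_tendsto_zero.mp hlim).eventually (gt_mem_nhds (by positivity))
  obtain ⟨k, hk⟩ := h1.exists
  have h2 := (hPs k S hS).totallyBounded.subset subset_closure
  obtain ⟨t, ht, hcov⟩ := Metric.totallyBounded_iff.mp h2 (ε / 2) (by positivity)
  refine ⟨t, ht, ?_⟩
  rintro _ ⟨x, hx, rfl⟩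
  obtain ⟨w, hw, hyw⟩ := Set.mem_iUnion₂.mp (hcov ⟨x, hx, rfl⟩)
  refine Set.mem_iUnion₂.mpr ⟨w, hw, ?_⟩
  rw [Metric.mem_ball] at hyw ⊢
  have h3 : dist (P.eval x) ((Ps k).eval x) ≤ ε / 2 := by
    rw [dist_comm, dist_eq_norm]
    rw [dist_eq_norm] at hk
    have : (Ps k).eval x - P.eval x = (Ps k - P).1 (fun _ => x) := rfl
    rw [this]
    refine ((Ps k - P).1.le_opNorm _).trans ?_
    rw [Finset.prod_const, Finset.card_univ, Fintype.card_fin]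
    calc _ ≤ ε / 2 / R ^ n * R ^ n := by
          gcongr
          · exact hk.le
          · exact hR x hx
      _ = ε / 2 := by field_simp
  linarith [dist_triangle (P.eval x) ((Ps k).eval x) w]

set_option maxHeartbeats 2000000 in
lemma poly_data (p q : ℝ≥0∞) [Fact (1 ≤ p)] [Fact (1 ≤ q)] (hp1 : 1 < p.toReal) (hp : p ≠ ⊤)
    (hpq : p ≤ q) (hq : q ≠ ⊤) (m : ℕ)
    (hE : ∃ (A : lp (fun _ : ℕ => 𝕜) p →L[𝕜] E) (B : E →L[𝕜] lp (fun _ : ℕ => 𝕜) p),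
      B.comp A = ContinuousLinearMap.id 𝕜 (lp (fun _ : ℕ => 𝕜) p))
    (hF : ∃ (A : lp (fun _ : ℕ => 𝕜) q →L[𝕜] F) (B : F →L[𝕜] lp (fun _ : ℕ => 𝕜) q),
      B.comp A = ContinuousLinearMap.id 𝕜 (lp (fun _ : ℕ => 𝕜) q)) :
    ∃ (C : ℝ) (Θ : BF 𝕜 →ₗ[𝕜] HomPoly 𝕜 (m + 1) E F)
      (Ξ : ∀ L, HomPoly 𝕜 (m + 1) E F →ₗ[𝕜] Mat 𝕜 L), 0 < C ∧
      (∀ (z : BF 𝕜) (b : ℝ), 0 ≤ b → (∀ L, ‖z.1 L‖ ≤ b) → ‖Θ z‖ ≤ C * b) ∧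
      (∀ L P, ‖Ξ L P‖ ≤ C * ‖P‖) ∧ (∀ L z, Ξ L (Θ z) = z.1 L) ∧
      (∀ P ∈ compactPolys 𝕜 (m + 1) E F, Tendsto (fun L => ‖Ξ L P‖) atTop (𝓝 0)) ∧
      (∀ (z : BF 𝕜) N, (∀ L, N ≤ L → z.1 L = 0) → Θ z ∈ compactPolys 𝕜 (m + 1) E F) := by
  obtain ⟨A1, B1, h1⟩ := hE
  obtain ⟨A2, B2, h2⟩ := hF
  obtain ⟨C, hC, V, W, Λ, hΛ, hV, hW, hΛ0, hWV, hW0, hfin⟩ := blocks (𝕜 := 𝕜) p q hp1 hp hpq hq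
  have h1' : ∀ x, B1 (A1 x) = x := fun x => congrArg (fun f => f x) h1
  have h2' : ∀ x, B2 (A2 x) = x := fun x => congrArg (fun f => f x) h2
  let φ : E →L[𝕜] 𝕜 := (lp.evalCLM 𝕜 (fun _ : ℕ => 𝕜) p i0) ∘L B1
  let e : E := A1 (lp.single p i0 1)
  have he : φ e = 1 := by
    change (B1 (A1 (lp.single p i0 1)) : ℕ → 𝕜) i0 = 1
    rw [h1', lp.single_apply_self]
  let T : BF 𝕜 →ₗ[𝕜] (E →L[𝕜] F) :=
    { toFun := fun z => A2 ∘L (Λ z) ∘L B1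
      map_add' := fun z w => by
        rw [map_add, ContinuousLinearMap.add_comp, ContinuousLinearMap.comp_add]
      map_smul' := fun c z => by
        rw [map_smul, ContinuousLinearMap.smul_comp, ContinuousLinearMap.comp_smul]
        rfl }
  have hTe : ∀ z, T z e = 0 := by
    intro z
    change A2 (Λ z (B1 (A1 _))) = 0
    rw [h1', hΛ0, map_zero]
  let Ξ : ∀ L, HomPoly 𝕜 (m + 1) E F →ₗ[𝕜] Mat 𝕜 L := fun L =>
    { toFun := fun P => (kk m : 𝕜)⁻¹ • (((W L ∘L B2) ∘L fz m e P) ∘L (A1 ∘L V L))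
      map_add' := fun P Q => by
        rw [map_add, ContinuousLinearMap.comp_add, ContinuousLinearMap.add_comp, smul_add]
      map_smul' := fun c P => by
        rw [map_smul, ContinuousLinearMap.comp_smul, ContinuousLinearMap.smul_comp, smul_comm]
        rfl }
  have hkk : (kk m : 𝕜) ≠ 0 := by exact_mod_cast kk_ne m
  have hΞ : ∀ L P, ‖Ξ L P‖ ≤ ‖(kk m : 𝕜)⁻¹‖ * (‖(W L ∘L B2) ∘L fz m e P‖ * (‖A1‖ * C)) := by
    intro L P
    change ‖(kk m : 𝕜)⁻¹ • (((W L ∘L B2) ∘L fz m e P) ∘L (A1 ∘L V L))‖ ≤ _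
    rw [norm_smul]
    gcongr
    refine (ContinuousLinearMap.opNorm_comp_le _ _).trans ?_
    gcongr
    refine (ContinuousLinearMap.opNorm_comp_le _ _).trans ?_
    gcongr
    exact hV L
  have hWB : ∀ L, ‖W L ∘L B2‖ ≤ C * ‖B2‖ := by
    intro L
    refine (ContinuousLinearMap.opNorm_comp_le _ _).trans ?_
    gcongr
    exact hW L
  let Θ : BF 𝕜 →ₗ[𝕜] HomPoly 𝕜 (m + 1) E F :=
    { toFun := fun z => th m φ (T z)
      map_add' := fun z w => by rw [map_add, map_add]
      map_smul' := fun c z => by rw [map_smul, map_smul, RingHom.id_apply] }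
  obtain ⟨K1, hK1, hth⟩ := th_bd (F := F) m φ
  obtain ⟨K2, hK2, hfz⟩ := fz_bd (𝕜 := 𝕜) (F := F) m e
  set D1 : ℝ := K1 * (‖A2‖ * (C * ‖B1‖)) with hD1
  set D2 : ℝ := ‖(kk m : 𝕜)⁻¹‖ * ((C * ‖B2‖) * K2 * (‖A1‖ * C)) with hD2
  have hD10 : 0 ≤ D1 := by positivity
  have hD20 : 0 ≤ D2 := by positivity
  refine ⟨D1 + D2 + 1, Θ, Ξ, by positivity, ?_, ?_, ?_, ?_, ?_⟩
  · intro z b hb hz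
    have e1 : ‖Θ z‖ ≤ D1 * b := by
      refine (hth (T z)).trans ?_
      rw [hD1, mul_assoc]
      gcongr
      change ‖A2 ∘L (Λ z) ∘L B1‖ ≤ _
      refine (ContinuousLinearMap.opNorm_comp_le _ _).trans ?_
      rw [mul_assoc]
      gcongr
      refine (ContinuousLinearMap.opNorm_comp_le _ _).trans ?_
      rw [mul_right_comm]
      gcongr
      exact hΛ z b hb hz
    refine e1.trans ?_
    gcongr
    linarith
  · intro L P
    have e1 : ‖Ξ L P‖ ≤ D2 * ‖P‖ := by
      refine (hΞ L P).trans ?_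
      have : ‖(W L ∘L B2) ∘L fz m e P‖ ≤ (C * ‖B2‖) * (K2 * ‖P‖) := by
        refine (ContinuousLinearMap.opNorm_comp_le _ _).trans ?_
        gcongr
        · exact hWB L
        · exact hfz P
      calc _ ≤ ‖(kk m : 𝕜)⁻¹‖ * (((C * ‖B2‖) * (K2 * ‖P‖)) * (‖A1‖ * C)) := by
            gcongr
        _ = _ := by rw [hD2]; ring
    refine e1.trans ?_
    gcongr
    linarith
  · intro L z
    apply ContinuousLinearMap.ext
    intro a
    change (kk m : 𝕜)⁻¹ • W L (B2 (fz m e (th m φ (T z)) (A1 (V L a)))) = _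
    rw [fz_th m φ e he _ (hTe z), map_smul, map_smul, smul_smul, inv_mul_cancel₀ hkk, one_smul]
    change W L (B2 (A2 (Λ z (B1 (A1 (V L a)))))) = _
    rw [h1', h2', hWV]
  · intro P hP
    have e1 : Tendsto (fun L => ‖(W L ∘L B2) ∘L fz m e P‖) atTop (𝓝 0) := by
      rw [Metric.tendsto_atTop]
      intro ε hε
      obtain ⟨N, hN⟩ := compact_fz (fun L => W L ∘L B2) (C * ‖B2‖) hWB (fun y => hW0 (B2 y)) m e P hP (ε / 2)
        (by positivity)
      refine ⟨N, fun L hL => ?_⟩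
      rw [dist_zero_right, norm_norm]
      have := hN L hL
      linarith
    have e2 := (e1.mul_const (‖A1‖ * C)).const_mul ‖(kk m : 𝕜)⁻¹‖
    rw [zero_mul, mul_zero] at e2
    exact squeeze_zero (fun _ => norm_nonneg _) (fun L => hΞ L P) e2
  · intro z N hz
    apply th_compact
    have := hfin z N hz
    have e1 : LinearMap.range (T z : E →ₗ[𝕜] F) ≤ (LinearMap.range ((Λ z : lp (fun _ : ℕ => 𝕜) p →L[𝕜] lp (fun _ : ℕ => 𝕜) q) :
          lp (fun _ : ℕ => 𝕜) p →ₗ[𝕜] lp (fun _ : ℕ => 𝕜) q)).map (A2 : lp (fun _ : ℕ => 𝕜) q →ₗ[𝕜] F) := by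
      rintro _ ⟨u, rfl⟩
      exact ⟨Λ z (B1 u), ⟨_, rfl⟩, rfl⟩
    exact Submodule.finiteDimensional_of_le e1

end
end SzP

namespace SzP
open Filter Topology
section
variable {𝕜 : Type*} [RCLike 𝕜] {X : Type*} [SeminormedAddCommGroup X] [NormedSpace 𝕜 X]

lemma qbound (S : Submodule 𝕜 X) (f : X ⧸ S → ℝ) (K : ℝ) (hK : 0 ≤ K)
    (h : ∀ P : X, f (Submodule.Quotient.mk P) ≤ K * ‖P‖) (y : X ⧸ S) : f y ≤ K * ‖y‖ := by
  refine le_of_forall_pos_le_add fun ε hε => ?_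
  obtain ⟨P, rfl, hP⟩ := Submodule.Quotient.norm_mk_lt y (show 0 < ε / (K + 1) by positivity)
  refine (h P).trans ?_
  calc K * ‖P‖ ≤ K * (‖(Submodule.Quotient.mk P : X ⧸ S)‖ + ε / (K + 1)) := by gcongr
    _ = K * ‖(Submodule.Quotient.mk P : X ⧸ S)‖ + K * (ε / (K + 1)) := mul_add _ _ _
    _ ≤ _ := by
      gcongr
      calc K * (ε / (K + 1)) ≤ (K + 1) * (ε / (K + 1)) := by gcongr; linarith
        _ = ε := by field_simp

lemma ulim (S : Submodule 𝕜 X) (f : ℕ → X →ₗ[𝕜] 𝕜) (K : ℝ) (hK : 0 ≤ K) (N : ℕ)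
    (hf : ∀ L, N ≤ L → ∀ P, ‖f L P‖ ≤ K * ‖P‖) (hS : ∀ P ∈ S, Tendsto (fun L => f L P) atTop (𝓝 0)) :
    ∃ g : (X ⧸ S) →L[𝕜] 𝕜, ∀ P, Tendsto (fun L => f L P) (hyperfilter ℕ : Filter ℕ)
      (𝓝 (g (Submodule.Quotient.mk P))) := by
  have hU : (hyperfilter ℕ : Filter ℕ) ≤ atTop := by
    rw [← Nat.cofinite_eq_atTop]; exact hyperfilter_le_cofinite
  have hev : ∀ᶠ L in (hyperfilter ℕ : Filter ℕ), N ≤ L := hU (eventually_ge_atTop N)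
  have hex : ∀ P, ∃ a, Tendsto (fun L => f L P) (hyperfilter ℕ : Filter ℕ) (𝓝 a) ∧ ‖a‖ ≤ K * ‖P‖ := by
    intro P
    have hc : IsCompact (Metric.closedBall (0 : 𝕜) (K * ‖P‖)) := isCompact_closedBall _ _
    obtain ⟨a, ha, hle⟩ := hc.ultrafilter_le_nhds ((hyperfilter ℕ).map fun L => f L P) (by
      rw [Ultrafilter.coe_map, le_principal_iff, mem_map]
      filter_upwards [hev] with L hL
      simpa using hf L hL P)
    exact ⟨a, hle, by simpa using ha⟩
  choose g0 hg0 hg0n using hex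
  let g1 : X →ₗ[𝕜] 𝕜 :=
    { toFun := g0
      map_add' := fun P Q => tendsto_nhds_unique (hg0 (P + Q)) (by
        simpa only [map_add] using (hg0 P).add (hg0 Q))
      map_smul' := fun c P => tendsto_nhds_unique (hg0 (c • P)) (by
        simpa only [map_smul, RingHom.id_apply] using (hg0 P).const_smul c) }
  have hker : S ≤ LinearMap.ker g1 := by
    intro P hP
    rw [LinearMap.mem_ker]
    exact tendsto_nhds_unique (hg0 P) ((hS P hP).mono_left hU)
  refine ⟨(S.liftQ g1 hker).mkContinuous K ?_, fun P => hg0 P⟩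
  intro y
  exact qbound S (fun y => ‖S.liftQ g1 hker y‖) K hK (fun P => hg0n P) y

end

section
variable {𝕜 : Type*} [RCLike 𝕜]

def yf (𝕜 : Type*) [RCLike 𝕜] {n : ℕ} (s : Lab n) : BF 𝕜 :=
  ⟨fun L => yh 𝕜 L s, ⟨(2 ^ n)⁻¹, fun _ => yh_bd s⟩⟩

lemma yf_coe {n : ℕ} (s : Lab n) (L : ℕ) : (yf 𝕜 s).1 L = yh 𝕜 L s := rfl

lemma BF_sub (z w : BF 𝕜) (L : ℕ) : (z - w).1 L = z.1 L - w.1 L := rfl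

set_option maxHeartbeats 2000000 in
theorem abs_main {X : Type*} [SeminormedAddCommGroup X] [NormedSpace 𝕜 X] (S : Submodule 𝕜 X)
    (hcl : IsClosed (S : Set X)) (C : ℝ) (Θ : BF 𝕜 →ₗ[𝕜] X)
      (Ξ : ∀ L, X →ₗ[𝕜] Mat 𝕜 L) (hC : 0 < C)
      (hΘ : ∀ (z : BF 𝕜) (b : ℝ), 0 ≤ b → (∀ L, ‖z.1 L‖ ≤ b) → ‖Θ z‖ ≤ C * b)
      (hΞ : ∀ L P, ‖Ξ L P‖ ≤ C * ‖P‖) (hΞΘ : ∀ L z, Ξ L (Θ z) = z.1 L)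
      (hS : ∀ P ∈ S, Tendsto (fun L => ‖Ξ L P‖) atTop (𝓝 0))
      (hfin : ∀ (z : BF 𝕜) N, (∀ L, N ≤ L → z.1 L = 0) → Θ z ∈ S) : ¬ HasAP 𝕜 (X ⧸ S) := by
  have hU : (hyperfilter ℕ : Filter ℕ) ≤ atTop := by
    rw [← Nat.cofinite_eq_atTop]; exact hyperfilter_le_cofinite
  have hev : ∀ N, ∀ᶠ L in (hyperfilter ℕ : Filter ℕ), N ≤ L := fun N => hU (eventually_ge_atTop N)
  have hg : ∀ (n : ℕ) (s : Lab n), ∃ g : (X ⧸ S) →L[𝕜] 𝕜, ∀ P,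
      Tendsto (fun L => ys 𝕜 L s (Ξ L P)) (hyperfilter ℕ : Filter ℕ) (𝓝 (g (Submodule.Quotient.mk P))) := by
    intro n s
    refine ulim S (fun L => ys 𝕜 L s ∘ₗ Ξ L) (2 ^ (n + 1) * C) (by positivity) (n + 1) ?_ ?_
    · intro L hL P
      refine (ys_bd (Nat.lt_of_succ_le hL) s _).trans ?_
      rw [mul_assoc]
      gcongr
      exact hΞ L P
    · intro P hP
      have h1 := (hS P hP).const_mul (2 ^ (n + 1) : ℝ)
      rw [mul_zero] at h1
      refine squeeze_zero_norm' ?_ h1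
      filter_upwards [eventually_ge_atTop (n + 1)] with L hL
      exact ys_bd (Nat.lt_of_succ_le hL) s _
  choose g hg using hg
  haveI : T2Space (X ⧸ S) := by
    haveI := hcl
    infer_instance
  have hsum : ∀ {ι : Type} (t : Finset ι) (ε : ι → 𝕜) (z : ι → BF 𝕜),
      ∑ i ∈ t, ε i • (Submodule.Quotient.mk (Θ (z i)) : X ⧸ S) =
      Submodule.Quotient.mk (Θ (∑ i ∈ t, ε i • z i)) := by
    intro ι t ε z
    rw [map_sum]
    simp only [map_smul, ← Submodule.mkQ_apply, map_sum]
  have hcoe : ∀ {ι : Type} (t : Finset ι) (ε : ι → 𝕜) (z : ι → BF 𝕜) (L : ℕ),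
      (∑ i ∈ t, ε i • z i).1 L = ∑ i ∈ t, ε i • (z i).1 L := by
    intro ι t ε z L
    rw [AddSubmonoidClass.coe_finset_sum, Finset.sum_apply]
    rfl
  refine enflo (fun n s => Submodule.Quotient.mk (Θ (yf 𝕜 s))) g ?_ ?_ ?_ (2 * C) (by positivity) ?_ ?_ ?_
  · intro n s
    have h1 := hsum Finset.univ (fun _ : Cc => (1 : 𝕜)) (fun c => yf 𝕜 (s + io n c))
    simp only [one_smul] at h1
    rw [h1, Submodule.Quotient.eq, ← map_sub]
    refine hfin _ (n + 1) fun L hL => ?_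
    have h2 := hcoe Finset.univ (fun _ : Cc => (1 : 𝕜)) (fun c => yf 𝕜 (s + io n c)) L
    simp only [one_smul] at h2
    rw [BF_sub, h2, yf_coe, yh_part (Nat.lt_of_succ_le hL) s]
    simp only [yf_coe]
    exact sub_self _
  · intro n s y
    obtain ⟨P, rfl⟩ := Submodule.Quotient.mk_surjective S y
    refine tendsto_nhds_unique (hg n (rs n s) P) ?_
    have h1 : Tendsto (fun L => 64⁻¹ * ∑ c : Cc, ys 𝕜 L (s + io n c) (Ξ L P)) (hyperfilter ℕ : Filter ℕ)
        (𝓝 (64⁻¹ * ∑ c : Cc, g (n + 1) (s + io n c) (Submodule.Quotient.mk P))) :=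
      (tendsto_finsetSum _ fun c _ => hg (n + 1) (s + io n c) P).const_mul _
    refine h1.congr' ?_
    filter_upwards [hev (n + 1)] with L hL
    rw [ys_part (Nat.lt_of_succ_le hL) s]
  · intro n s
    refine tendsto_nhds_unique (hg n s _) (tendsto_const_nhds.congr' ?_)
    filter_upwards [hev n] with L hL
    rw [hΞΘ, yf_coe]
    exact (ys_yh hL s).symm
  · intro n s
    refine (Submodule.Quotient.norm_mk_le S _).trans ((hΘ _ (2 ^ (n + 1))⁻¹ (by positivity) fun L => ?_).trans ?_)
    · rw [yf_coe]
      exact yh_bd s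
    have : ((2 : ℝ) ^ (n + 1))⁻¹ ≤ (2 ^ n)⁻¹ := by
      gcongr
      · norm_num
      · omega
    have h0 : (0 : ℝ) < (2 ^ n)⁻¹ := by positivity
    nlinarith
  · intro n R c A hA s ε hε
    rw [hsum]
    refine (Submodule.Quotient.norm_mk_le S _).trans ((hΘ _ (2 ^ (n + 1))⁻¹ (by positivity) fun L => ?_).trans ?_)
    · rw [hcoe]
      simp only [yf_coe]
      exact yh_good hA L s ε hε
    have : ((2 : ℝ) ^ (n + 1))⁻¹ ≤ (2 ^ n)⁻¹ := by
      gcongr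
      · norm_num
      · omega
    have h0 : (0 : ℝ) < (2 ^ n)⁻¹ := by positivity
    nlinarith
  · intro n R c A hA s ε hε y
    refine qbound S (fun y => ‖∑ δ, ε δ * g (n + 1) (A δ s) y‖) _ (by positivity) (fun P => ?_) y
    have h1 : Tendsto (fun L => ‖∑ δ, ε δ * ys 𝕜 L (A δ s) (Ξ L P)‖) (hyperfilter ℕ : Filter ℕ)
        (𝓝 ‖∑ δ, ε δ * g (n + 1) (A δ s) (Submodule.Quotient.mk P)‖) :=
      (tendsto_finsetSum _ fun δ _ => (hg (n + 1) (A δ s) P).const_mul _).norm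
    refine le_of_tendsto h1 ?_
    filter_upwards [hev (n + 1)] with L hL
    refine (ys_good hA (Nat.lt_of_succ_le hL) s ε hε _).trans ?_
    calc _ ≤ √(2 ^ R) * 2 ^ (n + 1) * (C * ‖P‖) := by
          gcongr
          exact hΞ L P
      _ = _ := by ring

end
end SzP

/-- If `n < p ≤ q < ∞` and `E`, `F` contain complemented copies of `ℓ_p`, `ℓ_q` respectively,
then the quotient `P(ⁿE;F)/P_K(ⁿE;F)` fails the approximation property. -/
theorem not_ap_quotient_polySpace (𝕜 : Type*) [RCLike 𝕜] (p q : ℝ≥0∞)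
    [Fact (1 ≤ p)] [Fact (1 ≤ q)]
    (n : ℕ) (hn : 1 ≤ n) (hnp : (n : ℝ≥0∞) < p) (hpq : p ≤ q) (hq : q < ⊤)
    (E F : Type*) [NormedAddCommGroup E] [NormedSpace 𝕜 E] [CompleteSpace E]
    [NormedAddCommGroup F] [NormedSpace 𝕜 F] [CompleteSpace F]
    (hE : ∃ (A : lp (fun _ : ℕ => 𝕜) p →L[𝕜] E) (B : E →L[𝕜] lp (fun _ : ℕ => 𝕜) p),
      B.comp A = ContinuousLinearMap.id 𝕜 (lp (fun _ : ℕ => 𝕜) p))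
    (hF : ∃ (A : lp (fun _ : ℕ => 𝕜) q →L[𝕜] F) (B : F →L[𝕜] lp (fun _ : ℕ => 𝕜) q),
      B.comp A = ContinuousLinearMap.id 𝕜 (lp (fun _ : ℕ => 𝕜) q)) :
    ¬ HasAP 𝕜 (HomPoly 𝕜 n E F ⧸ compactPolys 𝕜 n E F) := by
  obtain ⟨m, rfl⟩ : ∃ m, n = m + 1 := ⟨n - 1, by omega⟩
  have hp : p ≠ ⊤ := (lt_of_le_of_lt hpq hq).ne
  have hp1 : 1 < p.toReal := by
    have h1 : (1 : ℝ≥0∞) < p := lt_of_le_of_lt (by exact_mod_cast hn) hnp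
    rw [← ENNReal.toReal_one]
    exact (ENNReal.toReal_lt_toReal ENNReal.one_ne_top hp).mpr h1
  obtain ⟨C, Θ, Ξ, hC, h1, h2, h3, h4, h5⟩ :=
    SzP.poly_data (𝕜 := 𝕜) (E := E) (F := F) p q hp1 hp hpq hq.ne m hE hF
  have hcl := SzP.compactPolys_closed (𝕜 := 𝕜) (E := E) (F := F) (m + 1)
  have key := SzP.abs_main (𝕜 := 𝕜) (X := HomPoly 𝕜 (m + 1) E F) (compactPolys 𝕜 (m + 1) E F) hcl C Θ Ξ hC
  have key2 := key h1
  have key3 := key2 h2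
  have key4 := key3 h3
  have key5 := key4 h4 
  have key6 := key5 h5
  exact key6
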